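/- There exist an infinite-dimensional separable real Banach space Z which is an L∞-space, is hereditarily indecomposable and has the scalar-plus-compact property, together with a family (Y_α)_{α∈I} of infinite-dimensional closed subspaces of Z indexed by a set I of cardinality of the continuum, such that: (i) each Y_α is an L∞-space and has the scalar-plus-compact property; (ii) for all α ≠ β, every bounded linear operator T : Y_α → Y_β is compact; (iii) each quotient X_α = Z/Y_α is an infinite-dimensional hereditarily indecomposable Banach space with the scalar-plus-compact property; (iv) for all α ≠ β, every bounded linear operator T : X_α → X_β is compact. -/

import Mathlib

noncomputable section

/-- A Banach space is an `L∞`-space with constant `C` if it admits an increasing sequence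
of finite-dimensional subspaces with dense union, each of which is `C`-isomorphic to
`ℝ^n` (of the corresponding dimension `n`) with the supremum norm. -/
def IsLinftySpaceWith (C : ℝ) (X : Type*) [SeminormedAddCommGroup X] [NormedSpace ℝ X] :
    Prop :=
  ∃ F : ℕ → Submodule ℝ X, Monotone F ∧ (∀ n, FiniteDimensional ℝ ↥(F n)) ∧
    Dense (⋃ n, (F n : Set X)) ∧
    ∀ n, ∃ T : ↥(F n) ≃L[ℝ] (Fin (Module.finrank ℝ ↥(F n)) → ℝ),
      ‖(T : ↥(F n) →L[ℝ] (Fin (Module.finrank ℝ ↥(F n)) → ℝ))‖ *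
        ‖(T.symm : (Fin (Module.finrank ℝ ↥(F n)) → ℝ) →L[ℝ] ↥(F n))‖ ≤ C

/-- An `L∞`-space: an `L∞,C`-space for some constant `C ≥ 1`. -/
def IsLinftySpace (X : Type*) [SeminormedAddCommGroup X] [NormedSpace ℝ X] : Prop :=
  ∃ C : ℝ, 1 ≤ C ∧ IsLinftySpaceWith C X

/-- A space is hereditarily indecomposable if no infinite-dimensional closed subspace is
the topological direct sum of two infinite-dimensional closed subspaces. -/
def HereditarilyIndecomposable (X : Type*) [SeminormedAddCommGroup X] [NormedSpace ℝ X] :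
    Prop :=
  ∀ Z U V : Submodule ℝ X, IsClosed (Z : Set X) → ¬FiniteDimensional ℝ ↥Z →
    IsClosed (U : Set X) → IsClosed (V : Set X) →
    ¬FiniteDimensional ℝ ↥U → ¬FiniteDimensional ℝ ↥V → U ⊓ V = ⊥ → U ⊔ V ≠ Z

/-- The scalar-plus-compact property: every bounded linear operator on `X` is a scalar
multiple of the identity plus a compact operator. -/
def ScalarPlusCompact (X : Type*) [SeminormedAddCommGroup X] [NormedSpace ℝ X] : Prop :=
  ∀ T : X →L[ℝ] X, ∃ (c : ℝ) (K : X →L[ℝ] X),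
    IsCompactOperator K ∧ T = c • ContinuousLinearMap.id ℝ X + K

/-- A Banach space is reflexive if the canonical inclusion into its double dual is
surjective. -/
def IsReflexiveSpace (X : Type*) [SeminormedAddCommGroup X] [NormedSpace ℝ X] : Prop :=
  Function.Surjective (NormedSpace.inclusionInDoubleDual ℝ X)

/-- `X` contains no infinite-dimensional reflexive closed subspace. -/
def NoReflexiveSubspace (X : Type*) [NormedAddCommGroup X] [NormedSpace ℝ X] : Prop :=
  ∀ Y : Submodule ℝ X, IsClosed (Y : Set X) → ¬FiniteDimensional ℝ ↥Y →
    ¬IsReflexiveSpace ↥Y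

/-- `X` is reflexively saturated: every infinite-dimensional closed subspace contains an
infinite-dimensional reflexive closed subspace. -/
def ReflexivelySaturated (X : Type*) [NormedAddCommGroup X] [NormedSpace ℝ X] : Prop :=
  ∀ Y : Submodule ℝ X, IsClosed (Y : Set X) → ¬FiniteDimensional ℝ ↥Y →
    ∃ Z : Submodule ℝ X, Z ≤ Y ∧ IsClosed (Z : Set X) ∧ ¬FiniteDimensional ℝ ↥Z ∧
      IsReflexiveSpace ↥Z

/-- The space `ℓ₁` of absolutely summable real sequences. -/
abbrev EllOne : Type := lp (fun _ : ℕ => ℝ) 1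

/-- The space `c₀` of real null sequences with the supremum norm. -/
abbrev CZero : Type := ZeroAtInftyContinuousMap ℕ ℝ

namespace AH

def nu : ℕ → ℕ
  | 0 => 1
  | j + 1 => (4 * nu j ^ 2) ^ 4 * (2 * nu j) ^ ((4 * nu j ^ 2) ^ 2 + 1)

def mm (j : ℕ) : ℕ := 4 * nu j ^ 2
def nn (j : ℕ) : ℕ := nu (j + 1)
def code (k σ : ℕ) : ℕ := 2 * (k + σ + 1)

theorem nn_eq (j : ℕ) : nn j = mm j ^ 4 * (2 * nu j) ^ (mm j ^ 2 + 1) := by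
  simp only [nn, mm, nu]

theorem nu_pos (j : ℕ) : 1 ≤ nu j := by
  induction j with
  | zero => simp [nu]
  | succ j ih => rw [nu]; exact Nat.succ_le_of_lt (by positivity)

theorem mm_ge (j : ℕ) : 4 ≤ mm j := by
  have := nu_pos j
  unfold mm; nlinarith

theorem mm4_le_nn (j : ℕ) : mm j ^ 4 ≤ nn j := by
  rw [nn_eq]
  exact Nat.le_mul_of_pos_right _ (by have := nu_pos j; positivity)

theorem nu_le_mm (j : ℕ) : nu j ≤ mm j := by
  have := nu_pos j
  unfold mm; nlinarith

theorem mm_lt_nn (j : ℕ) : mm j < nn j := by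
  have h := mm_ge j
  calc mm j = mm j ^ 1 := by simp
    _ < mm j ^ 4 := Nat.pow_lt_pow_right (by omega) (by omega)
    _ ≤ nn j := mm4_le_nn j

theorem nu_strictMono : StrictMono nu :=
  strictMono_nat_of_lt_succ fun j => (nu_le_mm j).trans_lt (mm_lt_nn j)

theorem mm_mono {h j : ℕ} (H : h ≤ j) : mm h ≤ mm j := by
  unfold mm; have := nu_strictMono.monotone H; gcongr

theorem nn_le_nu {h j : ℕ} (H : h < j) : nn h ≤ nu j := nu_strictMono.monotone H

theorem nn_sq_le {h j : ℕ} (H : h < j) : 4 * nn h ^ 2 ≤ mm j := by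
  unfold mm; have := nn_le_nu H; gcongr

theorem mm_sq_le {h j : ℕ} (H : h < j) : mm h ^ 2 ≤ mm j := by
  have h1 := nn_sq_le H
  have h2 := (mm_lt_nn h).le
  nlinarith

theorem nn_pos (j : ℕ) : 1 ≤ nn j := nu_pos _

theorem le_nu (j : ℕ) : j ≤ nu j := nu_strictMono.le_apply

theorem mmR_ge (j : ℕ) : (4 : ℝ) ≤ mm j := by exact_mod_cast mm_ge j
theorem mmR_pos (j : ℕ) : (0 : ℝ) < mm j := by have := mmR_ge j; linarith
theorem nnR_pos (j : ℕ) : (0 : ℝ) < nn j := by exact_mod_cast nn_pos j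
theorem code_even (k σ : ℕ) : ¬ Odd (code k σ) := by simp [code]

def pv (x : ℕ → ℝ) (s : ℕ) : ℝ := if s = 0 then 0 else x (s - 1)
@[simp] theorem pv_zero (x : ℕ → ℝ) : pv x 0 = 0 := by simp [pv]
@[simp] theorem pv_succ (x : ℕ → ℝ) (n : ℕ) : pv x (n + 1) = x n := by simp [pv]

structure Sys where
  w : ℕ → ℕ
  s : ℕ → ℕ
  age : ℕ → ℕ
  t : ℕ → Finset ℕ
  bb : ℕ → (ℕ → ℝ) →ₗ[ℝ] ℝ
  s_le : ∀ n, s n ≤ n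
  w_par : ∀ n ξ, s n = ξ + 1 → w ξ = w n
  age_par : ∀ n ξ, s n = ξ + 1 → age n = age ξ + 1
  age_zero : ∀ n, s n = 0 → age n = 1
  age_le : ∀ n, age n ≤ nn (w n)
  t_par : ∀ n ξ, s n = ξ + 1 → t ξ ⊆ t n
  w_le : ∀ n, w n ≤ n
  bb_le : ∀ n x B, 0 ≤ B → (∀ i < n, t i ⊆ t n → |x i| ≤ B) → |bb n x| ≤ B
  odd_node : ∀ n, Odd (w n) → ∃ η, (∀ x, bb n x = x η) ∧ w η = code (w n) (s n)
  rich : ∀ (S : Set ℕ) (j σ a b : ℕ) (r₁ r₂ : ℚ), |r₁| + |r₂| ≤ 1 →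
    (t a : Set ℕ) ⊆ S → (t b : Set ℕ) ⊆ S →
    (Odd j → r₁ = 1 ∧ r₂ = 0 ∧ w a = code j σ) →
    (σ = 0 ∨ ∃ ξ, σ = ξ + 1 ∧ (t ξ : Set ℕ) ⊆ S ∧ w ξ = j ∧ age ξ < nn j) →
    ∀ N, ∃ n ≥ N, (t n : Set ℕ) ⊆ S ∧ w n = j ∧ s n = σ ∧ a < n ∧ b < n ∧
      ∀ x, bb n x = r₁ * x a + r₂ * x b
  labels : ∀ e N, ∃ n ≥ N, t n = {e} ∧ N ≤ w n

namespace Sys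
variable (Γ : Sys)

def A (S : Set ℕ) : Set ℕ := {n | (Γ.t n : Set ℕ) ⊆ S}

theorem A_univ : Γ.A Set.univ = Set.univ := by ext; simp [A]

def E (q : ℕ) (x : ℕ → ℝ) (n : ℕ) : ℝ :=
  if n < q then x n else
    (if h : 0 < Γ.s n ∧ Γ.s n ≤ n then E q x (Γ.s n - 1) else 0) +
    if Γ.s n ≤ q then
      (1 / (mm (Γ.w n) : ℝ)) * (Γ.bb n (fun i => if _h : i < n then E q x i else 0) -
        Γ.bb n (fun i => if _h : i < n then E (Γ.s n) x i else 0))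
    else 0
termination_by n
decreasing_by all_goals omega

variable {Γ}

theorem bb_congr {n : ℕ} {x y : ℕ → ℝ} (h : ∀ i < n, x i = y i) : Γ.bb n x = Γ.bb n y := by
  have := Γ.bb_le n (x - y) 0 le_rfl (fun i hi _ => by simp [h i hi])
  rw [map_sub] at this
  linarith [abs_nonpos_iff.mp this]

theorem E_lt {q n : ℕ} (x : ℕ → ℝ) (h : n < q) : Γ.E q x n = x n := by
  rw [E, if_pos h]

theorem E_ge {q n : ℕ} (x : ℕ → ℝ) (h : q ≤ n) : Γ.E q x n = pv (Γ.E q x) (Γ.s n) +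
    if Γ.s n ≤ q then (1 / (mm (Γ.w n) : ℝ)) * (Γ.bb n (Γ.E q x) - Γ.bb n (Γ.E (Γ.s n) x))
    else 0 := by
  rw [E, if_neg (by omega)]
  have hs := Γ.s_le n
  congr 1
  · unfold pv
    by_cases h0 : Γ.s n = 0
    · simp [h0]
    · rw [dif_pos ⟨by omega, hs⟩, if_neg h0]
  · congr 3
    · exact bb_congr fun i hi => by simp [hi]
    · exact bb_congr fun i hi => by simp [hi]

theorem pv_congr {x y : ℕ → ℝ} {s n : ℕ} (hs : s ≤ n) (h : ∀ i < n, x i = y i) :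
    pv x s = pv y s := by
  cases s with
  | zero => simp
  | succ k => simpa using h k (by omega)

theorem E_congr {q : ℕ} {x y : ℕ → ℝ} (h : ∀ i < q, x i = y i) : Γ.E q x = Γ.E q y := by
  funext n
  induction n using Nat.strong_induction_on generalizing q with
  | _ n ih =>
    by_cases hn : n < q
    · rw [E_lt _ hn, E_lt _ hn, h n hn]
    · rw [E_ge _ (by omega), E_ge _ (by omega)]
      rw [pv_congr (Γ.s_le n) (fun i hi => ih i hi h)]
      congr 1
      split_ifs with h1
      · rw [bb_congr (fun i hi => ih i hi h),
          bb_congr (x := Γ.E (Γ.s n) x) (fun i hi => ih i hi fun k hk => h k (by omega))]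
      · rfl

theorem pv_lin (a : ℝ) (x y : ℕ → ℝ) (s : ℕ) : pv (a • x + y) s = a * pv x s + pv y s := by
  cases s <;> simp

theorem E_lin (q : ℕ) (a : ℝ) (x y : ℕ → ℝ) :
    Γ.E q (a • x + y) = a • Γ.E q x + Γ.E q y := by
  funext n
  induction n using Nat.strong_induction_on generalizing q with
  | _ n ih =>
    by_cases hn : n < q
    · simp [E_lt _ hn]
    · simp only [Pi.add_apply, Pi.smul_apply]
      rw [E_ge _ (by omega), E_ge _ (by omega), E_ge _ (by omega)]
      rw [pv_congr (Γ.s_le n) (fun i hi => ih i hi q), pv_lin]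
      rw [bb_congr (fun i hi => ih i hi q), bb_congr (fun i hi => ih i hi (Γ.s n))]
      simp only [map_add, map_smul, smul_eq_mul]
      split_ifs <;> ring

/-- `E q` as a linear map. -/
def El (q : ℕ) : (ℕ → ℝ) →ₗ[ℝ] (ℕ → ℝ) where
  toFun := Γ.E q
  map_add' x y := by simpa using E_lin (Γ := Γ) q 1 x y
  map_smul' a x := by
    have h0 : Γ.E q 0 = 0 := by
      have := E_lin (Γ := Γ) q 1 0 0
      simpa using this
    simpa [h0] using E_lin (Γ := Γ) q a x 0

theorem E_add (q : ℕ) (x y : ℕ → ℝ) : Γ.E q (x + y) = Γ.E q x + Γ.E q y := map_add (El q) x y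
theorem E_sub (q : ℕ) (x y : ℕ → ℝ) : Γ.E q (x - y) = Γ.E q x - Γ.E q y := map_sub (El q) x y
theorem E_smul (q : ℕ) (a : ℝ) (x : ℕ → ℝ) : Γ.E q (a • x) = a • Γ.E q x := map_smul (El q) a x
theorem E_zero (q : ℕ) : Γ.E q 0 = 0 := map_zero (El q)
theorem E_sum {ι : Type*} (q : ℕ) (J : Finset ι) (x : ι → ℕ → ℝ) :
    Γ.E q (∑ i ∈ J, x i) = ∑ i ∈ J, Γ.E q (x i) := map_sum (El q) x J

theorem E_E_of_le {s q : ℕ} (x : ℕ → ℝ) (h : s ≤ q) : Γ.E s (Γ.E q x) = Γ.E s x :=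
  E_congr fun i hi => E_lt x (by omega)

theorem E_E_of_ge {s q : ℕ} (x : ℕ → ℝ) (h : q ≤ s) : Γ.E s (Γ.E q x) = Γ.E q x := by
  funext n
  induction n using Nat.strong_induction_on generalizing s with
  | _ n ih =>
    by_cases hn : n < s
    · rw [E_lt _ hn]
    · rw [E_ge _ (by omega), E_ge x (by omega : q ≤ n)]
      rw [pv_congr (Γ.s_le n) (fun i hi => ih i hi h), bb_congr (fun i hi => ih i hi h)]
      congr 1
      by_cases h1 : Γ.s n ≤ q
      · rw [if_pos h1, if_pos (by omega), E_E_of_le x h1]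
      · rw [if_neg h1, bb_congr (x := Γ.E (Γ.s n) (Γ.E q x)) (fun i hi => ih i hi (by omega))]
        simp

theorem E_bound {S : Set ℕ} {q : ℕ} {x : ℕ → ℝ} {B : ℝ} (hB : 0 ≤ B)
    (h : ∀ i < q, i ∈ Γ.A S → |x i| ≤ B) : ∀ n ∈ Γ.A S, |Γ.E q x n| ≤ 2 * B := by
  intro n
  induction n using Nat.strong_induction_on generalizing q with
  | _ n ih =>
    intro hnA
    by_cases hn : n < q
    · rw [E_lt _ hn]; linarith [h n hn hnA]
    · rw [E_ge _ (by omega)]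
      have hsub : ∀ i, Γ.t i ⊆ Γ.t n → i ∈ Γ.A S := fun i hi =>
        (Finset.coe_subset.mpr hi).trans hnA
      split_ifs with h1
      · have hp : |pv (Γ.E q x) (Γ.s n)| ≤ B := by
          rcases hs : Γ.s n with _ | ξ
          · simpa
          · rw [pv_succ, E_lt _ (by omega)]
            exact h ξ (by omega) (hsub _ (Γ.t_par n ξ hs))
        have h2 : |Γ.bb n (Γ.E q x)| ≤ 2 * B :=
          Γ.bb_le n _ _ (by linarith) fun i hi ht => ih i hi h (hsub i ht)
        have h3 : |Γ.bb n (Γ.E (Γ.s n) x)| ≤ 2 * B :=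
          Γ.bb_le n _ _ (by linarith) fun i hi ht =>
            ih i hi (fun k hk => h k (by omega)) (hsub i ht)
        have hm := mmR_ge (Γ.w n)
        have h4 : |(1 / (mm (Γ.w n) : ℝ)) * (Γ.bb n (Γ.E q x) - Γ.bb n (Γ.E (Γ.s n) x))| ≤ B := by
          rw [abs_mul, abs_of_pos (by positivity), one_div, inv_mul_le_iff₀ (by linarith)]
          calc _ ≤ 2 * B + 2 * B := (abs_sub _ _).trans (by linarith)
            _ ≤ _ := by nlinarith
        exact (abs_add_le _ _).trans (by linarith)
      · rw [add_zero]
        rcases hs : Γ.s n with _ | ξ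
        · simpa using hB
        · rw [pv_succ]
          have := Γ.s_le n
          exact ih ξ (by omega) h (hsub _ (Γ.t_par n ξ hs))

theorem E_bound' {q : ℕ} {x : ℕ → ℝ} {B : ℝ} (hB : 0 ≤ B) (h : ∀ i < q, |x i| ≤ B) (n : ℕ) :
    |Γ.E q x n| ≤ 2 * B :=
  E_bound (S := Set.univ) hB (fun i hi _ => h i hi) n (by simp [A])

/-- the coordinate functionals of the basis -/
def D (Γ : Sys) (n : ℕ) (x : ℕ → ℝ) : ℝ :=
  x n - pv x (Γ.s n) - (1 / (mm (Γ.w n) : ℝ)) * Γ.bb n (x - Γ.E (Γ.s n) x)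

theorem eval (n : ℕ) (x : ℕ → ℝ) : x n = Γ.D n x + pv x (Γ.s n) +
    (1 / (mm (Γ.w n) : ℝ)) * Γ.bb n (x - Γ.E (Γ.s n) x) := by
  unfold D; ring

theorem D_E {q n : ℕ} (x : ℕ → ℝ) (h : q ≤ n) : Γ.D n (Γ.E q x) = 0 := by
  unfold D
  rw [E_ge x h]
  split_ifs with h1
  · rw [E_E_of_le x h1, map_sub]; ring
  · rw [E_E_of_ge x (by omega)]; simp

theorem D_sub (n : ℕ) (x y : ℕ → ℝ) : Γ.D n (x - y) = Γ.D n x - Γ.D n y := by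
  unfold D
  have : pv (x - y) (Γ.s n) = pv x (Γ.s n) - pv y (Γ.s n) := by
    cases Γ.s n <;> simp
  rw [this, E_sub, show x - y - (Γ.E (Γ.s n) x - Γ.E (Γ.s n) y)
    = (x - Γ.E (Γ.s n) x) - (y - Γ.E (Γ.s n) y) by abel, map_sub, Pi.sub_apply]
  ring

theorem bb_abs_le {n : ℕ} {x : ℕ → ℝ} {C : ℝ} (hx : ∀ i, |x i| ≤ C) : |Γ.bb n x| ≤ C :=
  Γ.bb_le n x C ((abs_nonneg _).trans (hx 0)) fun i _ _ => hx i

theorem sub_E_le {q : ℕ} {x : ℕ → ℝ} {C : ℝ} (hx : ∀ i, |x i| ≤ C) (n : ℕ) :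
    |(x - Γ.E q x) n| ≤ 3 * C := by
  have h0 : 0 ≤ C := (abs_nonneg _).trans (hx 0)
  have := E_bound' (Γ := Γ) (q := q) h0 (fun i _ => hx i) n
  rw [Pi.sub_apply]
  exact (abs_sub _ _).trans (by linarith [hx n])

theorem D_le {n : ℕ} {x : ℕ → ℝ} {C : ℝ} (hx : ∀ i, |x i| ≤ C) : |Γ.D n x| ≤ 3 * C := by
  have h0 : 0 ≤ C := (abs_nonneg _).trans (hx 0)
  have h1 : |pv x (Γ.s n)| ≤ C := by cases Γ.s n <;> simp [h0, hx]
  have h2 := bb_abs_le (Γ := Γ) (n := n) (sub_E_le (Γ := Γ) (q := Γ.s n) hx)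
  have hm := mmR_ge (Γ.w n)
  have h3 : |(1 / (mm (Γ.w n) : ℝ)) * Γ.bb n (x - Γ.E (Γ.s n) x)| ≤ C := by
    rw [abs_mul, abs_of_pos (by positivity), one_div, inv_mul_le_iff₀ (by linarith)]
    nlinarith
  unfold D
  have := abs_sub (x n - pv x (Γ.s n)) ((1 / (mm (Γ.w n) : ℝ)) * Γ.bb n (x - Γ.E (Γ.s n) x))
  have := abs_sub (x n) (pv x (Γ.s n))
  linarith [hx n]

/-- finitely supported blocks -/
def Blk (Γ : Sys) (p q : ℕ) (x : ℕ → ℝ) : Prop := (∀ i < p, x i = 0) ∧ Γ.E q x = x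

theorem Blk.E_le {p q s : ℕ} {x : ℕ → ℝ} (h : Γ.Blk p q x) (hs : s ≤ p) : Γ.E s x = 0 := by
  rw [E_congr (y := 0) (fun i hi => h.1 i (by omega)), E_zero]

theorem Blk.E_ge {p q s : ℕ} {x : ℕ → ℝ} (h : Γ.Blk p q x) (hs : q ≤ s) : Γ.E s x = x := by
  conv_lhs => rw [← h.2]
  rw [E_E_of_ge _ hs, h.2]

theorem Blk.D_eq {p q n : ℕ} {x : ℕ → ℝ} (h : Γ.Blk p q x) (hn : q ≤ n) : Γ.D n x = 0 := by
  rw [← h.2, D_E _ hn]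

theorem Blk.mono {p q p' q' : ℕ} {x : ℕ → ℝ} (h : Γ.Blk p q x) (hp : p' ≤ p) (hq : q ≤ q') :
    Γ.Blk p' q' x := ⟨fun i hi => h.1 i (by omega), h.E_ge hq⟩

theorem Blk.smul {p q : ℕ} {x : ℕ → ℝ} (h : Γ.Blk p q x) (a : ℝ) : Γ.Blk p q (a • x) :=
  ⟨fun i hi => by simp [h.1 i hi], by rw [E_smul, h.2]⟩

theorem Blk.add {p q : ℕ} {x y : ℕ → ℝ} (h : Γ.Blk p q x) (h' : Γ.Blk p q y) :
    Γ.Blk p q (x + y) :=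
  ⟨fun i hi => by simp [h.1 i hi, h'.1 i hi], by rw [E_add, h.2, h'.2]⟩

theorem Blk.sum {ι : Type*} {p q : ℕ} {J : Finset ι} {x : ι → ℕ → ℝ}
    (h : ∀ i ∈ J, Γ.Blk p q (x i)) : Γ.Blk p q (∑ i ∈ J, x i) :=
  ⟨fun k hk => by rw [Finset.sum_apply]; exact Finset.sum_eq_zero fun i hi => (h i hi).1 k hk,
   by rw [E_sum]; exact Finset.sum_congr rfl fun i hi => (h i hi).2⟩

theorem Blk.of_E {p q : ℕ} {u : ℕ → ℝ} (h : ∀ i < p, u i = 0) (hpq : p ≤ q) :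
    Γ.Blk p q (Γ.E q u) :=
  ⟨fun i hi => by rw [E_lt _ (by omega), h i hi], E_E_of_ge _ le_rfl⟩

end Sys
end AH

namespace AH

theorem sum_le_bad {J : Finset ℕ} {f : ℕ → ℝ} {B c : ℝ} (hB0 : 0 ≤ B) (hc : 0 ≤ c)
    (hB : ∀ i ∈ J, f i ≤ B) (h : ∀ i ∈ J, ∀ j ∈ J, i < j → f i ≤ c ∨ f j ≤ c) :
    ∑ i ∈ J, f i ≤ B + c * J.card := by
  classical
  rw [← Finset.sum_filter_add_sum_filter_not J (fun i => c < f i)]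
  have hcard : (J.filter (fun i => c < f i)).card ≤ 1 := by
    rw [Finset.card_le_one]
    intro a ha b hb
    simp only [Finset.mem_filter] at ha hb
    by_contra hab
    rcases lt_or_gt_of_ne hab with hl | hl
    · rcases h a ha.1 b hb.1 hl with h1 | h1 <;> linarith
    · rcases h b hb.1 a ha.1 hl with h1 | h1 <;> linarith
  have h1 : ∑ i ∈ J.filter (fun i => c < f i), f i ≤ B := by
    calc _ ≤ ((J.filter (fun i => c < f i)).card : ℝ) * B := by
          rw [← nsmul_eq_mul]
          exact Finset.sum_le_card_nsmul _ _ _ fun i hi => hB i (Finset.mem_filter.mp hi).1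
      _ ≤ 1 * B := by gcongr; exact_mod_cast hcard
      _ = B := one_mul _
  have h2 : ∑ i ∈ J.filter (fun i => ¬ c < f i), f i ≤ c * J.card := by
    calc _ ≤ ((J.filter (fun i => ¬ c < f i)).card : ℝ) * c := by
          rw [← nsmul_eq_mul]
          exact Finset.sum_le_card_nsmul _ _ _ fun i hi => not_lt.mp (Finset.mem_filter.mp hi).2
      _ ≤ (J.card : ℝ) * c := by gcongr; exact Finset.filter_subset _ _
      _ = _ := mul_comm _ _
  linarith

namespace Sys
variable {Γ : Sys}

/-- a finite family of successive blocks bounded by `C` -/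
structure Fam (Γ : Sys) (J : Finset ℕ) (x : ℕ → ℕ → ℝ) (p q : ℕ → ℕ) (C : ℝ) : Prop where
  pos : 0 ≤ C
  blk : ∀ i ∈ J, Γ.Blk (p i) (q i) (x i)
  ord : ∀ i ∈ J, ∀ j ∈ J, i < j → q i ≤ p j
  bd : ∀ i ∈ J, ∀ n, |x i n| ≤ C

theorem Fam.step {J : Finset ℕ} {x : ℕ → ℕ → ℝ} {p q : ℕ → ℕ} {C K E : ℝ}
    (F : Γ.Fam J x p q C) (hK : 0 ≤ K) (hE : 0 ≤ E)
    (hyp : ∀ J' ⊆ J, ∀ η, |∑ i ∈ J', x i η| ≤ K + E * J'.card) :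
    ∀ γ, ∀ J' ⊆ J, |∑ i ∈ J', x i γ| ≤
      Γ.age γ * (2 * C + K) + E / mm (Γ.w γ) * J'.card := by
  classical
  intro γ
  induction γ using Nat.strong_induction_on with
  | _ γ ih =>
  intro J' hJ'
  set m : ℝ := ((mm (Γ.w γ) : ℕ) : ℝ) with hm
  have hm4 : 4 ≤ m := mmR_ge _
  set s := Γ.s γ with hs
  have hsγ : s ≤ γ := Γ.s_le γ
  have hC := F.pos
  set J1 := J'.filter (fun i => q i ≤ s) with hJ1
  set R := J'.filter (fun i => ¬ q i ≤ s) with hR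
  set G := fun i => s ≤ p i ∧ (q i ≤ γ ∨ γ < p i) with hG
  set J2 := R.filter G with hJ2
  set J3 := R.filter (fun i => ¬ G i) with hJ3
  have hsplit : ∑ i ∈ J', x i γ = ∑ i ∈ J1, x i γ + (∑ i ∈ J2, x i γ + ∑ i ∈ J3, x i γ) := by
    rw [hJ2, hJ3, Finset.sum_filter_add_sum_filter_not, hJ1, hR,
      Finset.sum_filter_add_sum_filter_not]
  have hc12 : (J1.card : ℝ) + J2.card ≤ J'.card := by
    have h1 : J1.card + R.card = J'.card := Finset.card_filter_add_card_filter_not _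
    have h2 : J2.card ≤ R.card := Finset.card_filter_le _ _
    exact_mod_cast (by omega : J1.card + J2.card ≤ J'.card)
  have hR' : R ⊆ J' := Finset.filter_subset _ _
  -- J1
  have e1 : ∑ i ∈ J1, x i γ = ∑ i ∈ J1, pv (x i) s := by
    refine Finset.sum_congr rfl fun i hi => ?_
    have hi' := Finset.mem_filter.mp hi
    have B := F.blk i (hJ' hi'.1)
    rw [Sys.eval (Γ := Γ) γ (x i), B.D_eq (by omega), ← hs, B.E_ge hi'.2]
    simp
  have b1 : |∑ i ∈ J1, pv (x i) s| ≤ (Γ.age γ - 1) * (2 * C + K) + E / m * J1.card := by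
    rcases hs' : s with _ | ξ
    · have : Γ.age γ = 1 := Γ.age_zero γ (by rw [← hs, hs'])
      simp only [pv_zero, Finset.sum_const_zero, abs_zero, this]
      norm_num; positivity
    · simp only [pv_succ]
      have h := ih ξ (by omega) J1 ((Finset.filter_subset _ _).trans hJ')
      rw [Γ.w_par γ ξ (by rw [← hs, hs'])] at h
      rw [Γ.age_par γ ξ (by rw [← hs, hs'])]
      push_cast
      rw [add_sub_cancel_right]
      exact h
  -- J2
  have e2 : ∑ i ∈ J2, x i γ = (1 / m) * Γ.bb γ (∑ i ∈ J2, x i) := by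
    rw [map_sum, Finset.mul_sum]
    refine Finset.sum_congr rfl fun i hi => ?_
    have hi' := Finset.mem_filter.mp hi
    have B := F.blk i (hJ' (hR' hi'.1))
    rcases hi'.2.2 with h | h
    · rw [Sys.eval (Γ := Γ) γ (x i), B.D_eq h, ← hs, B.E_le hi'.2.1]
      have : pv (x i) s = 0 := by
        rcases hs' : s with _ | ξ
        · simp
        · rw [pv_succ]; exact B.1 ξ (by have := hi'.2.1; omega)
      rw [this, sub_zero, zero_add, zero_add]
    · rw [B.1 γ h, bb_congr (y := 0) (fun k hk => B.1 k (by omega))]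
      simp
  have b2 : |(1 / m) * Γ.bb γ (∑ i ∈ J2, x i)| ≤ K + E / m * J2.card := by
    have h := bb_abs_le (Γ := Γ) (n := γ) (x := ∑ i ∈ J2, x i) (C := K + E * J2.card) (fun η => by
      rw [Finset.sum_apply]
      exact hyp J2 (((Finset.filter_subset _ _).trans hR').trans hJ') η)
    rw [abs_mul, abs_of_pos (by positivity)]
    calc 1 / m * |Γ.bb γ (∑ i ∈ J2, x i)| ≤ 1 / m * (K + E * J2.card) := by gcongr
      _ = K / m + E / m * J2.card := by ring
      _ ≤ _ := by gcongr; exact div_le_self hK (by linarith)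
  -- J3
  have b3 : |∑ i ∈ J3, x i γ| ≤ 2 * C := by
    refine (Finset.abs_sum_le_sum_abs _ _).trans ?_
    rw [← Finset.sum_filter_add_sum_filter_not J3 (fun i => p i < s)]
    have hcc : ∀ T ⊆ J3, T.card ≤ 1 → ∑ i ∈ T, |x i γ| ≤ C := by
      intro T hT hc
      calc _ ≤ (T.card : ℝ) * C := by
            rw [← nsmul_eq_mul]
            exact Finset.sum_le_card_nsmul _ _ _ fun i hi =>
              F.bd i (hJ' (hR' (Finset.mem_filter.mp (hT hi)).1)) γ
        _ ≤ 1 * C := by gcongr; exact_mod_cast hc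
        _ = C := one_mul _
    have c1 : (J3.filter (fun i => p i < s)).card ≤ 1 := by
      rw [Finset.card_le_one]
      intro a ha b hb
      simp only [hJ3, hR, Finset.mem_filter] at ha hb
      by_contra hab
      rcases lt_or_gt_of_ne hab with hl | hl
      · have := F.ord a (hJ' ha.1.1.1) b (hJ' hb.1.1.1) hl; omega
      · have := F.ord b (hJ' hb.1.1.1) a (hJ' ha.1.1.1) hl; omega
    have c2 : (J3.filter (fun i => ¬ p i < s)).card ≤ 1 := by
      rw [Finset.card_le_one]
      intro a ha b hb
      simp only [hJ3, hR, hG, Finset.mem_filter] at ha hb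
      by_contra hab
      rcases lt_or_gt_of_ne hab with hl | hl
      · have := F.ord a (hJ' ha.1.1.1) b (hJ' hb.1.1.1) hl; omega
      · have := F.ord b (hJ' hb.1.1.1) a (hJ' ha.1.1.1) hl; omega
    linarith [hcc _ (Finset.filter_subset _ _) c1, hcc _ (Finset.filter_subset _ _) c2]
  rw [hsplit, e1, e2]
  have t1 := abs_add_le (∑ i ∈ J1, pv (x i) s)
    ((1 / m) * Γ.bb γ (∑ i ∈ J2, x i) + ∑ i ∈ J3, x i γ)
  have t2 := abs_add_le ((1 / m) * Γ.bb γ (∑ i ∈ J2, x i)) (∑ i ∈ J3, x i γ)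
  have t3 : E / m * ((J1.card : ℝ) + J2.card) ≤ E / m * J'.card := by gcongr
  linarith

theorem age_pos (n : ℕ) : 1 ≤ Γ.age n := by
  rcases h : Γ.s n with _ | ξ
  · rw [Γ.age_zero n h]
  · rw [Γ.age_par n ξ h]; omega

theorem Fam.ris {J : Finset ℕ} {x : ℕ → ℕ → ℝ} {p q : ℕ → ℕ} {C B E₀ : ℝ} {j : ℕ}
    (F : Γ.Fam J x p q C) (hB : 0 ≤ B) (hE : 0 ≤ E₀)
    (hyp : ∀ J' ⊆ J, ∀ γ, j ≤ Γ.w γ → |∑ i ∈ J', x i γ| ≤ B + E₀ * J'.card) (D : ℕ) :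
    ∀ J' ⊆ J, ∀ γ, |∑ i ∈ J', x i γ| ≤
      (B + 2 * C) * (2 * nu j) ^ D + (E₀ + C / 2 ^ D) * J'.card := by
  have hC := F.pos
  have hnu : (1 : ℝ) ≤ nu j := by exact_mod_cast nu_pos j
  induction D with
  | zero =>
    intro J' hJ' γ
    have h1 : |∑ i ∈ J', x i γ| ≤ C * J'.card := by
      refine (Finset.abs_sum_le_sum_abs _ _).trans ?_
      rw [mul_comm, ← nsmul_eq_mul]
      exact Finset.sum_le_card_nsmul _ _ _ fun i hi => F.bd i (hJ' hi) γ
    have : 0 ≤ E₀ * (J'.card : ℝ) := by positivity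
    simp only [pow_zero, mul_one, div_one, add_mul]
    linarith
  | succ D ih =>
    intro J' hJ' γ
    by_cases hj : j ≤ Γ.w γ
    · have h1 := hyp J' hJ' γ hj
      have h2 : B ≤ (B + 2 * C) * (2 * nu j) ^ (D + 1) := by
        have : (1 : ℝ) ≤ (2 * nu j) ^ (D + 1) := one_le_pow₀ (by linarith)
        nlinarith
      have h3 : 0 ≤ C / 2 ^ (D + 1) * (J'.card : ℝ) := by positivity
      rw [add_mul]; linarith
    · have hK : 0 ≤ (B + 2 * C) * (2 * (nu j : ℝ)) ^ D := by positivity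
      have h1 := F.step hK (by positivity) ih γ J' hJ'
      have hage : (Γ.age γ : ℝ) ≤ nu j := by
        exact_mod_cast (Γ.age_le γ).trans (nn_le_nu (by omega))
      have hm := mmR_ge (Γ.w γ)
      refine h1.trans (add_le_add ?_ ?_)
      · have h3 : 2 * C ≤ (B + 2 * C) * (2 * (nu j : ℝ)) ^ D := by
          have : (1 : ℝ) ≤ (2 * nu j) ^ D := one_le_pow₀ (by linarith)
          nlinarith
        calc (Γ.age γ : ℝ) * (2 * C + (B + 2 * C) * (2 * nu j) ^ D)
            ≤ nu j * ((B + 2 * C) * (2 * nu j) ^ D + (B + 2 * C) * (2 * nu j) ^ D) := by gcongr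
          _ = _ := by ring
      · gcongr
        rw [div_le_iff₀ (by linarith), pow_succ, ← div_div]
        have : 0 ≤ C / 2 ^ D := by positivity
        nlinarith

/-- far out vectors with small values on nodes of small weight -/
def RV (Γ : Sys) (C : ℝ) (N : ℕ) (x : ℕ → ℝ) : Prop :=
  (∀ n, |x n| ≤ C) ∧ ∀ n, Γ.w n < N → |x n| ≤ C / mm (Γ.w n)

theorem Blk.far {p q : ℕ} {x : ℕ → ℝ} {C : ℝ} (h : Γ.Blk p q x) (hC : ∀ n, |x n| ≤ C) :
    ∀ γ, q ≤ Γ.w γ → |x γ| ≤ C / mm (Γ.w γ) := by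
  intro γ
  induction γ using Nat.strong_induction_on with
  | _ γ ih =>
  intro hq
  have hw := Γ.w_le γ
  have hm := mmR_pos (Γ.w γ)
  rw [Sys.eval (Γ := Γ) γ x, h.D_eq (by omega)]
  have hs' := Γ.s_le γ
  rcases hs : Γ.s γ with _ | ξ
  · rw [h.E_le (Nat.zero_le _), pv_zero, sub_zero, zero_add, zero_add, abs_mul,
      abs_of_pos (by positivity), one_div, ← div_eq_inv_mul]
    gcongr
    exact bb_abs_le hC
  · have hwξ := Γ.w_par γ ξ hs
    have := Γ.w_le ξ
    rw [h.E_ge (by omega)]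
    simp only [pv_succ, sub_self, map_zero, mul_zero, add_zero, zero_add]
    rw [← hwξ]
    exact ih ξ (by omega) (by omega)

theorem Fam.big {J : Finset ℕ} {x : ℕ → ℕ → ℝ} {p q N : ℕ → ℕ} {C : ℝ}
    (F : Γ.Fam J x p q C) (hN : ∀ i ∈ J, Γ.RV C (N i) (x i))
    (hqN : ∀ i ∈ J, ∀ j ∈ J, i < j → q i ≤ N j) {J' : Finset ℕ} (hJ' : J' ⊆ J) (γ : ℕ) :
    ∑ i ∈ J', |x i γ| ≤ C + C / mm (Γ.w γ) * J'.card := by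
  have hC := F.pos
  refine sum_le_bad hC (by positivity) (fun i hi => F.bd i (hJ' hi) γ) fun i hi j hj hij => ?_
  by_cases h : Γ.w γ < N j
  · exact Or.inr ((hN j (hJ' hj)).2 γ h)
  · refine Or.inl ((F.blk i (hJ' hi)).far (F.bd i (hJ' hi)) γ ?_)
    have := hqN i (hJ' hi) j (hJ' hj) hij
    omega

/-- exact vectors -/
structure EP (Γ : Sys) (C : ℝ) (j : ℕ) (z : ℕ → ℝ) : Prop where
  bd : ∀ n, |z n| ≤ 3 * C
  lo : ∀ n, Γ.w n < j → |z n| ≤ 3 * C / mm (Γ.w n)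
  hi : ∀ n, j < Γ.w n → ∀ σ, |(z - Γ.E σ z) n| ≤ 5 * C / mm j ^ 3
  d : ∀ n, |Γ.D n z| ≤ 3 * C / mm j ^ 3

theorem D_add (n : ℕ) (x y : ℕ → ℝ) : Γ.D n (x + y) = Γ.D n x + Γ.D n y := by
  have h := D_sub (Γ := Γ) n (x + y) y
  rw [add_sub_cancel_right] at h
  linarith

theorem D_smul (n : ℕ) (a : ℝ) (x : ℕ → ℝ) : Γ.D n (a • x) = a * Γ.D n x := by
  unfold D
  have : pv (a • x) (Γ.s n) = a * pv x (Γ.s n) := by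
    cases Γ.s n <;> simp
  rw [this, E_smul, ← smul_sub, map_smul]
  simp only [Pi.smul_apply, smul_eq_mul]; ring

theorem D_sum (n : ℕ) (J : Finset ℕ) (x : ℕ → ℕ → ℝ) :
    Γ.D n (∑ i ∈ J, x i) = ∑ i ∈ J, Γ.D n (x i) := by
  classical
  induction J using Finset.induction_on with
  | empty => simpa using D_sub (Γ := Γ) n 0 0
  | insert a J ha ih => rw [Finset.sum_insert ha, Finset.sum_insert ha, D_add, ih]

theorem Blk.D_lt {p q n : ℕ} {x : ℕ → ℝ} (h : Γ.Blk p q x) (hn : n < p) : Γ.D n x = 0 := by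
  have hs := Γ.s_le n
  unfold D
  rw [h.1 n hn, h.E_le (by omega), sub_zero, bb_congr (y := 0) (fun k hk => h.1 k (by omega)),
    pv_congr (y := 0) hs (fun k hk => h.1 k (by omega))]
  cases Γ.s n <;> simp

theorem mmR_mono {h j : ℕ} (H : h ≤ j) : (mm h : ℝ) ≤ mm j := by exact_mod_cast mm_mono H
theorem nnR_sq_le {h j : ℕ} (H : h < j) : 4 * (nn h : ℝ) ^ 2 ≤ mm j := by
  exact_mod_cast nn_sq_le H
theorem nnR_ge (j : ℕ) : (1 : ℝ) ≤ nn j := by exact_mod_cast nn_pos j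

theorem pow_facts (j : ℕ) : ((2 * nu j : ℝ)) ^ (mm j ^ 2) * mm j ^ 4 ≤ nn j ∧
    ((nu j : ℝ) * (2 * nu j : ℝ) ^ (mm j ^ 2)) * mm j ^ 4 ≤ nn j ∧
    (1 : ℝ) / 2 ^ (mm j ^ 2) ≤ 1 / mm j ^ 2 := by
  have hnu : (1 : ℝ) ≤ nu j := by exact_mod_cast nu_pos j
  have hm := mmR_pos j
  have e : (nn j : ℝ) = mm j ^ 4 * (2 * nu j) ^ (mm j ^ 2 + 1) := by exact_mod_cast nn_eq j
  have hp : (0 : ℝ) < (2 * nu j : ℝ) ^ (mm j ^ 2) := by positivity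
  have h4 : (0 : ℝ) < (mm j : ℝ) ^ 4 := by positivity
  refine ⟨?_, ?_, ?_⟩
  · rw [e, pow_succ (2 * (nu j : ℝ)) (mm j ^ 2)]
    have : 0 < (mm j : ℝ) ^ 4 * (2 * nu j : ℝ) ^ (mm j ^ 2) := by positivity
    nlinarith
  · rw [e, pow_succ (2 * (nu j : ℝ)) (mm j ^ 2)]
    have : 0 < (mm j : ℝ) ^ 4 * (2 * nu j : ℝ) ^ (mm j ^ 2) := by positivity
    nlinarith
  · apply one_div_le_one_div_of_le (by positivity)
    exact_mod_cast (Nat.lt_two_pow_self (n := mm j ^ 2)).le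

set_option maxHeartbeats 1000000 in
theorem Fam.ep {J : Finset ℕ} {x : ℕ → ℕ → ℝ} {p q N : ℕ → ℕ} {C : ℝ} {j : ℕ}
    (F : Γ.Fam J x p q C) (hN : ∀ i ∈ J, Γ.RV C (N i) (x i))
    (hqN : ∀ i ∈ J, ∀ k ∈ J, i < k → q i ≤ N k) (hJ : J.card = nn j) :
    Γ.EP C j (((mm j : ℝ) / nn j) • ∑ i ∈ J, x i) := by
  have hC := F.pos
  have hm := mmR_ge j
  have hn := nnR_pos j
  obtain ⟨f1, f2, f3⟩ := pow_facts j
  have hn4 : (mm j : ℝ) ^ 4 ≤ nn j := by exact_mod_cast mm4_le_nn j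
  set m : ℝ := ((mm j : ℕ) : ℝ) with hm'
  set n : ℝ := ((nn j : ℕ) : ℝ) with hn'
  have hm0 : 0 < m := by linarith
  have hmn : m / n ≤ 1 / m ^ 3 := by
    rw [div_le_div_iff₀ hn (by positivity)]; nlinarith
  have hyp : ∀ J' ⊆ J, ∀ γ, j ≤ Γ.w γ → |∑ i ∈ J', x i γ| ≤ C + C / m * J'.card := by
    intro J' hJ' γ hγ
    refine (Finset.abs_sum_le_sum_abs _ _).trans ((F.big hN hqN hJ' γ).trans ?_)
    have : m ≤ mm (Γ.w γ) := mmR_mono hγ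
    gcongr
  have main := F.ris hC (by positivity) hyp (mm j ^ 2)
  set K : ℝ := (2 * nu j : ℝ) ^ (mm j ^ 2) with hK
  have hK0 : 0 < K := by have := nu_pos j; positivity
  have hCD : C / 2 ^ (mm j ^ 2) ≤ C / m := by
    have : C / 2 ^ (mm j ^ 2) = C * (1 / 2 ^ (mm j ^ 2)) := by ring
    rw [this, div_eq_mul_one_div C m]
    refine mul_le_mul_of_nonneg_left ?_ hC
    refine f3.trans (one_div_le_one_div_of_le hm0 ?_)
    nlinarith
  have main' : ∀ J' ⊆ J, ∀ γ, |∑ i ∈ J', x i γ| ≤ 3 * C * K + 2 * C / m * J'.card := by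
    intro J' hJ' γ
    refine (main J' hJ' γ).trans ?_
    have : (C / m + C / 2 ^ (mm j ^ 2)) ≤ 2 * C / m := by rw [mul_div_assoc]; linarith
    have h2 : (C / m + C / 2 ^ (mm j ^ 2)) * (J'.card : ℝ) ≤ 2 * C / m * J'.card := by gcongr
    linarith
  have hcardR : (J.card : ℝ) = n := by rw [hJ]
  have zval : ∀ γ, |((m / n) • ∑ i ∈ J, x i) γ| = m / n * |∑ i ∈ J, x i γ| := by
    intro γ
    rw [Pi.smul_apply, Finset.sum_apply, smul_eq_mul, abs_mul, abs_of_pos (by positivity)]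
  have m3 : (1 : ℝ) / m ^ 3 ≤ 1 := by
    rw [div_le_one (by positivity)]; exact one_le_pow₀ (by linarith)
  have hKn : m / n * K ≤ 1 / m ^ 3 := by
    rw [div_mul_eq_mul_div, div_le_div_iff₀ hn (by positivity)]; nlinarith
  have hνKn : m / n * (nu j * K) ≤ 1 / m ^ 3 := by
    rw [div_mul_eq_mul_div, div_le_div_iff₀ hn (by positivity)]; nlinarith
  have hm3' : (64 : ℝ) / m ^ 3 ≤ 1 := by
    rw [div_le_one (by positivity)]
    calc (64 : ℝ) = 4 ^ 3 := by norm_num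
      _ ≤ m ^ 3 := by gcongr
  have hm3'' : (16 : ℝ) / m ^ 3 ≤ 1 / m := by
    rw [div_le_div_iff₀ (by positivity) hm0]
    have : 16 ≤ m ^ 2 := by nlinarith
    calc 16 * m ≤ m ^ 2 * m := by gcongr
      _ = 1 * m ^ 3 := by ring
  refine ⟨?_, ?_, ?_, ?_⟩
  · intro γ
    rw [zval]
    have h := main' J subset_rfl γ
    rw [hcardR] at h
    calc m / n * |∑ i ∈ J, x i γ| ≤ m / n * (3 * C * K + 2 * C / m * n) := by gcongr
      _ = 3 * C * (m / n * K) + 2 * C := by field_simp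
      _ ≤ 3 * C * (1 / m ^ 3) + 2 * C := by gcongr
      _ ≤ 3 * C := by
        have : 1 / m ^ 3 ≤ 1 / 64 := by
          apply one_div_le_one_div_of_le (by norm_num)
          calc (64 : ℝ) = 4 ^ 3 := by norm_num
            _ ≤ m ^ 3 := by gcongr
        nlinarith
  · intro γ hγ
    rw [zval]
    have h := F.step (K := 3 * C * K) (E := 2 * C / m) (by positivity) (by positivity) main' γ J
      subset_rfl
    rw [hcardR] at h
    have hmγ := mmR_pos (Γ.w γ)
    have hmm : (mm (Γ.w γ) : ℝ) ≤ m := mmR_mono hγ.le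
    set mγ : ℝ := ((mm (Γ.w γ) : ℕ) : ℝ) with hmγ'
    have hage : (Γ.age γ : ℝ) ≤ nu j := by
      exact_mod_cast (Γ.age_le γ).trans (nn_le_nu (by omega))
    have hK1 : 1 ≤ K := one_le_pow₀ (by have : (1 : ℝ) ≤ nu j := by exact_mod_cast nu_pos j
                                        linarith)
    calc m / n * |∑ i ∈ J, x i γ|
        ≤ m / n * (Γ.age γ * (2 * C + 3 * C * K) + 2 * C / m / mγ * n) := by gcongr
      _ ≤ m / n * (nu j * (2 * C * K + 3 * C * K) + 2 * C / m / mγ * n) := by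
        have h2 : 2 * C ≤ 2 * C * K := le_mul_of_one_le_right (by linarith) hK1
        have h3 : 2 * C + 3 * C * K ≤ 2 * C * K + 3 * C * K := by linarith
        gcongr
      _ = 5 * C * (m / n * (nu j * K)) + 2 * C / mγ := by field_simp; ring
      _ ≤ 5 * C * (1 / m ^ 3) + 2 * C / mγ := by gcongr
      _ ≤ C * (1 / m) + 2 * C / mγ := by
        have : 5 * (1 / m ^ 3) ≤ 1 / m := by
          have : 0 < 1 / m ^ 3 := by positivity
          have h5 : 16 / m ^ 3 = 16 * (1 / m ^ 3) := by ring
          linarith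
        nlinarith
      _ ≤ C * (1 / mγ) + 2 * C / mγ := by gcongr
      _ = 3 * C / mγ := by ring
  · intro γ hγ σ
    have hmγ := mmR_pos (Γ.w γ)
    have hmm : 4 * n ^ 2 ≤ (mm (Γ.w γ) : ℝ) := nnR_sq_le hγ
    set mγ : ℝ := ((mm (Γ.w γ) : ℕ) : ℝ) with hmγ'
    have key : |∑ i ∈ J, (x i γ - Γ.E σ (x i) γ)| ≤ 5 * C := by
      refine (Finset.abs_sum_le_sum_abs _ _).trans ?_
      have hle : ∀ i ∈ J, |x i γ - Γ.E σ (x i) γ| ≤ |x i γ| +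
          (if p i < σ ∧ σ < q i then 3 * C else 0) := by
        intro i hi
        have B := F.blk i hi
        split_ifs with h
        · have := sub_E_le (Γ := Γ) (q := σ) (F.bd i hi) γ
          rw [Pi.sub_apply] at this
          linarith [abs_nonneg (x i γ)]
        · rw [add_zero]
          by_cases h1 : p i < σ
          · rw [B.E_ge (by omega)]; simp
          · rw [B.E_le (by omega)]; simp
      refine (Finset.sum_le_sum hle).trans ?_
      rw [Finset.sum_add_distrib]
      have h1 := F.big hN hqN subset_rfl γ
      have h2 : ∑ i ∈ J, (if p i < σ ∧ σ < q i then 3 * C else 0) ≤ 3 * C + 0 * J.card := by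
        refine sum_le_bad (by positivity) le_rfl (fun i _ => by split_ifs <;> linarith) ?_
        intro i hi k hk hik
        by_cases h1 : p i < σ ∧ σ < q i
        · right
          have := F.ord i hi k hk hik
          rw [if_neg (by omega)]
        · left; rw [if_neg h1]
      rw [hcardR] at h1
      have h3 : C / mγ * n ≤ C := by
        rw [div_mul_eq_mul_div, div_le_iff₀ hmγ]
        have h1 : 1 ≤ n := nnR_ge j
        have h2 : n ≤ mγ := by nlinarith
        exact mul_le_mul_of_nonneg_left h2 hC
      linarith
    have e : (((m / n) • ∑ i ∈ J, x i) - Γ.E σ ((m / n) • ∑ i ∈ J, x i)) γ =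
        m / n * ∑ i ∈ J, (x i γ - Γ.E σ (x i) γ) := by
      rw [E_smul, E_sum]
      simp [Finset.sum_apply, mul_sub]
    rw [e, abs_mul, abs_of_pos (by positivity)]
    calc m / n * |∑ i ∈ J, (x i γ - Γ.E σ (x i) γ)| ≤ 1 / m ^ 3 * (5 * C) := by gcongr
      _ = _ := by ring
  · intro γ
    rw [D_smul, D_sum, abs_mul, abs_of_pos (by positivity)]
    have h2 : ∑ i ∈ J, |Γ.D γ (x i)| ≤ 3 * C + 0 * J.card := by
      refine sum_le_bad (by positivity) le_rfl (fun i hi => D_le (F.bd i hi)) ?_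
      intro i hi k hk hik
      by_cases h1 : q i ≤ γ
      · left; rw [(F.blk i hi).D_eq h1]; simp
      · right
        have := F.ord i hi k hk hik
        rw [(F.blk k hk).D_lt (by omega)]; simp
    have h3 : |∑ i ∈ J, Γ.D γ (x i)| ≤ 3 * C :=
      (Finset.abs_sum_le_sum_abs _ _).trans (h2.trans (by simp))
    calc m / n * |∑ i ∈ J, Γ.D γ (x i)| ≤ 1 / m ^ 3 * (3 * C) := by gcongr
      _ = _ := by ring

end Sys
end AH

namespace AH
namespace Sys
variable {Γ : Sys}

inductive Anc (Γ : Sys) : ℕ → ℕ → Prop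
  | refl (n : ℕ) : Anc Γ n n
  | step {n ξ γ : ℕ} : Γ.s n = ξ + 1 → Anc Γ ξ γ → Anc Γ n γ

theorem Anc.w_eq {γ γ' : ℕ} (h : Γ.Anc γ γ') : Γ.w γ' = Γ.w γ := by
  induction h with
  | refl => rfl
  | step hs _ ih => rw [ih, Γ.w_par _ _ hs]

theorem Anc.le {γ γ' : ℕ} (h : Γ.Anc γ γ') : γ' ≤ γ := by
  induction h with
  | refl => rfl
  | @step n ξ γ hs _ ih => have := Γ.s_le n; omega

theorem Anc.tail {γ γ' ξ : ℕ} (h : Γ.Anc γ γ') (hs : Γ.s γ' = ξ + 1) : Γ.Anc γ ξ := by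
  induction h with
  | refl => exact .step hs (.refl _)
  | step hs' _ ih => exact .step hs' (ih hs)

theorem Anc.val {γ γ' p q : ℕ} {v : ℕ → ℝ} (h : Γ.Anc γ γ') (B : Γ.Blk p q v) (hq : q ≤ γ') :
    v γ = v γ' := by
  induction h with
  | refl => rfl
  | @step n ξ γ hs h' ih =>
    have h1 := Γ.s_le n
    have h2 := h'.le
    rw [Sys.eval (Γ := Γ) n v, B.D_eq (by omega), B.E_ge (by omega), hs]
    simpa using ih hq

theorem Blk.val_node {σ ξ : ℕ} {v : ℕ → ℝ} (B : Γ.Blk σ ξ v) (hs : Γ.s ξ = σ) :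
    v ξ = (1 / (mm (Γ.w ξ) : ℝ)) * Γ.bb ξ v := by
  rw [Sys.eval (Γ := Γ) ξ v, B.D_eq le_rfl, hs, B.E_le le_rfl, sub_zero]
  have : pv v σ = 0 := by
    cases σ with
    | zero => simp
    | succ n => rw [pv_succ]; exact B.1 n (by omega)
  rw [this]; ring

theorem special_one {k p q : ℕ} (hk : Odd k) {z : ℕ → ℝ} {C : ℝ} (hC : 0 ≤ C)
    (B : Γ.Blk p q z) (hz : Γ.EP C (code k p) z) (γ : ℕ) (hγ : Γ.w γ = k)
    (hA : ∀ γ', Γ.Anc γ γ' → Γ.s γ' ≠ p) : |z γ| ≤ Γ.age γ * (8 * C / mm (k + 1)) := by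
  induction γ using Nat.strong_induction_on with
  | _ γ ih =>
  have hM := mmR_pos (k + 1)
  have hM1 := mmR_ge (k + 1)
  have hcode : (mm (k + 1) : ℝ) ≤ (mm (code k p) : ℝ) ^ 3 := by
    have h1 : (mm (k + 1) : ℝ) ≤ mm (code k p) := mmR_mono (by unfold code; omega)
    exact h1.trans (le_self_pow₀ (by linarith) (by norm_num))
  have h1 : |Γ.D γ z| ≤ 3 * C / mm (k + 1) := (hz.d γ).trans (by gcongr)
  obtain ⟨η, hη, hwη⟩ := Γ.odd_node γ (hγ ▸ hk)
  rw [hγ] at hwη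
  have hsp : Γ.s γ ≠ p := hA γ (.refl _)
  have h2 : |(z - Γ.E (Γ.s γ) z) η| ≤ 5 * C / mm (k + 1) := by
    rcases lt_or_gt_of_ne hsp with h | h
    · rw [B.E_le h.le, sub_zero]
      refine (hz.lo η (by rw [hwη]; unfold code; omega)).trans ?_
      have : (mm (k + 1) : ℝ) ≤ mm (Γ.w η) := mmR_mono (by rw [hwη]; unfold code; omega)
      gcongr; norm_num
    · exact (hz.hi η (by rw [hwη]; unfold code; omega) _).trans (by gcongr)
  have h3 : |(1 / (mm (Γ.w γ) : ℝ)) * Γ.bb γ (z - Γ.E (Γ.s γ) z)| ≤ 5 * C / mm (k + 1) := by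
    have hm := mmR_ge (Γ.w γ)
    rw [hη, abs_mul, abs_of_pos (by positivity)]
    refine le_trans ?_ h2
    apply mul_le_of_le_one_left (abs_nonneg _)
    rw [div_le_one (by linarith)]; linarith
  have h4 : |pv z (Γ.s γ)| ≤ (Γ.age γ - 1) * (8 * C / mm (k + 1)) := by
    rcases hs : Γ.s γ with _ | ξ
    · rw [Γ.age_zero _ hs]; simp
    · rw [Γ.age_par _ _ hs, pv_succ]
      have := Γ.s_le γ
      have := ih ξ (by omega) (by rw [Γ.w_par _ _ hs, hγ]) (fun γ' h' => hA γ' (.step hs h'))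
      push_cast
      rw [add_sub_cancel_right]; exact this
  rw [Sys.eval (Γ := Γ) γ z]
  have e : 8 * C / (mm (k + 1) : ℝ) = 3 * C / mm (k + 1) + 5 * C / mm (k + 1) := by ring
  calc _ ≤ |Γ.D γ z| + |pv z (Γ.s γ)| + _ := abs_add_three _ _ _
    _ ≤ 3 * C / mm (k + 1) + (Γ.age γ - 1) * (8 * C / mm (k + 1)) + 5 * C / mm (k + 1) := by
      gcongr
    _ = _ := by rw [sub_mul]; linarith

/-- special chains -/
structure Chain (Γ : Sys) (k : ℕ) (σ ξ η : ℕ → ℕ) (z : ℕ → ℕ → ℝ) (C τ : ℝ) : Prop where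
  hk : Odd k
  hC : 0 ≤ C
  hτ : 0 ≤ τ
  hσ : ∀ i, i + 1 < nn k → σ (i + 1) = ξ i + 1
  hw : ∀ i < nn k, Γ.w (ξ i) = k
  hs : ∀ i < nn k, Γ.s (ξ i) = σ i
  hbb : ∀ i < nn k, ∀ x, Γ.bb (ξ i) x = x (η i)
  blk : ∀ i < nn k, Γ.Blk (σ i) (ξ i) (z i)
  ep : ∀ i < nn k, Γ.EP C (code k (σ i)) (z i)
  small : ∀ i < nn k, |z i (η i)| ≤ τ

theorem Chain.le {k : ℕ} {σ ξ η : ℕ → ℕ} {z : ℕ → ℕ → ℝ} {C τ : ℝ}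
    (H : Γ.Chain k σ ξ η z C τ) {i j : ℕ} (hij : i < j) (hj : j < nn k) : ξ i < σ j := by
  induction j with
  | zero => omega
  | succ j ih =>
    rw [H.hσ j hj]
    rcases Nat.lt_succ_iff_lt_or_eq.mp hij with h | h
    · have h1 := ih h (by omega)
      have h2 := Γ.s_le (ξ j)
      rw [H.hs j (by omega)] at h2
      omega
    · subst h; omega

theorem Chain.special {k : ℕ} {σ ξ η : ℕ → ℕ} {z : ℕ → ℕ → ℝ} {C τ : ℝ}
    (H : Γ.Chain k σ ξ η z C τ) {J : Finset ℕ} (hJ : J ⊆ Finset.range (nn k)) (γ : ℕ)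
    (hγ : Γ.w γ = k) : ∑ i ∈ J, |z i γ| ≤ 5 * C + nn k * τ := by
  have hC := H.hC
  have hτ := H.hτ
  have hn := nnR_pos k
  set I : ℕ → Prop := fun i => ∃ γ', Γ.Anc γ γ' ∧ Γ.s γ' = σ i with hI
  have down1 : ∀ i, i + 1 < nn k → I (i + 1) → Γ.Anc γ (ξ i) := by
    rintro i hi ⟨γ', h1, h2⟩
    rw [H.hσ i hi] at h2
    exact h1.tail h2
  have down : ∀ j i, i ≤ j → j < nn k → I j → I i := by
    intro j
    induction j with
    | zero => intro i hi _ h; rwa [Nat.le_zero.mp hi]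
    | succ j ih =>
      intro i hi hj h
      rcases Nat.le_succ_iff.mp hi with h1 | h1
      · exact ih i h1 (by omega) ⟨ξ j, down1 j hj h, H.hs j (by omega)⟩
      · rwa [h1]
  have hcard : (J.card : ℝ) ≤ nn k := by
    exact_mod_cast (Finset.card_le_card hJ).trans (by simp)
  have b1 : ∀ i < nn k, ¬ I i → |z i γ| ≤ 2 * C / nn k := by
    intro i hi hIi
    refine (special_one H.hk hC (H.blk i hi) (H.ep i hi) γ hγ
      (fun γ' h1 h2 => hIi ⟨γ', h1, h2⟩)).trans ?_
    have h1 : (Γ.age γ : ℝ) ≤ nn k := by exact_mod_cast hγ ▸ Γ.age_le γ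
    have h2 := nnR_sq_le (Nat.lt_succ_self k)
    calc (Γ.age γ : ℝ) * (8 * C / mm (k + 1)) ≤ nn k * (8 * C / (4 * nn k ^ 2)) := by
          gcongr
      _ = _ := by field_simp; ring
  have b2 : ∀ i, i + 1 < nn k → I (i + 1) → |z i γ| ≤ τ := by
    intro i hi h
    have hi' : i < nn k := by omega
    rw [(down1 i hi h).val (H.blk i hi') le_rfl, (H.blk i hi').val_node (H.hs i hi'),
      H.hbb i hi', abs_mul, abs_of_pos (by have := mmR_pos (Γ.w (ξ i)); positivity)]
    refine le_trans ?_ (H.small i hi')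
    apply mul_le_of_le_one_left (abs_nonneg _)
    have := mmR_ge (Γ.w (ξ i))
    rw [div_le_one (by linarith)]; linarith
  have key : ∑ i ∈ J, |z i γ| ≤ 3 * C + (τ + 2 * C / nn k) * J.card := by
    have h0 : 0 ≤ 2 * C / nn k := by positivity
    refine sum_le_bad (by linarith) (by linarith)
      (fun i hi => (H.ep i (Finset.mem_range.mp (hJ hi))).bd γ) ?_
    intro i hi j hj hij
    have hj' := Finset.mem_range.mp (hJ hj)
    by_cases h : I (i + 1)
    · left; linarith [b2 i (by omega) h]
    · right
      have := b1 j hj' (fun hh => h (down j (i + 1) hij hj' hh))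
      linarith
  refine key.trans ?_
  have h0 : (τ + 2 * C / nn k) * J.card ≤ (τ + 2 * C / nn k) * nn k := by gcongr
  have h1 : (τ + 2 * C / nn k) * nn k = nn k * τ + 2 * C := by field_simp
  linarith

theorem EP.rv {C : ℝ} {j : ℕ} {z : ℕ → ℝ} (h : Γ.EP C j z) : Γ.RV (3 * C) j z := ⟨h.bd, h.lo⟩

theorem Chain.upper {k : ℕ} {σ ξ η : ℕ → ℕ} {z : ℕ → ℕ → ℝ} {C τ : ℝ}
    (H : Γ.Chain k σ ξ η z C τ) (hτ : nn k * τ ≤ C) (γ : ℕ) :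
    |∑ i ∈ Finset.range (nn k), z i γ| ≤ nn k * (18 * C / mm k ^ 2) := by
  have hC := H.hC
  have hn := nnR_pos k
  have hm := mmR_ge k
  have F : Γ.Fam (Finset.range (nn k)) z σ ξ (3 * C) := by
    refine ⟨by linarith, fun i hi => H.blk i (Finset.mem_range.mp hi), ?_,
      fun i hi => (H.ep i (Finset.mem_range.mp hi)).bd⟩
    intro i _ j hj hij
    exact (H.le hij (Finset.mem_range.mp hj)).le
  have big := fun {J'} => F.big (N := fun i => code k (σ i))
    (fun i hi => (H.ep i (Finset.mem_range.mp hi)).rv)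
    (fun i _ j hj hij => by
      have := H.le hij (Finset.mem_range.mp hj)
      simp only [code]; omega) (J' := J')
  have hyp : ∀ J' ⊆ Finset.range (nn k), ∀ γ, k ≤ Γ.w γ →
      |∑ i ∈ J', z i γ| ≤ 6 * C + 3 * C / mm (k + 1) * J'.card := by
    intro J' hJ' γ hγ
    refine (Finset.abs_sum_le_sum_abs _ _).trans ?_
    have h0 : 0 ≤ 3 * C / mm (k + 1) * (J'.card : ℝ) := by positivity
    rcases hγ.eq_or_lt with h | h
    · have := H.special hJ' γ h.symm
      linarith
    · have h1 := big hJ' γ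
      have h2 : (mm (k + 1) : ℝ) ≤ mm (Γ.w γ) := mmR_mono h
      have h3 : 0 < (mm (k + 1) : ℝ) := mmR_pos _
      have : 3 * C / mm (Γ.w γ) * (J'.card : ℝ) ≤ 3 * C / mm (k + 1) * (J'.card : ℝ) := by gcongr
      linarith
  have main := F.ris (by linarith) (by positivity) hyp (mm k ^ 2) _ subset_rfl γ
  rw [Finset.card_range] at main
  refine main.trans ?_
  obtain ⟨f1, -, f3⟩ := pow_facts k
  have h1 : (2 * nu k : ℝ) ^ (mm k ^ 2) ≤ nn k / mm k ^ 2 := by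
    rw [le_div_iff₀ (by positivity)]
    refine le_trans ?_ f1
    have : (mm k : ℝ) ^ 2 ≤ mm k ^ 4 := pow_le_pow_right₀ (by linarith) (by norm_num)
    gcongr
  have h2 : 3 * C / mm (k + 1) ≤ 3 * C / mm k ^ 2 := by
    have : (mm k : ℝ) ^ 2 ≤ mm (k + 1) := by exact_mod_cast mm_sq_le (Nat.lt_succ_self k)
    gcongr
  have h3 : 3 * C / 2 ^ (mm k ^ 2) ≤ 3 * C / mm k ^ 2 := by
    rw [div_eq_mul_one_div, div_eq_mul_one_div (3 * C) ((mm k : ℝ) ^ 2)]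
    exact mul_le_mul_of_nonneg_left f3 (by linarith)
  calc _ ≤ (6 * C + 2 * (3 * C)) * (nn k / mm k ^ 2) +
        (3 * C / mm k ^ 2 + 3 * C / mm k ^ 2) * nn k := by gcongr
    _ = _ := by ring

end Sys
end AH

namespace AH
open scoped BoundedContinuousFunction
open Filter Topology
namespace Sys
variable {Γ : Sys}

/-- the space -/
def Zs (Γ : Sys) : Submodule ℝ (ℕ →ᵇ ℝ) where
  carrier := {x | ∀ ε > 0, ∃ N, ∀ q ≥ N, ∀ n, |x n - Γ.E q x n| ≤ ε}
  zero_mem' := fun ε hε => ⟨0, fun q _ n => by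
    have : Γ.E q (⇑(0 : ℕ →ᵇ ℝ)) = 0 := E_zero q
    rw [this]; simpa using hε.le⟩
  add_mem' := by
    intro x y hx hy ε hε
    obtain ⟨N, hN⟩ := hx (ε / 2) (by linarith)
    obtain ⟨M, hM⟩ := hy (ε / 2) (by linarith)
    refine ⟨max N M, fun q hq n => ?_⟩
    have h1 := hN q (le_trans (le_max_left _ _) hq) n
    have h2 := hM q (le_trans (le_max_right _ _) hq) n
    rw [BoundedContinuousFunction.coe_add, E_add, Pi.add_apply, Pi.add_apply]
    calc _ = |(x n - Γ.E q x n) + (y n - Γ.E q y n)| := by congr 1; ring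
      _ ≤ _ := (abs_add_le _ _).trans (by linarith)
  smul_mem' := by
    intro a x hx ε hε
    obtain ⟨N, hN⟩ := hx (ε / (|a| + 1)) (by positivity)
    refine ⟨N, fun q hq n => ?_⟩
    have h1 := hN q hq n
    have e : ⇑(a • x) = a • ⇑x := rfl
    rw [e, E_smul, Pi.smul_apply, Pi.smul_apply, ← smul_sub, smul_eq_mul, abs_mul]
    calc |a| * |x n - Γ.E q x n| ≤ (|a| + 1) * (ε / (|a| + 1)) := by gcongr; linarith
      _ = ε := by field_simp

theorem Zs_closed : IsClosed (Γ.Zs : Set (ℕ →ᵇ ℝ)) := by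
  rw [← isSeqClosed_iff_isClosed]
  intro u x hu hx ε hε
  obtain ⟨k, hk⟩ := (Metric.tendsto_atTop.mp hx (ε / 6) (by linarith))
  have hk := hk k le_rfl
  obtain ⟨N, hN⟩ := hu k (ε / 2) (by linarith)
  refine ⟨N, fun q hq n => ?_⟩
  have h1 := hN q hq n
  have h2 : ∀ i, |(⇑x - ⇑(u k)) i| ≤ ε / 6 := fun i => by
    have := BoundedContinuousFunction.dist_coe_le_dist (f := u k) (g := x) i
    rw [Real.dist_eq, abs_sub_comm] at this
    exact this.trans hk.le
  have h3 := sub_E_le (Γ := Γ) (q := q) h2 n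
  rw [E_sub] at h3
  simp only [Pi.sub_apply] at h3
  calc _ = |(x n - u k n - (Γ.E q x n - Γ.E q (u k) n)) + (u k n - Γ.E q (u k) n)| := by
        congr 1; ring
    _ ≤ _ := (abs_add_le _ _).trans (by linarith)

def ZZ (Γ : Sys) : Type := ↥(Γ.Zs)

instance : NormedAddCommGroup (ZZ Γ) := inferInstanceAs (NormedAddCommGroup ↥(Γ.Zs))
instance : NormedSpace ℝ (ZZ Γ) := inferInstanceAs (NormedSpace ℝ ↥(Γ.Zs))
instance : CompleteSpace (ZZ Γ) := Zs_closed.isComplete.completeSpace_coe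

/-- the underlying function -/
def ev (x : ZZ Γ) : ℕ → ℝ := fun n => x.1 n

theorem ev_add (x y : ZZ Γ) : ev (x + y) = ev x + ev y := rfl
theorem ev_sub (x y : ZZ Γ) : ev (x - y) = ev x - ev y := rfl
theorem ev_smul (a : ℝ) (x : ZZ Γ) : ev (a • x) = a • ev x := rfl
theorem ev_zero : ev (0 : ZZ Γ) = 0 := rfl
theorem ev_inj {x y : ZZ Γ} (h : ev x = ev y) : x = y :=
  Subtype.ext (BoundedContinuousFunction.ext fun n => congrFun h n)
def evl : ZZ Γ →ₗ[ℝ] (ℕ → ℝ) := ⟨⟨ev, ev_add⟩, ev_smul⟩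
theorem ev_sum {ι : Type*} (J : Finset ι) (x : ι → ZZ Γ) :
    ev (∑ i ∈ J, x i) = ∑ i ∈ J, ev (x i) := map_sum evl x J
theorem ev_le (x : ZZ Γ) (n : ℕ) : |ev x n| ≤ ‖x‖ := x.1.norm_coe_le_norm n
theorem norm_le {x : ZZ Γ} {C : ℝ} (hC : 0 ≤ C) (h : ∀ n, |ev x n| ≤ C) : ‖x‖ ≤ C :=
  (BoundedContinuousFunction.norm_le hC).mpr h
theorem ev_tail (x : ZZ Γ) {ε : ℝ} (hε : 0 < ε) :
    ∃ N, ∀ q ≥ N, ∀ n, |ev x n - Γ.E q (ev x) n| ≤ ε := x.2 ε hε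

theorem exists_bd (q : ℕ) (u : ℕ → ℝ) : ∃ B, 0 ≤ B ∧ ∀ i < q, |u i| ≤ B :=
  ⟨∑ i ∈ Finset.range q, |u i|, by positivity, fun i hi =>
    Finset.single_le_sum (f := fun i => |u i|) (fun _ _ => abs_nonneg _) (Finset.mem_range.mpr hi)⟩

/-- extension as an element of the space -/
def ofE (Γ : Sys) (q : ℕ) : (ℕ → ℝ) →ₗ[ℝ] ZZ Γ where
  toFun u := ⟨BoundedContinuousFunction.ofNormedAddCommGroup (Γ.E q u) continuous_of_discreteTopology
      (2 * (exists_bd q u).choose) (fun n => E_bound' (exists_bd q u).choose_spec.1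
        (exists_bd q u).choose_spec.2 n), fun ε hε => ⟨q, fun q' hq n => by
          have : Γ.E q' (⇑(BoundedContinuousFunction.ofNormedAddCommGroup (Γ.E q u)
            continuous_of_discreteTopology
            (2 * (exists_bd q u).choose) (fun n => E_bound' (exists_bd q u).choose_spec.1
            (exists_bd q u).choose_spec.2 n))) = Γ.E q u := E_E_of_ge u hq
          rw [this]; simpa using hε.le⟩⟩
  map_add' u v := ev_inj (E_add q u v)
  map_smul' a u := ev_inj (E_smul q a u)

theorem ev_ofE (q : ℕ) (u : ℕ → ℝ) : ev (ofE Γ q u) = Γ.E q u := rfl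

theorem Blk.ev {p q : ℕ} {x : ℕ → ℝ} (h : Γ.Blk p q x) : ev (ofE Γ q x) = x := h.2

/-- the basis projections -/
def P (Γ : Sys) (q : ℕ) : ZZ Γ →L[ℝ] ZZ Γ :=
  ((ofE Γ q).comp evl).mkContinuous 2 fun x =>
    norm_le (by positivity) fun n => E_bound' (norm_nonneg _) (fun i _ => ev_le x i) n

theorem ev_P (q : ℕ) (x : ZZ Γ) : ev (P Γ q x) = Γ.E q (ev x) := rfl

theorem P_le (q : ℕ) (x : ZZ Γ) : ‖P Γ q x‖ ≤ 2 * ‖x‖ :=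
  norm_le (by positivity) fun n => E_bound' (norm_nonneg _) (fun i _ => ev_le x i) n

theorem P_tail (x : ZZ Γ) {ε : ℝ} (hε : 0 < ε) : ∃ N, ∀ q ≥ N, ‖x - P Γ q x‖ ≤ ε := by
  obtain ⟨N, hN⟩ := ev_tail x hε
  exact ⟨N, fun q hq => norm_le hε.le fun n => hN q hq n⟩

/-- invariant sets of coordinates -/
def Inv (Γ : Sys) (A' : Set ℕ) : Prop := ∀ (q : ℕ) (x : ℕ → ℝ),
  (∀ i < q, i ∈ A' → x i = 0) → ∀ n ∈ A', Γ.E q x n = 0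

theorem inv_A (S : Set ℕ) : Γ.Inv (Γ.A S) := fun q x h n hn => by
  have := E_bound (x := x) (B := 0) le_rfl (fun i hi hA => by rw [h i hi hA]; simp) n hn
  simpa using this

theorem inv_empty : Γ.Inv ∅ := fun _ _ _ _ hn => hn.elim

def YY (Γ : Sys) (A' : Set ℕ) : Submodule ℝ (ZZ Γ) where
  carrier := {x | ∀ n ∈ A', ev x n = 0}
  zero_mem' := fun n _ => rfl
  add_mem' := fun hx hy n hn => by rw [ev_add, Pi.add_apply, hx n hn, hy n hn, add_zero]
  smul_mem' := fun a x hx n hn => by rw [ev_smul, Pi.smul_apply, hx n hn, smul_zero]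

theorem mem_YY {A' : Set ℕ} {x : ZZ Γ} : x ∈ YY Γ A' ↔ ∀ n ∈ A', ev x n = 0 := Iff.rfl

/-- coordinate evaluation as a continuous functional -/
def evc (Γ : Sys) (n : ℕ) : ZZ Γ →L[ℝ] ℝ :=
  ((LinearMap.proj n).comp evl).mkContinuous 1 fun x => by rw [one_mul]; exact ev_le x n

theorem evc_apply (n : ℕ) (x : ZZ Γ) : evc Γ n x = ev x n := rfl

theorem YY_closed (A' : Set ℕ) : IsClosed (YY Γ A' : Set (ZZ Γ)) := by
  have : (YY Γ A' : Set (ZZ Γ)) = ⋂ n ∈ A', {x | evc Γ n x = 0} := by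
    ext x; simp [mem_YY, evc_apply]
  rw [this]
  exact isClosed_biInter fun n _ => isClosed_eq (evc Γ n).continuous continuous_const

/-- targets -/
structure Tgt (Γ : Sys) (S : Set ℕ) (V : Type*) [SeminormedAddCommGroup V] [NormedSpace ℝ V] where
  Q : ZZ Γ →L[ℝ] V
  surj : Function.Surjective Q
  lower : ∀ x, ∀ n ∈ Γ.A S, |ev x n| ≤ ‖Q x‖
  upper : ∀ x B, 0 ≤ B → (∀ n ∈ Γ.A S, |ev x n| ≤ B) → ‖Q x‖ ≤ 2 * B

def tgtId (Γ : Sys) : Γ.Tgt Set.univ (ZZ Γ) where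
  Q := ContinuousLinearMap.id ℝ _
  surj := Function.surjective_id
  lower x n _ := ev_le x n
  upper x B hB h := (norm_le hB fun n => h n (by simp [A])).trans (by linarith)

def mkQL (S : Set ℕ) : ZZ Γ →L[ℝ] (ZZ Γ ⧸ YY Γ (Γ.A S)) :=
  ⟨(YY Γ (Γ.A S)).mkQ, continuous_quot_mk⟩

theorem mkQL_le (S : Set ℕ) (x : ZZ Γ) : ‖mkQL S x‖ ≤ ‖x‖ :=
  Submodule.Quotient.norm_mk_le _ x

open Classical in
def tgtQ (Γ : Sys) (S : Set ℕ) : Γ.Tgt S (ZZ Γ ⧸ YY Γ (Γ.A S)) where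
  Q := mkQL S
  surj := Submodule.mkQ_surjective _
  lower x n hn := by
    refine le_of_forall_pos_le_add fun ε hε => ?_
    obtain ⟨y, hy, hy'⟩ := Submodule.Quotient.norm_mk_lt (S := YY Γ (Γ.A S)) (mkQL S x) hε
    have hyx : y - x ∈ YY Γ (Γ.A S) := (Submodule.Quotient.eq _).mp hy
    have := hyx n hn
    rw [ev_sub, Pi.sub_apply, sub_eq_zero] at this
    rw [← this]
    exact (ev_le y n).trans hy'.le
  upper x B hB h := by
    refine le_of_forall_pos_le_add fun ε hε => ?_
    obtain ⟨q, hq⟩ := P_tail x hε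
    set u : ℕ → ℝ := fun n => if n ∈ Γ.A S then ev x n else 0 with hu
    have h1 : mkQL S (P Γ q x) = mkQL S (ofE Γ q u) := by
      refine (Submodule.Quotient.eq _).mpr ?_
      have e : P Γ q x - ofE Γ q u = ofE Γ q (ev x - u) := by
        rw [map_sub]; rfl
      rw [e]
      exact inv_A S q _ fun i _ hi => by simp [hu, hi]
    have h2 : ‖ofE Γ q u‖ ≤ 2 * B := norm_le (by linarith) fun n =>
      E_bound' hB (fun i _ => by
        simp only [hu]; split_ifs with hi
        · exact h i hi
        · simpa using hB) n
    have e : mkQL S x = mkQL S (ofE Γ q u) + mkQL S (x - P Γ q x) := by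
      rw [map_sub, h1]; abel
    rw [e]
    exact (norm_add_le _ _).trans (add_le_add ((mkQL_le _ _).trans h2)
      ((mkQL_le _ _).trans (hq q le_rfl)))

section
variable {S : Set ℕ} {V : Type*} [SeminormedAddCommGroup V] [NormedSpace ℝ V]

theorem Tgt.coord (t : Γ.Tgt S V) {n : ℕ} (hn : n ∈ Γ.A S) :
    ∃ ψ : V →L[ℝ] ℝ, ∀ x, ψ (t.Q x) = ev x n := by
  choose c hc using t.surj
  have key : ∀ x y, t.Q x = t.Q y → ev x n = ev y n := fun x y h => by
    have := t.lower (x - y) n hn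
    rw [map_sub, h, sub_self, norm_zero, ev_sub, Pi.sub_apply] at this
    linarith [abs_nonpos_iff.mp this]
  let f : V →ₗ[ℝ] ℝ :=
    { toFun := fun v => ev (c v) n
      map_add' := fun v v' => by
        rw [key (c (v + v')) (c v + c v') (by rw [map_add, hc, hc, hc])]; rfl
      map_smul' := fun a v => by
        rw [key (c (a • v)) (a • c v) (by rw [map_smul, hc, hc])]; rfl }
  refine ⟨f.mkContinuous 1 fun v => ?_, fun x => key _ _ (hc _)⟩
  have := t.lower (c v) n hn
  rw [hc] at this
  rw [one_mul]; exact this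

end

theorem linfty_of {X : Type*} [NormedAddCommGroup X] [NormedSpace ℝ X] (F : ℕ → Submodule ℝ X)
    (hF : Monotone F) (hd : ∀ x, ∀ ε > 0, ∃ q, ∃ y ∈ F q, ‖x - y‖ ≤ ε)
    (he : ∀ q, ∃ (ι : Type) (_ : Fintype ι) (e : F q ≃ₗ[ℝ] (ι → ℝ)),
      (∀ x, ‖e x‖ ≤ ‖x‖) ∧ ∀ x, ‖x‖ ≤ 2 * ‖e x‖) :
    IsLinftySpace X ∧ TopologicalSpace.SeparableSpace X := by
  have hfd : ∀ n, FiniteDimensional ℝ (F n) := fun n => by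
    obtain ⟨ι, _, e, -, -⟩ := he n
    exact LinearEquiv.finiteDimensional e.symm
  have hdense : Dense (⋃ n, (F n : Set X)) := by
    intro x
    rw [Metric.mem_closure_iff]
    intro ε hε
    obtain ⟨q, y, hy, h⟩ := hd x (ε / 2) (by linarith)
    exact ⟨y, Set.mem_iUnion.mpr ⟨q, hy⟩, by rw [dist_eq_norm]; linarith⟩
  refine ⟨⟨2, by norm_num, F, hF, hfd, hdense, fun n => ?_⟩, ?_⟩
  · obtain ⟨ι, _, e, h1, h2⟩ := he n
    have hr : Module.finrank ℝ (F n) = Fintype.card ι := by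
      rw [e.finrank_eq, Module.finrank_fintype_fun_eq_card]
    let r : ι ≃ Fin (Module.finrank ℝ (F n)) := (Fintype.equivFin ι).trans (finCongr hr.symm)
    let R : (ι → ℝ) ≃ₗᵢ[ℝ] (Fin (Module.finrank ℝ (F n)) → ℝ) :=
      { LinearEquiv.funCongrLeft ℝ ℝ r.symm with
        norm_map' := fun x => by
          change ‖x ∘ r.symm‖ = ‖x‖
          simp only [Pi.norm_def]
          congr 1
          rw [← Finset.univ_map_equiv_to_embedding r, Finset.sup_map]
          congr 1
          funext i; simp }
    let T := (e.trans R.toLinearEquiv).toContinuousLinearEquiv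
    refine ⟨T, ?_⟩
    have a1 : ‖(T : F n →L[ℝ] (Fin (Module.finrank ℝ (F n)) → ℝ))‖ ≤ 1 := ContinuousLinearMap.opNorm_le_bound _ zero_le_one
      fun x => by
        change ‖R (e x)‖ ≤ _
        rw [R.norm_map, one_mul]; exact h1 x
    have a2 : ‖(T.symm : (Fin (Module.finrank ℝ (F n)) → ℝ) →L[ℝ] F n)‖ ≤ 2 := ContinuousLinearMap.opNorm_le_bound _ zero_le_two
      fun y => by
        obtain ⟨x, rfl⟩ := T.surjective y
        change ‖T.symm (T x)‖ ≤ 2 * ‖R (e x)‖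
        rw [T.symm_apply_apply, R.norm_map]; exact h2 x
    calc _ ≤ 1 * 2 := mul_le_mul a1 a2 (ContinuousLinearMap.opNorm_nonneg _) zero_le_one
      _ = 2 := by norm_num
  · have hsep : TopologicalSpace.IsSeparable (⋃ n, (F n : Set X)) := by
      refine TopologicalSpace.IsSeparable.iUnion fun n => ?_
      have := (TopologicalSpace.isSeparable_univ_iff.mpr
        (inferInstance : TopologicalSpace.SeparableSpace (F n))).image continuous_subtype_val
      simpa using this
    have := hsep.closure
    rw [hdense.closure_eq] at this
    exact TopologicalSpace.isSeparable_univ_iff.mp this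

open Classical in
theorem linfty_emb {X : Type*} [NormedAddCommGroup X] [NormedSpace ℝ X] (i : X →ₗᵢ[ℝ] ZZ Γ)
    {A' : Set ℕ} (hA : Γ.Inv A') (hr : ∀ z, z ∈ YY Γ A' → ∃ x, i x = z)
    (hr' : ∀ x, i x ∈ YY Γ A') :
    IsLinftySpace X ∧ TopologicalSpace.SeparableSpace X := by
  refine linfty_of (fun q => LinearMap.ker (i.toLinearMap - (P Γ q).toLinearMap ∘ₗ i.toLinearMap))
    ?_ ?_ ?_
  · intro q q' hq x hx
    simp only [LinearMap.mem_ker, LinearMap.sub_apply, sub_eq_zero] at hx ⊢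
    apply ev_inj
    have hx' : ev (i x) = Γ.E q (ev (i x)) := congrArg ev hx
    change ev (i x) = Γ.E q' (ev (i x))
    rw [hx', E_E_of_ge _ hq]
  · intro x ε hε
    obtain ⟨q, hq⟩ := P_tail (i x) hε
    obtain ⟨y, hy⟩ := hr (P Γ q (i x)) (hA q _ fun k _ hk => hr' x k hk)
    refine ⟨q, y, ?_, ?_⟩
    · simp only [LinearMap.mem_ker, LinearMap.sub_apply, sub_eq_zero]
      apply ev_inj
      change ev (i y) = Γ.E q (ev (i y))
      rw [hy, ev_P, E_E_of_ge _ le_rfl]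
    · rw [← i.norm_map, map_sub, hy]; exact hq q le_rfl
  · intro q
    let I := {n : Fin q // (n : ℕ) ∉ A'}
    set F := LinearMap.ker (i.toLinearMap - (P Γ q).toLinearMap ∘ₗ i.toLinearMap) with hF
    have memF : ∀ x : X, x ∈ F ↔ ev (i x) = Γ.E q (ev (i x)) := fun x => by
      simp only [hF, LinearMap.mem_ker, LinearMap.sub_apply, sub_eq_zero]
      exact ⟨fun h => congrArg ev h, fun h => ev_inj h⟩
    let f : F →ₗ[ℝ] (I → ℝ) := LinearMap.pi fun n =>
      (LinearMap.proj (n.1 : ℕ)).comp (evl.comp (i.toLinearMap.comp F.subtype))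
    have hf : ∀ (x : F) (n : I), f x n = ev (i x) n.1 := fun x n => rfl
    have u1 : ∀ x, ‖f x‖ ≤ ‖x‖ := fun x => by
      rw [pi_norm_le_iff_of_nonneg (norm_nonneg _)]
      intro n
      rw [hf, Real.norm_eq_abs]
      refine (ev_le _ _).trans ?_
      rw [i.norm_map]; rfl
    have u2 : ∀ x, ‖x‖ ≤ 2 * ‖f x‖ := fun x => by
      change ‖(x : X)‖ ≤ _
      rw [← i.norm_map]
      refine norm_le (by positivity) fun n => ?_
      rw [(memF x).mp x.2]
      refine E_bound' (norm_nonneg _) (fun k hk => ?_) n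
      by_cases hkA : k ∈ A'
      · rw [hr' x k hkA]; simp
      · exact norm_le_pi_norm (f x) (⟨⟨k, hk⟩, hkA⟩ : I)
    have hinj : Function.Injective f := by
      rw [injective_iff_map_eq_zero]
      intro x hx
      have := u2 x
      rw [hx, norm_zero, mul_zero] at this
      exact norm_le_zero_iff.mp this
    have hsurj : Function.Surjective f := by
      intro g
      let u : ℕ → ℝ := fun n => if h : ∃ h : n < q, n ∉ A' then g ⟨⟨n, h.1⟩, h.2⟩ else 0
      obtain ⟨x, hx⟩ := hr (ofE Γ q u) (hA q u fun k _ hk => by simp [u, hk])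
      refine ⟨⟨x, (memF x).mpr ?_⟩, ?_⟩
      · rw [hx, ev_ofE, E_E_of_ge _ le_rfl]
      · funext n
        rw [hf]
        change ev (i x) n.1 = g n
        rw [hx, ev_ofE, E_lt _ n.1.2]
        have : ∃ h : (n.1 : ℕ) < q, (n.1 : ℕ) ∉ A' := ⟨n.1.2, n.2⟩
        simp only [u, dif_pos this]
        rfl
    exact ⟨I, inferInstance, LinearEquiv.ofBijective f ⟨hinj, hsurj⟩, u1, u2⟩

end Sys
end AH

namespace AH
open Filter Topology
namespace Sys
variable {Γ : Sys}

/-- admissible starting point for a chain of weight `j` -/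
def Val (Γ : Sys) (S : Set ℕ) (j σ : ℕ) : Prop :=
  σ = 0 ∨ ∃ ξ, σ = ξ + 1 ∧ ξ ∈ Γ.A S ∧ Γ.w ξ = j ∧ Γ.age ξ < nn j

/-- chains of nodes -/
structure NCh (Γ : Sys) (S : Set ℕ) (j : ℕ) (σ ξ : ℕ → ℕ) : Prop where
  suc : ∀ i, i + 1 < nn j → σ (i + 1) = ξ i + 1
  mem : ∀ i < nn j, ξ i ∈ Γ.A S
  hw : ∀ i < nn j, Γ.w (ξ i) = j
  hs : ∀ i < nn j, Γ.s (ξ i) = σ i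

theorem build {O : Type*} {S : Set ℕ} {j : ℕ} (R : ℕ → O → ℕ → Prop)
    (step : ∀ σ, Γ.Val S j σ → ∃ o ξ, ξ ∈ Γ.A S ∧ Γ.w ξ = j ∧ Γ.s ξ = σ ∧ R σ o ξ) :
    ∃ (σ ξ : ℕ → ℕ) (o : ℕ → O), Γ.NCh S j σ ξ ∧ ∀ i < nn j, R (σ i) (o i) (ξ i) := by
  classical
  obtain ⟨o0, -⟩ := step 0 (Or.inl rfl)
  have step' : ∀ σ, ∃ o ξ, Γ.Val S j σ → ξ ∈ Γ.A S ∧ Γ.w ξ = j ∧ Γ.s ξ = σ ∧ R σ o ξ := by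
    intro σ
    by_cases h : Γ.Val S j σ
    · obtain ⟨o, ξ, h'⟩ := step σ h
      exact ⟨o, ξ, fun _ => h'⟩
    · exact ⟨o0, 0, fun h' => absurd h' h⟩
  choose fo fx hf using step'
  let σ : ℕ → ℕ := fun i => Nat.rec 0 (fun _ s => fx s + 1) i
  have hσ : ∀ i, σ (i + 1) = fx (σ i) + 1 := fun i => rfl
  have inv : ∀ i < nn j, Γ.Val S j (σ i) ∧ Γ.age (fx (σ i)) = i + 1 := by
    intro i
    induction i with
    | zero =>
      intro _
      have hv : Γ.Val S j (σ 0) := Or.inl rfl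
      exact ⟨hv, Γ.age_zero _ (hf _ hv).2.2.1⟩
    | succ i ih =>
      intro hi
      obtain ⟨hv, ha⟩ := ih (by omega)
      have h1 := hf _ hv
      have hv' : Γ.Val S j (σ (i + 1)) :=
        Or.inr ⟨fx (σ i), hσ i, h1.1, h1.2.1, by omega⟩
      refine ⟨hv', ?_⟩
      rw [Γ.age_par _ (fx (σ i)) ((hf _ hv').2.2.1.trans (hσ i)), ha]
  exact ⟨σ, fun i => fx (σ i), fun i => fo (σ i),
    ⟨fun i _ => rfl, fun i hi => (hf _ (inv i hi).1).1, fun i hi => (hf _ (inv i hi).1).2.1,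
      fun i hi => (hf _ (inv i hi).1).2.2.1⟩, fun i hi => (hf _ (inv i hi).1).2.2.2⟩

theorem NCh.le {S : Set ℕ} {k : ℕ} {σ ξ : ℕ → ℕ}
    (H : Γ.NCh S k σ ξ) {i j : ℕ} (hij : i < j) (hj : j < nn k) : ξ i < σ j := by
  induction j with
  | zero => omega
  | succ j ih =>
    rw [H.suc j hj]
    rcases Nat.lt_succ_iff_lt_or_eq.mp hij with h | h
    · have h1 := ih h (by omega)
      have h2 := Γ.s_le (ξ j)
      rw [H.hs j (by omega)] at h2
      omega
    · subst h; omega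

theorem NCh.σ_le {S : Set ℕ} {k : ℕ} {σ ξ : ℕ → ℕ}
    (H : Γ.NCh S k σ ξ) {i : ℕ} (hi : i < nn k) : σ i ≤ ξ i := by
  have h2 := Γ.s_le (ξ i)
  rwa [H.hs i hi] at h2

theorem NCh.anc {S : Set ℕ} {k : ℕ} {σ ξ : ℕ → ℕ}
    (H : Γ.NCh S k σ ξ) {i j : ℕ} (hij : i ≤ j) (hj : j < nn k) : Γ.Anc (ξ j) (ξ i) := by
  induction j with
  | zero => rw [Nat.le_zero.mp hij]; exact .refl _
  | succ j ih =>
    rcases Nat.le_succ_iff.mp hij with h | h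
    · exact .step ((H.hs _ hj).trans (H.suc j hj)) (ih h (by omega))
    · rw [h]; exact .refl _

theorem NCh.y_lower {S : Set ℕ} {j : ℕ} {σ ξ : ℕ → ℕ} (H : Γ.NCh S j σ ξ) {i γ : ℕ}
    (hi : i < nn j) (hγ : Γ.Anc γ (ξ i)) (hγA : γ ∈ Γ.A S) {y : ℕ → ℝ} {β ε : ℝ} (hε : 0 ≤ ε)
    (h1 : β ≤ Γ.bb (ξ i) y) (h2 : ∀ n ∈ Γ.A S, n < σ i → |y n| ≤ ε)
    (h3 : ∀ n, |y n - Γ.E (ξ i) y n| ≤ ε) :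
    (1 / (mm j : ℝ)) * (β - 3 * ε) - 3 * ε ≤ y γ := by
  have hσ := H.σ_le hi
  have hEσ : ∀ n ∈ Γ.A S, |Γ.E (σ i) y n| ≤ 2 * ε := E_bound hε fun k hk hA => h2 k hA hk
  have B : Γ.Blk (σ i) (ξ i) (Γ.E (ξ i) y - Γ.E (σ i) y) := by
    constructor
    · intro k hk
      rw [Pi.sub_apply, E_lt _ (by omega), E_lt _ hk, sub_self]
    · rw [E_sub, E_E_of_ge _ le_rfl, E_E_of_ge _ hσ]
  have v1 := hγ.val B le_rfl
  rw [B.val_node (H.hs i hi), H.hw i hi, Pi.sub_apply, map_sub] at v1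
  have b1 : |Γ.bb (ξ i) (Γ.E (σ i) y)| ≤ 2 * ε := by
    refine Γ.bb_le _ _ _ (by linarith) fun k _ hk => hEσ k ?_
    exact (Finset.coe_subset.mpr hk).trans (H.mem i hi)
  have b2 : |Γ.bb (ξ i) (y - Γ.E (ξ i) y)| ≤ ε := bb_abs_le h3
  rw [map_sub] at b2
  have c1 := (abs_le.mp b1).2
  have c2 := (abs_le.mp b2).2
  have c3 := (abs_le.mp (h3 γ)).1
  have c4 := (abs_le.mp (hEσ γ hγA)).1
  have hm := mmR_pos j
  have c5 : (1 / (mm j : ℝ)) * (β - 3 * ε) ≤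
      (1 / (mm j : ℝ)) * (Γ.bb (ξ i) (Γ.E (ξ i) y) - Γ.bb (ξ i) (Γ.E (σ i) y)) := by
    refine mul_le_mul_of_nonneg_left ?_ (by positivity)
    linarith
  linarith

section
variable {W : Type*} [NormedAddCommGroup W] [NormedSpace ℝ W] (i : W →ₗᵢ[ℝ] ZZ Γ)

/-- rapidly increasing block `x` approximated by the vector `w` -/
structure Adm (C : ℝ) (N q : ℕ) (x : ℕ → ℝ) (w : W) : Prop where
  blk : Γ.Blk N q x
  rv : Γ.RV C N x
  near : ∀ n, |ev (i w) n - x n| ≤ 1 / (N + 1)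

variable {i}
theorem Adm.mono {C : ℝ} {N N' q : ℕ} {x : ℕ → ℝ} {w : W} (h : Adm i C N q x w) (hN : N' ≤ N) :
    Adm i C N' q x w :=
  ⟨h.blk.mono hN le_rfl, ⟨h.rv.1, fun n hn => h.rv.2 n (by omega)⟩, fun n =>
    (h.near n).trans (by gcongr)⟩

theorem Adm.q_mono {C : ℝ} {N q q' : ℕ} {x : ℕ → ℝ} {w : W} (h : Adm i C N q x w) (hq : q ≤ q') :
    Adm i C N q' x w := ⟨h.blk.mono le_rfl hq, h.rv, h.near⟩

theorem Adm.neg {C : ℝ} {N q : ℕ} {x : ℕ → ℝ} {w : W} (h : Adm i C N q x w) :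
    Adm i C N q (-x) (-w) :=
  ⟨by simpa using h.blk.smul (-1), ⟨fun n => by simpa using h.rv.1 n, fun n hn => by
    simpa using h.rv.2 n hn⟩, fun n => by
    have e : ev (i (-w)) = (-1 : ℝ) • ev (i w) := by
      rw [map_neg, ← neg_one_smul ℝ, ev_smul]
    rw [e]
    have := h.near n
    rw [abs_sub_comm] at this
    simpa [sub_eq_add_neg, add_comm] using this⟩

theorem weak_null (φ : W →L[ℝ] ℝ) (C : ℝ) {ε : ℝ} (hε : 0 < ε) :
    ∃ N, ∀ q x w, Adm i C N q x w → |φ w| ≤ ε := by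
  by_contra! hcon
  have hcon' : ∀ N, ∃ q x w, N ≤ q ∧ Adm i C N q x w ∧ ε < φ w := by
    intro N
    obtain ⟨q, x, w, h, h'⟩ := hcon N
    rcases lt_abs.mp h' with h1 | h1
    · exact ⟨max q N, x, w, le_max_right _ _, h.q_mono (le_max_left _ _), h1⟩
    · exact ⟨max q N, -x, -w, le_max_right _ _, h.neg.q_mono (le_max_left _ _), by simpa using h1⟩
  choose fq fx fw hf using hcon'
  have hC : 0 ≤ C := (abs_nonneg _).trans ((hf 0).2.1.rv.1 0)
  obtain ⟨M, hM⟩ := exists_nat_gt ((‖φ‖ * (3 * C + 1)) / ε)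
  let N : ℕ → ℕ := fun i => Nat.rec M (fun _ s => fq s) i
  have hN : ∀ i, N (i + 1) = fq (N i) := fun i => rfl
  have hmono : Monotone N := monotone_nat_of_le_succ fun i => by rw [hN]; exact (hf _).1
  have hq : ∀ a b, a < b → fq (N a) ≤ N b := fun a b hab => by
    rw [← hN]; exact hmono hab
  have F : Γ.Fam (Finset.range (nn M)) (fun a => fx (N a)) N (fun a => fq (N a)) C :=
    ⟨hC, fun a _ => (hf _).2.1.blk, fun a _ b _ => hq a b, fun a _ => (hf _).2.1.rv.1⟩
  have ep := F.ep (N := N) (j := M) (fun a _ => (hf _).2.1.rv) (fun a _ b _ => hq a b) (by simp)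
  have hm := mmR_ge M
  have hn := nnR_pos M
  set w : W := (1 / (nn M : ℝ)) • ∑ a ∈ Finset.range (nn M), fw (N a) with hw
  have hMm : (M : ℝ) ≤ mm M := by exact_mod_cast (le_nu M).trans (nu_le_mm M)
  have hle : ‖w‖ ≤ 3 * C / mm M + 1 / (M + 1) := by
    rw [← i.norm_map]
    refine norm_le (by positivity) fun n => ?_
    have e : ev (i w) n = (1 / (nn M : ℝ)) * ∑ a ∈ Finset.range (nn M), fx (N a) n +
        (1 / (nn M : ℝ)) * ∑ a ∈ Finset.range (nn M), (ev (i (fw (N a))) n - fx (N a) n) := by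
      rw [hw, map_smul, map_sum, ev_smul, ev_sum, Finset.sum_sub_distrib]
      simp only [Pi.smul_apply, Finset.sum_apply, smul_eq_mul]
      ring
    rw [e]
    refine (abs_add_le _ _).trans (add_le_add ?_ ?_)
    · have h1 := ep.bd n
      rw [Pi.smul_apply, Finset.sum_apply, smul_eq_mul, abs_mul, abs_of_pos (by positivity)] at h1
      rw [abs_mul, abs_of_pos (by positivity), le_div_iff₀ (by linarith)]
      refine le_trans (le_of_eq ?_) h1
      ring
    · rw [abs_mul, abs_of_pos (by positivity), one_div, inv_mul_le_iff₀ hn]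
      refine (Finset.abs_sum_le_sum_abs _ _).trans ?_
      have := Finset.sum_le_card_nsmul (Finset.range (nn M))
        (fun a => |ev (i (fw (N a))) n - fx (N a) n|) (1 / ((M : ℝ) + 1)) (fun a _ => by
          refine ((hf (N a)).2.1.near n).trans ?_
          have : (M : ℝ) ≤ N a := by exact_mod_cast hmono (Nat.zero_le a)
          gcongr)
      simpa using this
  have h1 : φ w ≤ ‖φ‖ * (3 * C / mm M + 1 / (M + 1)) :=
    (le_abs_self _).trans ((φ.le_opNorm w).trans (by gcongr))
  have h2 : ε ≤ φ w := by
    rw [hw, map_smul, map_sum, smul_eq_mul, one_div, ← div_eq_inv_mul, le_div_iff₀ hn]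
    have := Finset.card_nsmul_le_sum (Finset.range (nn M)) (fun a => φ (fw (N a))) ε
      (fun a _ => (hf (N a)).2.2.le)
    simpa [mul_comm] using this
  have hM0 : (0 : ℝ) < M := lt_of_le_of_lt (by positivity) hM
  have h3 : 3 * C / mm M + 1 / (M + 1) ≤ (3 * C + 1) / M := by
    rw [add_div]
    gcongr
    linarith
  have h4 : ‖φ‖ * (3 * C / mm M + 1 / (M + 1)) ≤ (‖φ‖ * (3 * C + 1)) / M := by
    rw [mul_div_assoc ‖φ‖]; exact mul_le_mul_of_nonneg_left h3 (norm_nonneg _)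
  rw [div_lt_iff₀ hε] at hM
  have h5 : (‖φ‖ * (3 * C + 1)) / M < ε := by
    rw [div_lt_iff₀ hM0]; linarith
  linarith

end

theorem sep_pair {A : Set ℕ} {f g : ℕ → ℝ} {δ ε K : ℝ} (hδ : 0 < δ) (hε : 0 < ε)
    (hf : ∀ n ∈ A, |f n| ≤ K) (h : ∀ c : ℝ, ∃ n ∈ A, δ < |g n - c * f n|) :
    ∃ a ∈ A, ∃ b ∈ A, ∃ r₁ r₂ : ℚ, |r₁| + |r₂| ≤ 1 ∧ |(r₁ : ℝ) * f a + r₂ * f b| ≤ ε ∧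
      δ / 8 ≤ r₁ * g a + r₂ * g b := by
  -- reduce sign
  suffices H : ∃ a ∈ A, ∃ b ∈ A, ∃ r₁ r₂ : ℚ, |r₁| + |r₂| ≤ 1 ∧ |(r₁ : ℝ) * f a + r₂ * f b| ≤ ε ∧
      δ / 8 ≤ |r₁ * g a + r₂ * g b| by
    obtain ⟨a, ha, b, hb, r₁, r₂, h1, h2, h3⟩ := H
    rcases le_abs.mp h3 with h4 | h4
    · exact ⟨a, ha, b, hb, r₁, r₂, h1, h2, h4⟩
    · refine ⟨a, ha, b, hb, -r₁, -r₂, by simpa using h1, ?_, ?_⟩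
      · rw [← abs_neg]; convert h2 using 2; push_cast; ring
      · push_cast; linarith
  by_cases h0 : ∀ n ∈ A, f n = 0
  · obtain ⟨n, hn, hn'⟩ := h 0
    refine ⟨n, hn, n, hn, 1, 0, by simp, by simp [h0 n hn, hε.le], ?_⟩
    simp only [zero_mul, sub_zero] at hn'
    simp; linarith
  · push Not at h0
    obtain ⟨n0, hn0, hf0⟩ := h0
    -- near-maximal coordinate
    have hmax : ∃ b ∈ A, f b ≠ 0 ∧ ∀ n ∈ A, |f n| ≤ 2 * |f b| := by
      by_contra! hc
      have : ∀ k : ℕ, ∃ n ∈ A, f n ≠ 0 ∧ 2 ^ k * |f n0| ≤ |f n| := by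
        intro k
        induction k with
        | zero => exact ⟨n0, hn0, hf0, by simp⟩
        | succ k ih =>
          obtain ⟨n, hn, h1, h2⟩ := ih
          obtain ⟨n', hn', h3⟩ := hc n hn h1
          refine ⟨n', hn', ?_, ?_⟩
          · intro h4; rw [h4, abs_zero] at h3; linarith [abs_nonneg (f n)]
          · rw [pow_succ]; linarith
      obtain ⟨k, hk⟩ := pow_unbounded_of_one_lt (K / |f n0|) (one_lt_two : (1 : ℝ) < 2)
      obtain ⟨n, hn, -, h2⟩ := this k
      have h3 := hf n hn
      have : 0 < |f n0| := abs_pos.mpr hf0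
      rw [div_lt_iff₀ this] at hk
      linarith
    obtain ⟨b, hb, hfb, hmax⟩ := hmax
    obtain ⟨a, ha, hga⟩ := h (g b / f b)
    set t := f a / f b with ht
    have hfb' : 0 < |f b| := abs_pos.mpr hfb
    have ht2 : |t| ≤ 2 := by
      rw [ht, abs_div, div_le_iff₀ hfb']; exact hmax a ha
    have hfa : f a = t * f b := by rw [ht]; field_simp
    set κ := min 1 (min (ε / (|f b| + 1)) (δ / (2 * (|g b| + 1)))) with hκ
    have hκ0 : 0 < κ := by
      rw [hκ]; refine lt_min one_pos (lt_min (by positivity) (by positivity))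
    obtain ⟨ρ, h1, h2⟩ := exists_rat_btwn (show t - κ < t by linarith)
    have hκ1 : κ ≤ 1 := min_le_left _ _
    have hκ2 : κ * (|f b| + 1) ≤ ε := by
      rw [← le_div_iff₀ (by positivity)]; exact (min_le_right _ _).trans (min_le_left _ _)
    have hκ3 : κ * (2 * (|g b| + 1)) ≤ δ := by
      rw [← le_div_iff₀ (by positivity)]; exact (min_le_right _ _).trans (min_le_right _ _)
    have hd : |t - ρ| ≤ κ := by rw [abs_le]; constructor <;> linarith
    have hρ : |(ρ : ℝ)| ≤ 3 := by
      rw [abs_le] at ht2 ⊢; constructor <;> linarith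
    have hρ' : |ρ| ≤ 3 := by exact_mod_cast hρ
    refine ⟨a, ha, b, hb, 1 / 4, -ρ / 4, ?_, ?_, ?_⟩
    · rw [abs_div (-ρ), abs_neg, abs_of_pos (by norm_num : (0 : ℚ) < 1 / 4),
        abs_of_pos (by norm_num : (0 : ℚ) < 4)]
      linarith
    · push_cast
      rw [hfa, show (1 / 4 : ℝ) * (t * f b) + -(ρ : ℝ) / 4 * f b = 1 / 4 * ((t - ρ) * f b) by ring,
        abs_mul, abs_mul, abs_of_pos (by norm_num : (0 : ℝ) < 1 / 4)]
      have : |t - ρ| * |f b| ≤ κ * |f b| := by gcongr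
      nlinarith [abs_nonneg (f b)]
    · push_cast
      have e1 : g a - g b / f b * f a = g a - t * g b := by rw [ht]; field_simp
      rw [e1] at hga
      have h5 : |(t - ρ) * g b| ≤ δ / 2 := by
        rw [abs_mul]
        have : |t - ρ| * |g b| ≤ κ * |g b| := by gcongr
        nlinarith
      have h6 := abs_sub_abs_le_abs_sub (g a - t * g b) (-((t - ρ) * g b))
      rw [abs_neg] at h6
      rw [show (1 / 4 : ℝ) * g a + -(ρ : ℝ) / 4 * g b =
        1 / 4 * (g a - t * g b - -((t - ρ) * g b)) by ring, abs_mul,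
        abs_of_pos (by norm_num : (0 : ℝ) < 1 / 4)]
      linarith

end Sys
end AH

namespace AH
open Filter Topology
namespace Sys
variable {Γ : Sys}
variable {W : Type*} [NormedAddCommGroup W] [NormedSpace ℝ W] {i : W →ₗᵢ[ℝ] ZZ Γ}
  {S : Set ℕ} {V : Type*} [SeminormedAddCommGroup V] [NormedSpace ℝ V]

theorem weak_null_many (t : Γ.Tgt S V) (T : W →L[ℝ] V) (C : ℝ) {ε : ℝ} (hε : 0 < ε) (M : ℕ) :
    ∃ N, ∀ q x w y, Adm i C N q x w → t.Q y = T w → ∀ n < M, n ∈ Γ.A S → |ev y n| ≤ ε := by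
  induction M with
  | zero => exact ⟨0, fun _ _ _ _ _ _ n hn => by omega⟩
  | succ M ih =>
    obtain ⟨N1, h1⟩ := ih
    by_cases hM : M ∈ Γ.A S
    · obtain ⟨ψ, hψ⟩ := t.coord hM
      obtain ⟨N2, h2⟩ := weak_null (i := i) (ψ.comp T) C hε
      refine ⟨max N1 N2, fun q x w y hA hy n hn hnA => ?_⟩
      rcases Nat.lt_succ_iff_lt_or_eq.mp hn with h | h
      · exact h1 q x w y (hA.mono (le_max_left _ _)) hy n h hnA
      · have := h2 q x w (hA.mono (le_max_right _ _))
        rw [ContinuousLinearMap.comp_apply, ← hy, hψ] at this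
        rwa [h]
    · refine ⟨N1, fun q x w y hA hy n hn hnA => ?_⟩
      rcases Nat.lt_succ_iff_lt_or_eq.mp hn with h | h
      · exact h1 q x w y hA hy n h hnA
      · exact absurd (h ▸ hnA) hM

theorem level1 (t : Γ.Tgt S V) (T : W →L[ℝ] V) {C δ : ℝ} (hδ : 0 < δ)
    (hbad : ∀ N, ∃ q x w, Adm i C N q x w ∧ ∀ c : ℝ, δ < ‖T w - c • t.Q (i w)‖)
    {j : ℕ} (hj : ¬ Odd j) (N0 : ℕ) {τ : ℝ} (hτ : 0 < τ) :
    ∃ q z w y η, Γ.Blk N0 q z ∧ Γ.EP C j z ∧ η ∈ Γ.A S ∧ Γ.w η = j ∧ |z η| ≤ τ ∧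
      δ / 32 ≤ ev y η ∧ (∀ n, |ev (i w) n - z n| ≤ τ) ∧ t.Q y = T w ∧
      ∀ n ∈ Γ.A S, n < N0 → |ev y n| ≤ τ := by
  have hm := mmR_ge j
  have hn := nnR_pos j
  set m : ℝ := ((mm j : ℕ) : ℝ) with hm'
  have hm0 : 0 < m := by linarith
  obtain ⟨ε, hε, hε1, hε2⟩ : ∃ ε : ℝ, 0 < ε ∧ m * ε ≤ τ ∧ 6 * m * ε ≤ δ / 32 := by
    refine ⟨min (τ / m) (δ / 32 / (6 * m)), lt_min (by positivity) (by positivity), ?_, ?_⟩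
    · rw [mul_comm, ← le_div_iff₀ hm0]; exact min_le_left _ _
    · rw [mul_comm, ← le_div_iff₀ (by linarith)]; exact min_le_right _ _
  obtain ⟨σ, ξ, o, H, hR⟩ := build (Γ := Γ) (S := S) (j := j)
    (O := ℕ × (ℕ → ℝ) × W × ZZ Γ)
    (fun σ o ξ => N0 ≤ o.1 ∧ σ ≤ o.1 ∧ Γ.Blk o.1 ξ o.2.1 ∧ Γ.RV C o.1 o.2.1 ∧
      (∀ n, |ev (i o.2.2.1) n - o.2.1 n| ≤ ε) ∧ t.Q o.2.2.2 = T o.2.2.1 ∧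
      |Γ.bb ξ o.2.1| ≤ 2 * ε ∧ δ / 16 ≤ Γ.bb ξ (ev o.2.2.2) ∧
      (∀ n ∈ Γ.A S, n < max N0 σ → |ev o.2.2.2 n| ≤ ε) ∧
      ∀ n, |ev o.2.2.2 n - Γ.E ξ (ev o.2.2.2) n| ≤ ε) (by
    intro σ hσ
    obtain ⟨N1, hN1⟩ := weak_null_many (i := i) t T C hε (max N0 σ)
    obtain ⟨N2, hN2⟩ := exists_nat_gt (1 / ε)
    set N := max N1 (max N2 (max N0 σ)) with hN
    obtain ⟨q, x, w, hA, hw⟩ := hbad N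
    obtain ⟨y, hy⟩ := t.surj (T w)
    have hnear : ∀ n, |ev (i w) n - x n| ≤ ε := fun n => by
      refine (hA.near n).trans ?_
      rw [div_le_iff₀ (by positivity)]
      have : (N2 : ℝ) ≤ N := by exact_mod_cast (by omega : N2 ≤ N)
      rw [div_lt_iff₀ hε] at hN2
      nlinarith
    obtain ⟨a, ha, b, hb, r₁, r₂, hr, hf, hg⟩ := sep_pair (A := Γ.A S) (f := ev (i w)) (g := ev y)
      (δ := δ / 2) (ε := ε) (K := ‖i w‖) (by linarith) hε (fun n _ => ev_le _ n) (by
        intro c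
        by_contra! hc
        have := t.upper (y - c • i w) (δ / 2) (by linarith) (fun n hn => by
          rw [ev_sub, ev_smul]; exact hc n hn)
        rw [map_sub, map_smul, hy] at this
        linarith [hw c])
    obtain ⟨N3, hN3⟩ := ev_tail y hε
    obtain ⟨ξ, hξ, hξt, hξw, hξs, -, -, hbb⟩ := Γ.rich S j σ a b r₁ r₂ hr ha hb
      (fun h => absurd h hj) hσ (max q N3)
    refine ⟨(N, x, w, y), ξ, hξt, hξw, hξs, by omega, by omega,
      hA.blk.mono le_rfl (le_trans (le_max_left _ _) hξ), hA.rv, hnear, hy, ?_, ?_, ?_, ?_⟩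
    · simp only
      rw [hbb]
      have hr' : |(r₁ : ℝ)| + |(r₂ : ℝ)| ≤ 1 := by exact_mod_cast hr
      have e : (r₁ : ℝ) * x a + r₂ * x b = (r₁ * ev (i w) a + r₂ * ev (i w) b) -
        (r₁ * (ev (i w) a - x a) + r₂ * (ev (i w) b - x b)) := by ring
      have h1 := abs_sub (r₁ * ev (i w) a + r₂ * ev (i w) b)
        (r₁ * (ev (i w) a - x a) + r₂ * (ev (i w) b - x b))
      have h2 := abs_add_le (r₁ * (ev (i w) a - x a)) (r₂ * (ev (i w) b - x b))
      rw [abs_mul, abs_mul] at h2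
      have h3 := mul_le_mul_of_nonneg_left (hnear a) (abs_nonneg (r₁ : ℝ))
      have h4 := mul_le_mul_of_nonneg_left (hnear b) (abs_nonneg (r₂ : ℝ))
      rw [e]
      nlinarith
    · simp only
      rw [hbb]
      linarith
    · exact fun n hnA hn => hN1 q x w y (hA.mono (by omega)) hy n hn hnA
    · exact fun n => hN3 ξ (le_trans (le_max_right _ _) hξ) n)
  have hC : 0 ≤ C := by
    obtain ⟨q, x, w, hA, -⟩ := hbad 0
    exact (abs_nonneg _).trans (hA.rv.1 0)
  set J := Finset.range (nn j) with hJ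
  have hJm : ∀ a ∈ J, a < nn j := fun a ha => Finset.mem_range.mp ha
  have hord : ∀ a ∈ J, ∀ b ∈ J, a < b → ξ a ≤ (o b).1 := fun a ha b hb hab =>
    (H.le hab (hJm b hb)).le.trans (hR b (hJm b hb)).2.1
  have F : Γ.Fam J (fun a => (o a).2.1) (fun a => (o a).1) ξ C :=
    ⟨hC, fun a ha => (hR a (hJm a ha)).2.2.1, hord, fun a ha => (hR a (hJm a ha)).2.2.2.1.1⟩
  have ep := F.ep (N := fun a => (o a).1) (j := j) (fun a ha => (hR a (hJm a ha)).2.2.2.1) hord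
    (by simp [hJ])
  have hlast : nn j - 1 < nn j := by have := nn_pos j; omega
  set η := ξ (nn j - 1) with hη
  have hanc : ∀ a ∈ J, Γ.Anc η (ξ a) := fun a ha =>
    H.anc (by have := hJm a ha; omega) hlast
  have hc : (m / nn j) * ((nn j : ℝ) * (1 / m)) = 1 := by field_simp
  have hmn : 0 < m / nn j := by positivity
  have cardJ : (J.card : ℝ) = nn j := by simp [hJ]
  have sumb : ∀ (f : ℕ → ℝ) (B : ℝ), (∀ a ∈ J, |f a| ≤ B) →
      |m / nn j * ∑ a ∈ J, f a| ≤ m * B := by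
    intro f B hf
    rw [abs_mul, abs_of_pos hmn]
    have h1 : |∑ a ∈ J, f a| ≤ nn j * B := by
      refine (Finset.abs_sum_le_sum_abs _ _).trans ?_
      rw [← cardJ, ← nsmul_eq_mul]
      exact Finset.sum_le_card_nsmul _ _ _ hf
    calc m / nn j * |∑ a ∈ J, f a| ≤ m / nn j * (nn j * B) := by gcongr
      _ = m * B := by field_simp
  refine ⟨η + 1, (m / nn j) • ∑ a ∈ J, (o a).2.1, (m / nn j) • ∑ a ∈ J, (o a).2.2.1,
    (m / nn j) • ∑ a ∈ J, (o a).2.2.2, η, ?_, ep, H.mem _ hlast, H.hw _ hlast, ?_, ?_, ?_, ?_, ?_⟩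
  · refine (Blk.sum fun a ha => ?_).smul _
    obtain ⟨h1, h2, h3, -⟩ := hR a (hJm a ha)
    refine h3.mono h1 ?_
    have := (hanc a ha).le
    omega
  · rw [Pi.smul_apply, Finset.sum_apply, smul_eq_mul]
    refine (sumb _ (1 / m * (2 * ε)) fun a ha => ?_).trans ?_
    · obtain ⟨h1, h2, h3, -, -, -, h4, -⟩ := hR a (hJm a ha)
      have B := h3.mono h2 le_rfl
      rw [(hanc a ha).val B le_rfl, B.val_node (H.hs a (hJm a ha)), H.hw a (hJm a ha), abs_mul,
        abs_of_pos (by positivity)]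
      gcongr
    · rw [← mul_assoc, mul_one_div_cancel hm0.ne', one_mul]
      nlinarith
  · rw [ev_smul, ev_sum, Pi.smul_apply, Finset.sum_apply, smul_eq_mul]
    have h1 : (nn j : ℝ) * (1 / m * (δ / 16 - 3 * ε) - 3 * ε) ≤ ∑ a ∈ J, ev (o a).2.2.2 η := by
      rw [← cardJ, ← nsmul_eq_mul]
      refine Finset.card_nsmul_le_sum _ _ _ fun a ha => ?_
      obtain ⟨-, -, -, -, -, -, -, h4, h5, h6⟩ := hR a (hJm a ha)
      exact H.y_lower (hJm a ha) (hanc a ha) (H.mem _ hlast) hε.le h4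
        (fun n hA hn => h5 n hA (lt_max_of_lt_right hn)) h6
    have h2 := mul_le_mul_of_nonneg_left h1 hmn.le
    have h3 : m / nn j * ((nn j : ℝ) * (1 / m * (δ / 16 - 3 * ε) - 3 * ε)) =
      δ / 16 - 3 * ε - 3 * m * ε := by field_simp
    rw [h3] at h2
    nlinarith
  · intro n
    have e : ev (i ((m / nn j) • ∑ a ∈ J, (o a).2.2.1)) n - ((m / nn j) • ∑ a ∈ J, (o a).2.1) n =
        m / nn j * ∑ a ∈ J, (ev (i (o a).2.2.1) n - (o a).2.1 n) := by
      rw [map_smul, map_sum, ev_smul, ev_sum, Finset.sum_sub_distrib]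
      simp only [Pi.smul_apply, Finset.sum_apply, smul_eq_mul]
      ring
    rw [e]
    exact (sumb _ ε fun a ha => (hR a (hJm a ha)).2.2.2.2.1 n).trans hε1
  · rw [map_smul, map_sum, map_smul, map_sum]
    congr 1
    exact Finset.sum_congr rfl fun a ha => (hR a (hJm a ha)).2.2.2.2.2.1
  · intro n hnA hn
    rw [ev_smul, ev_sum, Pi.smul_apply, Finset.sum_apply, smul_eq_mul]
    exact (sumb _ ε fun a ha => (hR a (hJm a ha)).2.2.2.2.2.2.2.2.1 n hnA
      (lt_max_of_lt_left hn)).trans hε1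

theorem KP (t : Γ.Tgt S V) (T : W →L[ℝ] V) (C : ℝ) {δ : ℝ} (hδ : 0 < δ) :
    ∃ N, ∀ q x w, Adm i C N q x w → ∃ c : ℝ, ‖T w - c • t.Q (i w)‖ ≤ δ := by
  by_contra! hbad
  have hC : 0 ≤ C := by
    obtain ⟨q, x, w, hA, -⟩ := hbad 0
    exact (abs_nonneg _).trans (hA.rv.1 0)
  obtain ⟨k, hk, hkm⟩ : ∃ k, Odd k ∧ 128 * (‖T‖ * (18 * C + 1)) / δ < mm k := by
    obtain ⟨a, ha⟩ := exists_nat_gt (128 * (‖T‖ * (18 * C + 1)) / δ)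
    refine ⟨2 * a + 1, by simp, ha.trans_le ?_⟩
    exact_mod_cast (by omega : a ≤ 2 * a + 1).trans ((le_nu _).trans (nu_le_mm _))
  have hm := mmR_ge k
  have hn := nnR_pos k
  set m : ℝ := ((mm k : ℕ) : ℝ) with hm'
  have hm0 : 0 < m := by linarith
  rcases hC.eq_or_lt with hC0 | hC0
  · -- C = 0
    obtain ⟨N0, hN0⟩ := exists_nat_gt (‖T‖ / δ)
    obtain ⟨q, x, w, hA, hw⟩ := hbad N0
    have h0 := hw 0
    rw [zero_smul, sub_zero] at h0
    have hle : ‖w‖ ≤ 1 / (N0 + 1) := by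
      rw [← i.norm_map]
      refine norm_le (by positivity) fun n => ?_
      have h1 := hA.near n
      have h2 := hA.rv.1 n
      rw [← hC0] at h2
      rw [abs_nonpos_iff.mp h2, sub_zero] at h1
      exact h1
    have h1 : ‖T w‖ ≤ ‖T‖ * (1 / (N0 + 1)) := (T.le_opNorm w).trans (by gcongr)
    rw [div_lt_iff₀ hδ] at hN0
    have h2 : ‖T‖ * (1 / (N0 + 1)) ≤ δ := by
      rw [mul_one_div, div_le_iff₀ (by positivity)]; nlinarith
    linarith
  obtain ⟨τ, hτ, hτ1, hτ2, hτ3⟩ : ∃ τ : ℝ, 0 < τ ∧ nn k * τ ≤ C ∧ τ ≤ 1 / m ^ 2 ∧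
      6 * m * τ ≤ δ / 64 := by
    refine ⟨min (C / nn k) (min (1 / m ^ 2) (δ / 64 / (6 * m))),
      lt_min (by positivity) (lt_min (by positivity) (by positivity)), ?_, ?_, ?_⟩
    · rw [mul_comm, ← le_div_iff₀ hn]; exact min_le_left _ _
    · exact (min_le_right _ _).trans (min_le_left _ _)
    · rw [mul_comm, ← le_div_iff₀ (by linarith)]
      exact (min_le_right _ _).trans (min_le_right _ _)
  obtain ⟨σ, ξ, o, H, hR⟩ := build (Γ := Γ) (S := S) (j := k)
    (O := ℕ × (ℕ → ℝ) × W × ZZ Γ)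
    (fun σ o ξ => Γ.Blk σ ξ o.2.1 ∧ Γ.EP C (code k σ) o.2.1 ∧ |o.2.1 o.1| ≤ τ ∧
      (∀ x, Γ.bb ξ x = x o.1) ∧ δ / 32 ≤ ev o.2.2.2 o.1 ∧
      (∀ n, |ev (i o.2.2.1) n - o.2.1 n| ≤ τ) ∧ t.Q o.2.2.2 = T o.2.2.1 ∧
      (∀ n ∈ Γ.A S, n < σ → |ev o.2.2.2 n| ≤ τ) ∧
      ∀ n, |ev o.2.2.2 n - Γ.E ξ (ev o.2.2.2) n| ≤ τ) (by
    intro σ hσ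
    obtain ⟨q, z, w, y, η, h1, h2, h3, h4, h5, h6, h7, h8, h9⟩ :=
      level1 t T hδ hbad (code_even k σ) σ hτ
    obtain ⟨N3, hN3⟩ := ev_tail y hτ
    obtain ⟨ξ, hξ, hξt, hξw, hξs, -, -, hbb⟩ := Γ.rich S k σ η η 1 0 (by simp) h3 h3
      (fun _ => ⟨rfl, rfl, h4⟩) hσ (max q N3)
    exact ⟨(η, z, w, y), ξ, hξt, hξw, hξs, h1.mono le_rfl (le_trans (le_max_left _ _) hξ), h2, h5,
      fun x => by rw [hbb]; simp, h6, h7, h8, h9, hN3 ξ (le_trans (le_max_right _ _) hξ)⟩)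
  have Ch : Γ.Chain k σ ξ (fun a => (o a).1) (fun a => (o a).2.1) C τ :=
    ⟨hk, hC, hτ.le, H.suc, H.hw, H.hs, fun a ha => (hR a ha).2.2.2.1, fun a ha => (hR a ha).1,
      fun a ha => (hR a ha).2.1, fun a ha => (hR a ha).2.2.1⟩
  have up := Ch.upper hτ1
  set J := Finset.range (nn k) with hJ
  have hJm : ∀ a ∈ J, a < nn k := fun a ha => Finset.mem_range.mp ha
  have cardJ : (J.card : ℝ) = nn k := by simp [hJ]
  have hlast : nn k - 1 < nn k := by have := nn_pos k; omega
  set γ := ξ (nn k - 1) with hγ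
  have hanc : ∀ a ∈ J, Γ.Anc γ (ξ a) := fun a ha =>
    H.anc (by have := hJm a ha; omega) hlast
  set w := ∑ a ∈ J, (o a).2.2.1 with hw
  set y := ∑ a ∈ J, (o a).2.2.2 with hy
  have hQ : t.Q y = T w := by
    rw [hy, hw, map_sum, map_sum]
    exact Finset.sum_congr rfl fun a ha => (hR a (hJm a ha)).2.2.2.2.2.2.1
  have low : (nn k : ℝ) * (δ / (64 * m)) ≤ ev y γ := by
    rw [hy, ev_sum, Finset.sum_apply, ← cardJ, ← nsmul_eq_mul]
    refine Finset.card_nsmul_le_sum _ _ _ fun a ha => ?_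
    obtain ⟨-, -, -, h3, h4, -, -, h5, h6⟩ := hR a (hJm a ha)
    refine le_trans ?_ (H.y_lower (hJm a ha) (hanc a ha) (H.mem _ hlast) hτ.le
      (β := δ / 32) (by rw [h3]; exact h4) h5 h6)
    have e : 1 / m * (δ / 32 - 3 * τ) - 3 * τ = (δ / 32 - 3 * τ - 3 * m * τ) / m := by
      field_simp
    rw [e, ← div_div, div_le_div_iff_of_pos_right hm0]
    nlinarith
  have hwn : ‖w‖ ≤ nn k * ((18 * C + 1) / m ^ 2) := by
    rw [← i.norm_map]
    refine norm_le (by positivity) fun n => ?_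
    have e : ev (i w) n = ∑ a ∈ J, (o a).2.1 n +
        ∑ a ∈ J, (ev (i (o a).2.2.1) n - (o a).2.1 n) := by
      rw [hw, map_sum, ev_sum, Finset.sum_sub_distrib, Finset.sum_apply]
      ring
    have h2 : |∑ a ∈ J, (ev (i (o a).2.2.1) n - (o a).2.1 n)| ≤ nn k * τ := by
      refine (Finset.abs_sum_le_sum_abs _ _).trans ?_
      rw [← cardJ, ← nsmul_eq_mul]
      exact Finset.sum_le_card_nsmul _ _ _ fun a ha => (hR a (hJm a ha)).2.2.2.2.2.1 n
    have h3 : nn k * τ ≤ nn k * (1 / m ^ 2) := by gcongr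
    rw [e]
    refine (abs_add_le _ _).trans ((add_le_add (up n) (h2.trans h3)).trans (le_of_eq ?_))
    ring
  have h1 : ev y γ ≤ ‖T‖ * (nn k * ((18 * C + 1) / m ^ 2)) := by
    refine (le_abs_self _).trans ((t.lower y γ (H.mem _ hlast)).trans ?_)
    rw [hQ]
    exact (T.le_opNorm w).trans (by gcongr)
  have h2 := low.trans h1
  have h3 : δ / (64 * m) ≤ ‖T‖ * ((18 * C + 1) / m ^ 2) := by
    rw [show ‖T‖ * (nn k * ((18 * C + 1) / m ^ 2)) = nn k * (‖T‖ * ((18 * C + 1) / m ^ 2)) by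
      ring] at h2
    exact le_of_mul_le_mul_left h2 hn
  rw [← mul_div_assoc, div_le_div_iff₀ (by positivity) (by positivity)] at h3
  rw [div_lt_iff₀ hδ] at hkm
  have h4 : δ * m ≤ ‖T‖ * (18 * C + 1) * 64 := by
    have : (δ * m) * m ≤ (‖T‖ * (18 * C + 1) * 64) * m := by nlinarith
    exact le_of_mul_le_mul_right this hm0
  have : 0 ≤ ‖T‖ * (18 * C + 1) := by positivity
  nlinarith

end Sys
end AH

namespace AH
open Filter Topology
namespace Sys
variable {Γ : Sys}

theorem E_weight {q : ℕ} {u : ℕ → ℝ} {B : ℝ} (hB : 0 ≤ B) (hu : ∀ n < q, |u n| ≤ B) (γ : ℕ)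
    (hw : ∀ n < q, u n ≠ 0 → Γ.w n ≠ Γ.w γ) : |Γ.E q u γ| ≤ 4 * B / mm (Γ.w γ) := by
  induction γ using Nat.strong_induction_on with
  | _ γ ih =>
  have hm := mmR_pos (Γ.w γ)
  have h0 : ∀ n < q, Γ.w n = Γ.w γ → u n = 0 := fun n hn h => by
    by_contra h'; exact hw n hn h' h
  have hp : 0 ≤ 4 * B / mm (Γ.w γ) := by positivity
  by_cases hq : γ < q
  · rw [E_lt _ hq, h0 γ hq rfl, abs_zero]; exact hp
  · rw [E_ge _ (by omega)]
    have hs' := Γ.s_le γ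
    split_ifs with h1
    · have hpv : pv (Γ.E q u) (Γ.s γ) = 0 := by
        rcases hs : Γ.s γ with _ | ξ
        · simp
        · rw [pv_succ, E_lt _ (by omega)]
          exact h0 ξ (by omega) (Γ.w_par γ ξ hs)
      have h2 := bb_abs_le (Γ := Γ) (n := γ) (E_bound' (Γ := Γ) (q := q) hB hu)
      have h3 := bb_abs_le (Γ := Γ) (n := γ) (E_bound' (Γ := Γ) (q := Γ.s γ) hB
        (fun n hn => hu n (by omega)))
      rw [hpv, zero_add, abs_mul, abs_of_pos (by positivity), one_div, ← div_eq_inv_mul]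
      gcongr
      exact (abs_sub _ _).trans (by linarith)
    · rw [add_zero]
      rcases hs : Γ.s γ with _ | ξ
      · omega
      · rw [pv_succ]
        have e := Γ.w_par γ ξ hs
        rw [← e]
        exact ih ξ (by omega) (fun n hn h => by rw [e]; exact hw n hn h)

theorem rv_hi {q N : ℕ} {u : ℕ → ℝ} {B : ℝ} (hB : 0 ≤ B) (hu : ∀ n < q, |u n| ≤ B)
    (hw : ∀ n < q, u n ≠ 0 → N ≤ Γ.w n) : Γ.RV (4 * B) N (Γ.E q u) :=
  ⟨fun n => (E_bound' hB hu n).trans (by linarith), fun γ hγ => E_weight hB hu γ fun n hn h => by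
    have := hw n hn h; omega⟩

theorem rv_lo {q M N : ℕ} {u : ℕ → ℝ} {B : ℝ} (hB : 0 ≤ B) (hu : ∀ n < q, |u n| ≤ B)
    (hw : ∀ n < q, u n ≠ 0 → Γ.w n < M) : Γ.RV (4 * mm M * B) N (Γ.E q u) := by
  have hm := mmR_ge M
  have h1 : ∀ n, |Γ.E q u n| ≤ 4 * B := fun n => (E_bound' hB hu n).trans (by linarith)
  refine ⟨fun n => (h1 n).trans ?_, fun γ _ => ?_⟩
  · nlinarith
  · have hg := mmR_pos (Γ.w γ)
    by_cases h : Γ.w γ < M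
    · refine (h1 γ).trans ?_
      rw [le_div_iff₀ hg]
      have : (mm (Γ.w γ) : ℝ) ≤ mm M := mmR_mono h.le
      nlinarith
    · refine (E_weight hB hu γ fun n hn h' => ?_).trans ?_
      · have := hw n hn h'; omega
      · gcongr ?_ / _
        nlinarith

section
variable {W : Type*} [NormedAddCommGroup W] [NormedSpace ℝ W] {i : W →ₗᵢ[ℝ] ZZ Γ}
  {S A' : Set ℕ} {V : Type*} [SeminormedAddCommGroup V] [NormedSpace ℝ V]

theorem Tgt.Q_le (t : Γ.Tgt S V) (x : ZZ Γ) : ‖t.Q x‖ ≤ 2 * ‖x‖ :=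
  t.upper x _ (norm_nonneg _) fun n _ => ev_le x n

/-- exact lifts -/
theorem lift (hA : Γ.Inv A') (hr : ∀ z, z ∈ YY Γ A' → ∃ x, i x = z) (q : ℕ) {u : ℕ → ℝ}
    (hu : ∀ n ∈ A', u n = 0) : ∃ w, ev (i w) = Γ.E q u := by
  obtain ⟨w, hw⟩ := hr (ofE Γ q u) (hA q u fun n _ hn => hu n hn)
  exact ⟨w, by rw [hw, ev_ofE]⟩

theorem adm_ex {C : ℝ} {N q : ℕ} {x : ℕ → ℝ} {w : W} (hb : Γ.Blk N q x) (hR : Γ.RV C N x)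
    (h : ev (i w) = x) : Adm i C N q x w :=
  ⟨hb, hR, fun n => by rw [h, sub_self, abs_zero]; positivity⟩

/-- merging with a far away vector -/
theorem merge (t : Γ.Tgt S V) (T : W →L[ℝ] V) {C δ : ℝ} {N q n : ℕ} {x d : ℕ → ℝ}
    {w v : W} (hC : 0 ≤ C) (hδ : 0 ≤ δ) (hb : Γ.Blk N q x) (hR : Γ.RV C N x) (hw : ev (i w) = x)
    (hv : ev (i v) = d) (hn : n ∈ Γ.A S) (hd : ∀ k < q, d k = 0) (hd1 : d n = 1) {c c' c'' : ℝ}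
    (h1 : ‖T w - c • t.Q (i w)‖ ≤ δ) (h2 : ‖T v - c' • t.Q (i v)‖ ≤ δ)
    (h3 : ‖T (w + v) - c'' • t.Q (i (w + v))‖ ≤ δ) :
    ‖T w - c' • t.Q (i w)‖ ≤ (13 + 18 * C) * δ := by
  set z := (c - c'') • i w + (c' - c'') • i v with hz
  have e : t.Q z = (T (w + v) - c'' • t.Q (i (w + v))) - (T w - c • t.Q (i w))
      - (T v - c' • t.Q (i v)) := by
    rw [hz, map_add, map_smul, map_smul, map_add, map_add, map_add]; module
  have hQz : ‖t.Q z‖ ≤ 3 * δ := by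
    rw [e]
    have a1 := norm_sub_le ((T (w + v) - c'' • t.Q (i (w + v))) - (T w - c • t.Q (i w)))
      (T v - c' • t.Q (i v))
    have a2 := norm_sub_le (T (w + v) - c'' • t.Q (i (w + v))) (T w - c • t.Q (i w))
    linarith
  have hev : ∀ k, ev z k = (c - c'') * x k + (c' - c'') * d k := fun k => by
    rw [hz, ev_add, ev_smul, ev_smul, hw, hv]; rfl
  have hx1 : ∀ k < q, k ∈ Γ.A S → |((c - c'') • x) k| ≤ 3 * δ := fun k hk hkA => by
    have := (t.lower z k hkA).trans hQz
    rwa [hev, hd k hk, mul_zero, add_zero] at this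
  have hx2 : ∀ k ∈ Γ.A S, |((c - c'') • x) k| ≤ 6 * δ := fun k hk => by
    have := E_bound (by linarith) hx1 k hk
    rw [(hb.smul _).2] at this
    linarith
  have hx3 : ‖(c - c'') • t.Q (i w)‖ ≤ 12 * δ := by
    rw [← map_smul]
    refine (t.upper _ (6 * δ) (by linarith) fun k hk => ?_).trans (by linarith)
    rw [ev_smul, hw]; exact hx2 k hk
  have hc : |c' - c''| ≤ 9 * δ := by
    have a := (t.lower z n hn).trans hQz
    have b := hx2 n hn
    rw [hev, hd1, mul_one] at a
    rw [Pi.smul_apply, smul_eq_mul] at b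
    rw [abs_le] at *
    constructor <;> linarith
  have hQw : ‖t.Q (i w)‖ ≤ 2 * C := (t.Q_le _).trans (by
    have : ‖i w‖ ≤ C := norm_le hC fun k => by rw [hw]; exact hR.1 k
    linarith)
  have e2 : T w - c' • t.Q (i w) = (T w - c • t.Q (i w)) + (c - c'') • t.Q (i w)
      - (c' - c'') • t.Q (i w) := by
    simp only [sub_smul]; abel
  rw [e2]
  have b1 := norm_sub_le ((T w - c • t.Q (i w)) + (c - c'') • t.Q (i w)) ((c' - c'') • t.Q (i w))
  have b2 := norm_add_le (T w - c • t.Q (i w)) ((c - c'') • t.Q (i w))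
  have b3 : ‖(c' - c'') • t.Q (i w)‖ ≤ (9 * δ) * (2 * C) := by
    rw [norm_smul, Real.norm_eq_abs]
    exact mul_le_mul hc hQw (norm_nonneg _) (by linarith)
  nlinarith

/-- the test vectors -/
theorem test_vec (hA : Γ.Inv A') (hr : ∀ z, z ∈ YY Γ A' → ∃ x, i x = z) {n N : ℕ} (hn : n ∉ A')
    (hN : N ≤ n) (hw : N ≤ Γ.w n) : ∃ (d : ℕ → ℝ) (v : W), ev (i v) = d ∧ d n = 1 ∧
      Γ.Blk n (n + 1) d ∧ Γ.RV 4 N d := by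
  have hz : ∀ k, k ≠ n → (Pi.single n 1 : ℕ → ℝ) k = 0 := fun k hk => by simp [hk]
  obtain ⟨v, hv⟩ := lift hA hr (n + 1) (u := (Pi.single n 1 : ℕ → ℝ)) fun k hk =>
    hz k fun h => hn (h ▸ hk)
  refine ⟨_, v, hv, ?_, Blk.of_E (fun k hk => hz k (by omega)) (by omega), ?_⟩
  · rw [E_lt _ (by omega)]; simp
  · have := rv_hi (Γ := Γ) (q := n + 1) (N := N) (u := (Pi.single n 1 : ℕ → ℝ)) zero_le_one
      (fun k _ => by by_cases h : k = n <;> simp [h])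
      (fun k _ h => by
        have : k = n := by by_contra h'; exact h (hz k h')
        rw [this]; exact hw)
    simpa using this

theorem exists_lam (t : Γ.Tgt S V) (T : W →L[ℝ] V) (hA : Γ.Inv A')
    (hr : ∀ z, z ∈ YY Γ A' → ∃ x, i x = z)
    (hl : ∀ N, ∃ n ≥ N, n ∈ Γ.A S ∧ n ∉ A' ∧ N ≤ Γ.w n) :
    ∃ lam : ℝ, ∀ δ > 0, ∀ N, ∃ n ≥ N, n ∈ Γ.A S ∧ ∃ (d : ℕ → ℝ) (v : W), ev (i v) = d ∧ d n = 1 ∧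
      Γ.Blk n (n + 1) d ∧ Γ.RV 4 N d ∧ ‖T v - lam • t.Q (i v)‖ ≤ δ := by
  have h1 : ∀ k : ℕ, ∃ n ≥ k, n ∈ Γ.A S ∧ ∃ (c : ℝ) (d : ℕ → ℝ) (v : W), ev (i v) = d ∧ d n = 1 ∧
      Γ.Blk n (n + 1) d ∧ Γ.RV 4 k d ∧ ‖T v - c • t.Q (i v)‖ ≤ 1 / (k + 1) := fun k => by
    obtain ⟨N, hN⟩ := KP (i := i) t T 4 (δ := 1 / ((k : ℝ) + 1)) (by positivity)
    obtain ⟨n, hn, hnA, hnA', hnw⟩ := hl (max k N)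
    obtain ⟨d, v, h1, h2, h3, h4⟩ := test_vec hA hr hnA' hn hnw
    obtain ⟨c, hc⟩ := hN _ _ v (adm_ex (h3.mono (by omega) le_rfl)
      ⟨h4.1, fun n hn => h4.2 n (by omega)⟩ h1)
    exact ⟨n, by omega, hnA, c, d, v, h1, h2, h3, ⟨h4.1, fun n hn => h4.2 n (by omega)⟩, hc⟩
  choose n hn hnA c d v h1 h2 h3 h4 h5 using h1
  have hv : ∀ k, ‖v k‖ ≤ 4 := fun k => by
    rw [← i.norm_map]
    exact norm_le (by norm_num) fun m => by rw [h1]; exact (h4 k).1 m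
  have hQ1 : ∀ k, 1 ≤ ‖t.Q (i (v k))‖ := fun k => by
    have := t.lower (i (v k)) _ (hnA k)
    rwa [h1, h2, abs_one] at this
  have hQ2 : ∀ k, ‖t.Q (i (v k))‖ ≤ 8 := fun k => (t.Q_le _).trans (by
    rw [i.norm_map]; linarith [hv k])
  have hc : ∀ k, c k ∈ Metric.closedBall (0 : ℝ) (‖T‖ * 4 + 1) := fun k => by
    rw [mem_closedBall_zero_iff]
    have a : ‖c k • t.Q (i (v k))‖ ≤ ‖T‖ * 4 + 1 := by
      have e : c k • t.Q (i (v k)) = T (v k) - (T (v k) - c k • t.Q (i (v k))) := by abel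
      rw [e]
      have b1 := norm_sub_le (T (v k)) (T (v k) - c k • t.Q (i (v k)))
      have b2 : ‖T (v k)‖ ≤ ‖T‖ * 4 := (T.le_opNorm _).trans (by gcongr; exact hv k)
      have b3 : (1 : ℝ) / (k + 1) ≤ 1 := by
        rw [div_le_one (by positivity)]; linarith [(Nat.cast_nonneg k : (0 : ℝ) ≤ k)]
      linarith [h5 k]
    rw [norm_smul] at a
    have := hQ1 k
    nlinarith [norm_nonneg (c k)]
  obtain ⟨lam, -, φ, hφ, hlim⟩ := tendsto_subseq_of_bounded Metric.isBounded_closedBall hc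
  refine ⟨lam, fun δ hδ N => ?_⟩
  have ev1 : ∀ᶠ k in atTop, |c (φ k) - lam| ≤ δ / 16 := by
    have := (Metric.tendsto_nhds.mp hlim) (δ / 16) (by linarith)
    filter_upwards [this] with k hk
    exact (by simpa [Real.dist_eq] using hk.le)
  have ev2 : ∀ᶠ k : ℕ in atTop, (1 : ℝ) / (k + 1) ≤ δ / 2 := by
    have := (Metric.tendsto_nhds.mp (tendsto_one_div_add_atTop_nhds_zero_nat (𝕜 := ℝ))) (δ / 2)
      (by linarith)
    filter_upwards [this] with k hk
    rw [Real.dist_eq, sub_zero] at hk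
    exact (le_abs_self _).trans hk.le
  obtain ⟨k, k1, k2, k3⟩ := (ev1.and (ev2.and (eventually_ge_atTop N))).exists
  have hk := hφ.id_le k
  simp only [id] at hk
  refine ⟨n (φ k), by have := hn (φ k); omega, hnA _, d (φ k), v (φ k), h1 _, h2 _, h3 _,
    ⟨(h4 _).1, fun m hm => (h4 _).2 m (by omega)⟩, ?_⟩
  have e : T (v (φ k)) - lam • t.Q (i (v (φ k))) = (T (v (φ k)) - c (φ k) • t.Q (i (v (φ k)))) +
    (c (φ k) - lam) • t.Q (i (v (φ k))) := by simp only [sub_smul]; abel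
  rw [e]
  have b1 := norm_add_le (T (v (φ k)) - c (φ k) • t.Q (i (v (φ k))))
    ((c (φ k) - lam) • t.Q (i (v (φ k))))
  have b2 : ‖(c (φ k) - lam) • t.Q (i (v (φ k)))‖ ≤ δ / 16 * 8 := by
    rw [norm_smul, Real.norm_eq_abs]
    exact mul_le_mul k1 (hQ2 _) (norm_nonneg _) (by linarith)
  have b3 : (1 : ℝ) / ((φ k : ℕ) + 1) ≤ 1 / (k + 1) := by gcongr
  linarith [h5 (φ k)]

theorem lam_rv (t : Γ.Tgt S V) (T : W →L[ℝ] V) {lam : ℝ}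
    (hlam : ∀ δ > 0, ∀ N, ∃ n ≥ N, n ∈ Γ.A S ∧ ∃ (d : ℕ → ℝ) (v : W), ev (i v) = d ∧ d n = 1 ∧
      Γ.Blk n (n + 1) d ∧ Γ.RV 4 N d ∧ ‖T v - lam • t.Q (i v)‖ ≤ δ) {C : ℝ} (hC : 0 ≤ C)
    {δ : ℝ} (hδ : 0 < δ) :
    ∃ N, ∀ q x w, N ≤ q → Γ.Blk N q x → Γ.RV C N x → ev (i w) = x →
      ‖T w - lam • t.Q (i w)‖ ≤ δ := by
  set η := δ / (13 + 18 * C) with hη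
  have hηp : 0 < η := by positivity
  obtain ⟨N1, hN1⟩ := KP (i := i) t T C hηp
  obtain ⟨N2, hN2⟩ := KP (i := i) t T (C + 4) hηp
  refine ⟨max N1 N2, fun q x w hq hb hR hw => ?_⟩
  obtain ⟨n, hn, hnA, d, v, h1, h2, h3, h4, h5⟩ := hlam η hηp q
  obtain ⟨c, hc⟩ := hN1 q x w ((adm_ex hb hR hw).mono (le_max_left _ _))
  have hRR : Γ.RV (C + 4) (max N1 N2) (x + d) := by
    refine ⟨fun k => (abs_add_le _ _).trans (add_le_add (hR.1 k) (h4.1 k)), fun k hk => ?_⟩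
    rw [add_div]
    exact (abs_add_le _ _).trans (add_le_add (hR.2 k hk) (h4.2 k (by omega)))
  have hBB : Γ.Blk (max N1 N2) (n + 1) (x + d) :=
    (hb.mono le_rfl (by omega)).add (h3.mono (by omega) le_rfl)
  obtain ⟨c'', hc''⟩ := hN2 (n + 1) (x + d) (w + v) ((adm_ex hBB hRR (by
    rw [map_add, ev_add, hw, h1])).mono (le_max_right _ _))
  have := merge t T hC hηp.le hb hR hw h1 hnA (fun k hk => h3.1 k (by omega)) h2 hc h5 hc''
  refine this.trans (le_of_eq ?_)
  rw [hη]; field_simp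

theorem tail_small (t : Γ.Tgt S V) (T : W →L[ℝ] V) (hA : Γ.Inv A')
    (hr : ∀ z, z ∈ YY Γ A' → ∃ x, i x = z) (hr' : ∀ x, i x ∈ YY Γ A') {lam : ℝ}
    (hlam : ∀ C ≥ (0 : ℝ), ∀ δ > 0, ∃ N, ∀ q x w, N ≤ q → Γ.Blk N q x → Γ.RV C N x → ev (i w) = x →
      ‖T w - lam • t.Q (i w)‖ ≤ δ) {δ : ℝ} (hδ : 0 < δ) :
    ∃ N, ∀ w, (∀ n < N, ev (i w) n = 0) → ‖w‖ ≤ 1 → ‖T w - lam • t.Q (i w)‖ ≤ δ := by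
  classical
  obtain ⟨M, hM⟩ := hlam 4 (by norm_num) (δ / 4) (by linarith)
  obtain ⟨N2, hN2⟩ := hlam (4 * mm M * 1) (by positivity) (δ / 4) (by linarith)
  set N := max M N2 with hN
  set R : W →L[ℝ] V := T - lam • (t.Q.comp i.toContinuousLinearMap) with hRd
  have hRa : ∀ w, R w = T w - lam • t.Q (i w) := fun w => rfl
  refine ⟨N, fun w hw hw1 => ?_⟩
  have hbl : ∀ q ≥ N, ∀ v, ev (i v) = Γ.E q (ev (i w)) → ‖R v‖ ≤ δ / 2 := by
    intro q hq v hv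
    have hb : ∀ n, |ev (i w) n| ≤ 1 := fun n => (ev_le _ _).trans (by rwa [i.norm_map])
    set u1 : ℕ → ℝ := fun n => if M ≤ Γ.w n then ev (i w) n else 0 with hu1
    set u2 : ℕ → ℝ := fun n => if M ≤ Γ.w n then 0 else ev (i w) n with hu2
    have hsum : ev (i w) = u1 + u2 := by
      funext n; simp only [hu1, hu2, Pi.add_apply]; split_ifs <;> simp
    have z1 : ∀ n, ev (i w) n = 0 → u1 n = 0 := fun n h => by
      simp only [hu1]; split_ifs <;> simp [h]
    have z2 : ∀ n, ev (i w) n = 0 → u2 n = 0 := fun n h => by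
      simp only [hu2]; split_ifs <;> simp [h]
    have b1 : ∀ n < q, |u1 n| ≤ 1 := fun n _ => by
      simp only [hu1]; split_ifs <;> simp [hb n]
    have b2 : ∀ n < q, |u2 n| ≤ 1 := fun n _ => by
      simp only [hu2]; split_ifs <;> simp [hb n]
    obtain ⟨v1, hv1⟩ := lift hA hr q (u := u1) fun n hn => z1 n (hr' w n hn)
    obtain ⟨v2, hv2⟩ := lift hA hr q (u := u2) fun n hn => z2 n (hr' w n hn)
    have hvv : v = v1 + v2 := by
      apply i.injective; apply ev_inj
      rw [map_add, ev_add, hv, hv1, hv2, hsum, E_add]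
    have r1 := hM q _ v1 (by omega) (Blk.of_E (fun n hn => z1 n (hw n (by omega))) (by omega))
      (by simpa using rv_hi (Γ := Γ) (N := M) zero_le_one b1 fun n _ h => by
            by_contra h'; exact h (by simp [hu1, h'])) hv1
    have r2 := hN2 q _ v2 (by omega) (Blk.of_E (fun n hn => z2 n (hw n (by omega))) (by omega))
      (rv_lo (Γ := Γ) (M := M) (N := N2) zero_le_one b2 fun n _ h => by
            by_contra h'; exact h (by simp [hu2, not_lt.mp h'])) hv2
    rw [← hRa] at r1 r2
    rw [hvv, map_add]
    exact (norm_add_le _ _).trans (by linarith)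
  obtain ⟨q0, hq0⟩ := P_tail (i w) (ε := δ / (2 * (‖R‖ + 1))) (by positivity)
  set q := max q0 N with hq
  obtain ⟨v, hv⟩ := lift hA hr q (u := ev (i w)) fun n hn => hr' w n hn
  have h1 := hbl q (le_max_right _ _) v hv
  have h2 : ‖w - v‖ ≤ δ / (2 * (‖R‖ + 1)) := by
    rw [← i.norm_map, map_sub]
    have : i v = P Γ q (i w) := ev_inj (by rw [hv, ev_P])
    rw [this]; exact hq0 q (le_max_left _ _)
  have h3 : ‖R (w - v)‖ ≤ δ / 2 := (R.le_opNorm _).trans (by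
    calc ‖R‖ * ‖w - v‖ ≤ (‖R‖ + 1) * (δ / (2 * (‖R‖ + 1))) := by gcongr; linarith
      _ = δ / 2 := by field_simp)
  rw [← hRa]
  have : R w = R v + R (w - v) := by rw [map_sub]; abel
  rw [this]
  exact (norm_add_le _ _).trans (by linarith)

end

section
variable {W : Type*} [NormedAddCommGroup W] [NormedSpace ℝ W] {i : W →ₗᵢ[ℝ] ZZ Γ}
  {S A' : Set ℕ} {V : Type*} [NormedAddCommGroup V] [NormedSpace ℝ V]

open Classical in
theorem proj_ex (hA : Γ.Inv A') (hr : ∀ z, z ∈ YY Γ A' → ∃ x, i x = z)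
    (hr' : ∀ x, i x ∈ YY Γ A') (q : ℕ) :
    ∃ R : W →L[ℝ] W, IsCompactOperator R ∧ ∀ w, i (R w) = P Γ q (i w) := by
  let zx : (Fin q → ℝ) → ℕ → ℝ := fun u n => if h : n < q then if n ∈ A' then 0 else u ⟨n, h⟩ else 0
  have hz : ∀ u, ∃ w, i w = ofE Γ q (zx u) := fun u => by
    obtain ⟨w, hw⟩ := lift hA hr q (u := zx u) fun n hn => by simp [zx, hn]
    exact ⟨w, ev_inj (by rw [hw, ev_ofE])⟩
  choose f hf using hz
  let J : (Fin q → ℝ) →ₗ[ℝ] W :=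
    { toFun := f
      map_add' := fun u v => by
        apply i.injective
        rw [map_add, hf, hf, hf, ← map_add]
        congr 1; funext n; simp only [zx, Pi.add_apply]; split_ifs <;> simp
      map_smul' := fun a u => by
        apply i.injective
        rw [map_smul, hf, hf, RingHom.id_apply, ← map_smul]
        congr 1; funext n; simp only [zx, Pi.smul_apply]; split_ifs <;> simp }
  let JL : (Fin q → ℝ) →L[ℝ] W := LinearMap.toContinuousLinearMap J
  let G : W →L[ℝ] (Fin q → ℝ) := ContinuousLinearMap.pi fun n =>
    (evc Γ n).comp i.toContinuousLinearMap
  refine ⟨JL.comp G, ?_, fun w => ?_⟩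
  · exact (isCompactOperator_of_locallyCompactSpace_rng JL).comp_clm G
  · change i (f (G w)) = _
    rw [hf]
    apply ev_inj
    rw [ev_ofE, ev_P]
    refine E_congr fun n hn => ?_
    simp only [zx, dif_pos hn]
    split_ifs with h
    · exact (hr' w n h).symm
    · rfl

theorem thmA [CompleteSpace V] (t : Γ.Tgt S V) (T : W →L[ℝ] V) (hA : Γ.Inv A')
    (hr : ∀ z, z ∈ YY Γ A' → ∃ x, i x = z) (hr' : ∀ x, i x ∈ YY Γ A')
    (hl : ∀ N, ∃ n ≥ N, n ∈ Γ.A S ∧ n ∉ A' ∧ N ≤ Γ.w n) :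
    ∃ lam : ℝ, IsCompactOperator (T - lam • (t.Q.comp i.toContinuousLinearMap)) := by
  obtain ⟨lam, hlam⟩ := exists_lam t T hA hr hl
  refine ⟨lam, ?_⟩
  set K : W →L[ℝ] V := T - lam • (t.Q.comp i.toContinuousLinearMap) with hK
  have hKa : ∀ w, K w = T w - lam • t.Q (i w) := fun w => rfl
  choose R hRc hR using proj_ex hA hr hr'
  have hlim : Tendsto (fun q => K.comp (R q)) atTop (𝓝 K) := by
    rw [Metric.tendsto_atTop]
    intro ε hε
    obtain ⟨N, hN⟩ := tail_small t T hA hr hr' (fun C hC δ hδ => lam_rv t T hlam hC hδ)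
      (δ := ε / 8) (by linarith)
    refine ⟨N, fun q hq => ?_⟩
    rw [dist_comm, dist_eq_norm]
    refine lt_of_le_of_lt (ContinuousLinearMap.opNorm_le_bound _ (M := ε / 2) (by linarith)
      fun w => ?_) (by linarith : ε / 2 < ε)
    by_cases hw0 : w = 0
    · simp [hw0]
    have hwp : 0 < ‖w‖ := norm_pos_iff.mpr hw0
    set v : W := (1 / (3 * ‖w‖)) • (w - R q w) with hv
    have hnv : ‖w - R q w‖ ≤ 3 * ‖w‖ := by
      rw [← i.norm_map, map_sub, hR]
      refine (norm_sub_le _ _).trans ?_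
      have := P_le (Γ := Γ) q (i w)
      rw [i.norm_map] at *
      linarith
    have h1 : ‖K v‖ ≤ ε / 8 := by
      rw [hKa]
      refine hN v (fun n hn => ?_) ?_
      · rw [hv, map_smul, map_sub, hR, ev_smul, ev_sub, ev_P]
        simp [E_lt _ (show n < q by omega)]
      · rw [hv, norm_smul, Real.norm_of_nonneg (by positivity), one_div, inv_mul_le_iff₀ (by positivity)]
        linarith
    have e : (K - K.comp (R q)) w = (3 * ‖w‖) • K v := by
      rw [hv, map_smul, smul_smul, mul_one_div_cancel (by positivity), one_smul, map_sub]; rfl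
    rw [e, norm_smul, Real.norm_of_nonneg (by positivity)]
    nlinarith
  exact isCompactOperator_of_tendsto hlim (Eventually.of_forall fun q => (hRc q).clm_comp K)

theorem not_compact (t : Γ.Tgt S V) (hA : Γ.Inv A')
    (hr : ∀ z, z ∈ YY Γ A' → ∃ x, i x = z)
    (hl : ∀ N, ∃ n ≥ N, n ∈ Γ.A S ∧ n ∉ A' ∧ N ≤ Γ.w n) :
    ¬ IsCompactOperator (t.Q.comp i.toContinuousLinearMap) := by
  intro hc
  have h1 : ∀ k : ℕ, ∃ n ≥ k, n ∈ Γ.A S ∧ ∃ v : W, ev (i v) n = 1 ∧ (∀ m < n, ev (i v) m = 0) ∧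
      ‖v‖ ≤ 4 := fun k => by
    obtain ⟨n, hn, hnA, hnA', hnw⟩ := hl k
    obtain ⟨d, v, h1, h2, h3, h4⟩ := test_vec hA hr hnA' hn hnw
    refine ⟨n, hn, hnA, v, by rw [h1, h2], fun m hm => by rw [h1]; exact h3.1 m hm, ?_⟩
    rw [← i.norm_map]
    exact norm_le (by norm_num) fun m => by rw [h1]; exact h4.1 m
  choose n hn hnA v hv1 hv0 hvb using h1
  obtain ⟨K, hK, hsub⟩ := hc.image_closedBall_subset_compact 4
  let φ : ℕ → ℕ := fun k => Nat.rec 0 (fun _ m => n m + 1) k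
  have hφs : ∀ k, φ (k + 1) = n (φ k) + 1 := fun k => rfl
  have hφ : StrictMono φ := strictMono_nat_of_lt_succ fun k => by
    rw [hφs]; have := hn (φ k); omega
  obtain ⟨a, -, ψ, hψ, hlim⟩ := hK.tendsto_subseq (x := fun k => t.Q (i (v (φ k)))) fun k =>
    hsub ⟨v (φ k), by simpa using hvb (φ k), rfl⟩
  obtain ⟨N, hN⟩ := Metric.cauchySeq_iff'.mp hlim.cauchySeq 1 one_pos
  have h2 := hN (N + 1) (by omega)
  have hlt : φ (ψ N) < φ (ψ (N + 1)) := hφ (hψ (by omega))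
  have hlt2 : n (φ (ψ N)) < n (φ (ψ (N + 1))) := by
    have : φ (ψ N + 1) ≤ φ (ψ (N + 1)) := hφ.monotone (hψ (by omega : N < N + 1))
    rw [hφs] at this
    have := hn (φ (ψ (N + 1))); omega
  have h3 := t.lower (i (v (φ (ψ (N + 1)))) - i (v (φ (ψ N)))) _ (hnA (φ (ψ N)))
  rw [ev_sub, Pi.sub_apply, hv1, hv0 _ _ hlt2, map_sub] at h3
  rw [dist_eq_norm] at h2
  simp only [Function.comp] at h2
  norm_num at h3
  linarith

end
end Sys
end AH

namespace AH
open Filter Topology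
namespace Sys
variable {Γ : Sys}
variable {S : Set ℕ} {V : Type*} [NormedAddCommGroup V] [NormedSpace ℝ V]

theorem Tgt.Q_zero (t : Γ.Tgt S V) {x : ZZ Γ} (h : ∀ n ∈ Γ.A S, ev x n = 0) : t.Q x = 0 := by
  have := t.upper x 0 le_rfl fun n hn => by rw [h n hn]; simp
  exact norm_le_zero_iff.mp (by linarith)

open Classical in
/-- restriction to the coordinates of `A S`, extended again -/
def rl (Γ : Sys) (S : Set ℕ) (q : ℕ) (x : ℕ → ℝ) : ℕ → ℝ :=
  Γ.E q (fun n => if n ∈ Γ.A S then x n else 0)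

theorem rl_le {q : ℕ} {x : ℕ → ℝ} {B : ℝ} (hB : 0 ≤ B) (h : ∀ n < q, n ∈ Γ.A S → |x n| ≤ B)
    (n : ℕ) : |Γ.rl S q x n| ≤ 2 * B :=
  E_bound' hB (fun k hk => by
    split_ifs with hA
    · exact h k hk hA
    · simpa using hB) n

open Classical in
theorem rl_eq {q : ℕ} {x : ℕ → ℝ} {n : ℕ} (hn : n ∈ Γ.A S) : Γ.rl S q x n = Γ.E q x n := by
  have := inv_A (Γ := Γ) S q ((fun n => if n ∈ Γ.A S then x n else 0) - x)
    (fun k _ hk => by simp [hk]) n hn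
  rw [E_sub, Pi.sub_apply] at this
  unfold rl
  linarith

theorem rl_blk {p q : ℕ} {x : ℕ → ℝ} (hpq : p ≤ q) (h : ∀ n < p, n ∈ Γ.A S → x n = 0) :
    Γ.Blk p q (Γ.rl S q x) :=
  Blk.of_E (fun k hk => by
    split_ifs with hA
    · exact h k hk hA
    · rfl) hpq

theorem gh (t : Γ.Tgt S V) {U : Submodule ℝ V} (hU : ¬ FiniteDimensional ℝ U) (p : ℕ) {η : ℝ}
    (hη : 0 < η) : ∃ (q : ℕ) (x : ℕ → ℝ) (a : ZZ Γ), t.Q a ∈ U ∧ p ≤ q ∧ Γ.Blk p q x ∧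
      (∀ n, |x n| ≤ 1) ∧ (∃ n < q, n ∈ Γ.A S ∧ 1 / 8 < |x n|) ∧ ∀ n, |ev a n - x n| ≤ η := by
  classical
  have h1 : ∀ n : ℕ, ∃ ψ : V →L[ℝ] ℝ, n ∈ Γ.A S → ∀ x, ψ (t.Q x) = ev x n := fun n => by
    by_cases hn : n ∈ Γ.A S
    · obtain ⟨ψ, hψ⟩ := t.coord hn
      exact ⟨ψ, fun _ => hψ⟩
    · exact ⟨0, fun h => absurd h hn⟩
  choose ψ hψ using h1
  let f : U →ₗ[ℝ] (Fin p → ℝ) := LinearMap.pi fun n => (ψ n).toLinearMap.comp U.subtype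
  have hf : ¬ Function.Injective f := fun h => hU (FiniteDimensional.of_injective f h)
  have : ∃ u : U, u ≠ 0 ∧ f u = 0 := by
    by_contra! hcon
    exact hf ((injective_iff_map_eq_zero f).mpr fun a ha => by_contra fun h => hcon a h ha)
  obtain ⟨u0, hu0, hfu⟩ := this
  have hpos : 0 < ‖u0‖ := norm_pos_iff.mpr hu0
  set u : U := (1 / (2 * ‖u0‖)) • u0 with hu
  have hun : ‖(u : V)‖ = 1 / 2 := by
    change ‖u‖ = 1 / 2
    rw [hu, norm_smul, Real.norm_of_nonneg (by positivity)]; field_simp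
  have hfu' : f u = 0 := by rw [hu, map_smul, hfu, smul_zero]
  obtain ⟨y, hy⟩ := t.surj (u : V)
  have hy0 : ∀ n < p, n ∈ Γ.A S → ev y n = 0 := fun n hn hA => by
    rw [← hψ n hA y, hy]
    exact congrFun hfu' ⟨n, hn⟩
  have hyb : ∀ n ∈ Γ.A S, |ev y n| ≤ 1 / 2 := fun n hn => by
    rw [← hun, ← hy]; exact t.lower y n hn
  obtain ⟨n0, hn0, hn0'⟩ : ∃ n ∈ Γ.A S, 1 / 8 < |ev y n| := by
    by_contra! hcon
    have := t.upper y (1 / 8) (by norm_num) hcon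
    rw [hy, hun] at this
    norm_num at this
  obtain ⟨q0, hq0⟩ := P_tail y hη
  set q := max q0 (max p (n0 + 1)) with hq
  have hb := rl_blk (Γ := Γ) (S := S) (x := ev y) (show p ≤ q by omega) hy0
  refine ⟨q, Γ.rl S q (ev y), ofE Γ q (Γ.rl S q (ev y)) + (y - P Γ q y), ?_, by omega, hb, ?_,
    ⟨n0, by omega, hn0, ?_⟩, ?_⟩
  · have e : t.Q (ofE Γ q (Γ.rl S q (ev y)) - P Γ q y) = 0 := t.Q_zero fun n hn => by
      rw [ev_sub, hb.ev, ev_P, Pi.sub_apply, rl_eq hn, sub_self]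
    have e2 : t.Q (ofE Γ q (Γ.rl S q (ev y)) + (y - P Γ q y)) = u := by
      rw [show ofE Γ q (Γ.rl S q (ev y)) + (y - P Γ q y)
        = (ofE Γ q (Γ.rl S q (ev y)) - P Γ q y) + y by abel, map_add, e, zero_add, hy]
    rw [e2]; exact u.2
  · intro n
    have := rl_le (Γ := Γ) (S := S) (q := q) (x := ev y) (B := 1 / 2) (by norm_num)
      (fun k _ hk => hyb k hk) n
    linarith
  · rw [rl_eq hn0, E_lt _ (by omega)]; exact hn0'
  · intro n
    rw [ev_add, hb.ev, Pi.add_apply, add_sub_cancel_left]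
    exact (ev_le _ _).trans (hq0 q (by omega))

theorem two_pow_big {m : ℕ} (hm : 4 ≤ m) : 8 * m < 2 ^ (m ^ 2) := by
  have h1 : m < 2 ^ m := Nat.lt_two_pow_self
  calc 8 * m ≤ m ^ 4 := by nlinarith [pow_le_pow_left' hm 3]
    _ < (2 ^ m) ^ 4 := Nat.pow_lt_pow_left h1 (by norm_num)
    _ = 2 ^ (m * 4) := (pow_mul _ _ _).symm
    _ ≤ 2 ^ (m ^ 2) := Nat.pow_le_pow_right (by norm_num) (by nlinarith)

theorem sum_blocks (f : ℕ → ℝ) (a m k : ℕ) :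
    ∑ t ∈ Finset.range k, ∑ i ∈ Finset.Ico ((a + t) * m) ((a + t + 1) * m), f i =
      ∑ i ∈ Finset.Ico (a * m) ((a + k) * m), f i := by
  induction k with
  | zero => simp
  | succ k ih =>
    rw [Finset.sum_range_succ, ih, Finset.sum_Ico_consecutive _ (Nat.mul_le_mul_right _ (by omega))
      (Nat.mul_le_mul_right _ (by omega))]
    rfl

/-- the basic sequence of blocks with a lower estimate -/
theorem lower_seq (t : Γ.Tgt S V) {U : Submodule ℝ V} (hU : ¬ FiniteDimensional ℝ U) {j : ℕ}
    (hj : ¬ Odd j) (N : ℕ) {η : ℝ} (hη : 0 < η) :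
    ∃ (p q : ℕ → ℕ) (x : ℕ → ℕ → ℝ) (a : ℕ → ZZ Γ), (∀ i < nn j, t.Q (a i) ∈ U ∧ N ≤ p i ∧
      p i ≤ q i ∧ Γ.Blk (p i) (q i) (x i) ∧ (∀ n, |x i n| ≤ 1) ∧ ∀ n, |ev (a i) n - x i n| ≤ η) ∧
      (∀ i k, i < k → k < nn j → q i ≤ p k) ∧
      ∀ M, 0 < M → M ≤ nn j → ∃ γ ∈ Γ.A S, ∀ i < M, 1 / (8 * (mm j : ℝ)) ≤ x i γ := by
  obtain ⟨σ, ξ, o, H, hR⟩ := build (Γ := Γ) (S := S) (j := j) (O := (ℕ → ℝ) × ZZ Γ)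
    (fun σ o ξ => t.Q o.2 ∈ U ∧ Γ.Blk (max N σ) ξ o.1 ∧ N ≤ ξ ∧ (∀ n, |o.1 n| ≤ 1) ∧
      (∀ n, |ev o.2 n - o.1 n| ≤ η) ∧ 1 / 8 ≤ Γ.bb ξ o.1) (by
    intro σ hσ
    obtain ⟨q, x, a, h1, h2, h3, h4, ⟨n, hn, hnA, hxn⟩, h5⟩ := gh t hU (max N σ) hη
    obtain ⟨r, hr1, hr2⟩ : ∃ r : ℚ, |r| = 1 ∧ (r : ℝ) * x n = |x n| := by
      rcases le_total 0 (x n) with h | h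
      · exact ⟨1, by simp, by rw [abs_of_nonneg h]; simp⟩
      · exact ⟨-1, by simp, by rw [abs_of_nonpos h]; simp⟩
    obtain ⟨ξ, hξ, k1, k2, k3, -, -, k4⟩ := Γ.rich S j σ n n r 0 (by simp [hr1]) hnA hnA
      (fun h => absurd h hj) hσ q
    refine ⟨(x, a), ξ, k1, k2, k3, h1, h3.mono le_rfl hξ, by omega, h4, h5, ?_⟩
    rw [k4]
    simp only [Rat.cast_zero, zero_mul, add_zero, hr2]
    exact hxn.le)
  refine ⟨fun i => max N (σ i), ξ, fun i => (o i).1, fun i => (o i).2, fun i hi => ?_, ?_, ?_⟩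
  · obtain ⟨h1, h2, h3, h4, h5, h6⟩ := hR i hi
    exact ⟨h1, le_max_left _ _, max_le h3 (H.σ_le hi), h2, h4, h5⟩
  · intro i k hik hk
    have := H.le hik hk
    exact le_max_of_le_right this.le
  · intro M hM hMn
    refine ⟨ξ (M - 1), H.mem _ (by omega), fun i hi => ?_⟩
    obtain ⟨h1, h2, h3, h4, h5, h6⟩ := hR i (by omega)
    have h2' := h2.mono (le_max_right N (σ i)) le_rfl
    have e := (H.anc (show i ≤ M - 1 by omega) (by omega)).val h2' le_rfl
    have hm := mmR_pos j
    change 1 / (8 * (mm j : ℝ)) ≤ (o i).1 (ξ (M - 1))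
    rw [e, h2'.val_node (H.hs i (by omega)), H.hw i (by omega)]
    calc 1 / (8 * (mm j : ℝ)) = 1 / (mm j : ℝ) * (1 / 8) := by field_simp
      _ ≤ _ := by gcongr

theorem rvu (t : Γ.Tgt S V) {U : Submodule ℝ V} (hU : ¬ FiniteDimensional ℝ U) (N : ℕ) {η : ℝ}
    (hη : 0 < η) : ∃ (q : ℕ) (x : ℕ → ℝ) (a : ZZ Γ), t.Q a ∈ U ∧ N ≤ q ∧ Γ.Blk N q x ∧
      Γ.RV 5 N x ∧ (∃ n < q, n ∈ Γ.A S ∧ 1 < |x n|) ∧ ∀ n, |ev a n - x n| ≤ η := by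
  classical
  set j := 2 * (1 + ∑ h ∈ Finset.range N, 8 * nn h * mm h) with hj
  set n := nu j with hn
  set D := mm j ^ 2 with hD
  have hn1 : 1 ≤ n := nu_pos j
  have hnR : (0 : ℝ) < n := by exact_mod_cast hn1
  have hnh : ∀ h < N, 8 * nn h * mm h ≤ n := fun h hh => by
    have h1 : 8 * nn h * mm h ≤ ∑ h ∈ Finset.range N, 8 * nn h * mm h :=
      Finset.single_le_sum (f := fun h => 8 * nn h * mm h) (fun _ _ => Nat.zero_le _)
        (Finset.mem_range.mpr hh)
    have := le_nu j
    omega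
  have hnD : n ^ D ≤ nn j := by
    rw [nn_eq]
    calc n ^ D ≤ (2 * nu j) ^ D := Nat.pow_le_pow_left (by omega) _
      _ ≤ (2 * nu j) ^ (mm j ^ 2 + 1) := Nat.pow_le_pow_right (by omega) (by omega)
      _ ≤ _ := Nat.le_mul_of_pos_left _ (by have := mm_ge j; positivity)
  obtain ⟨p, q, x, a, hxa, hpq, hlow⟩ := lower_seq t hU (j := j) (by simp [hj]) N
    (η := η / 2 ^ D) (by positivity)
  set G : ℕ → ℕ → ℕ → ℝ := fun l s γ => ∑ i ∈ Finset.Ico (s * n ^ l) ((s + 1) * n ^ l), x i γ with hG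
  let Pr : ℕ → Prop := fun l => ∃ s, (s + 1) * n ^ l ≤ n ^ D ∧ ∃ γ ∈ Γ.A S, ((n : ℝ) / 2) ^ l < |G l s γ|
  have hPD : Pr D := by
    obtain ⟨γ, hγ, hv⟩ := hlow (n ^ D) (by positivity) hnD
    refine ⟨0, by simp, γ, hγ, ?_⟩
    have hm := mmR_pos j
    have h8 : 8 * (mm j : ℝ) < 2 ^ D := by exact_mod_cast two_pow_big (mm_ge j)
    have h1 : ∑ i ∈ Finset.Ico (0 * n ^ D) ((0 + 1) * n ^ D), 1 / (8 * (mm j : ℝ)) ≤ G D 0 γ :=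
      Finset.sum_le_sum fun i hi => hv i (by simpa using (Finset.mem_Ico.mp hi).2)
    rw [Finset.sum_const, Nat.card_Ico] at h1
    simp only [zero_mul, zero_add, one_mul, Nat.sub_zero, nsmul_eq_mul, Nat.cast_pow] at h1
    refine lt_of_lt_of_le ?_ (h1.trans (le_abs_self _))
    rw [div_pow, div_eq_mul_one_div]
    gcongr
  have hP0 : ¬ Pr 0 := by
    rintro ⟨s, hs, γ, hγ, h⟩
    have h1 := (hxa s (by simp at hs; omega)).2.2.2.2.1 γ
    simp only [hG, pow_zero, mul_one, Nat.Ico_succ_singleton, Finset.sum_singleton] at h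
    linarith
  obtain ⟨l, hl1, hl2, hlD⟩ : ∃ l, Pr (l + 1) ∧ ¬ Pr l ∧ l + 1 ≤ D := by
    have hex : ∃ l, Pr l := ⟨D, hPD⟩
    rcases h : Nat.find hex with _ | l
    · exact absurd (h ▸ Nat.find_spec hex) hP0
    · exact ⟨l, h ▸ Nat.find_spec hex, Nat.find_min hex (by omega), h ▸ Nat.find_min' hex hPD⟩
  obtain ⟨s, hs, γ, hγA, hγ⟩ := hl1
  set L := n ^ l with hL
  have hL1 : 1 ≤ L := Nat.one_le_pow _ _ hn1
  have hsL : (s + 1) * (n * L) ≤ n ^ D := by rw [hL, ← pow_succ']; exact hs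
  -- sub-blocks
  have hidx : ∀ k < n, (s * n + k + 1) * L ≤ (s + 1) * (n * L) := fun k hk => by
    calc (s * n + k + 1) * L ≤ (s * n + n) * L := Nat.mul_le_mul_right _ (by omega)
      _ = _ := by ring
  set y : ℕ → ℕ → ℝ := fun k => (2 * (2 / (n : ℝ)) ^ l) •
    ∑ i ∈ Finset.Ico ((s * n + k) * L) ((s * n + k + 1) * L), x i with hy
  set P0 : ℕ → ℕ := fun k => p ((s * n + k) * L) with hP
  set Q0 : ℕ → ℕ := fun k => q ((s * n + k + 1) * L - 1) with hQ
  have hlen : ∀ k, (s * n + k) * L + 1 ≤ (s * n + k + 1) * L := fun k => by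
    rw [add_mul (s * n + k) 1]; omega
  have hpm : ∀ i k, i ≤ k → k < nn j → p i ≤ p k := fun i k hik hk => by
    rcases hik.eq_or_lt with h | h
    · rw [h]
    · exact ((hxa i (by omega)).2.2.1).trans (hpq i k h hk)
  have hqm : ∀ i k, i ≤ k → k < nn j → q i ≤ q k := fun i k hik hk => by
    rcases hik.eq_or_lt with h | h
    · rw [h]
    · exact (hpq i k h hk).trans ((hxa k hk).2.2.1)
  have hyblk : ∀ k < n, Γ.Blk (P0 k) (Q0 k) (y k) := fun k hk => by
    refine (Blk.sum fun i hi => ?_).smul _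
    rw [Finset.mem_Ico] at hi
    have := hidx k hk
    exact (hxa i (by omega)).2.2.2.1.mono (hpm _ _ hi.1 (by omega)) (hqm _ _ (by omega) (by omega))
  have hyA : ∀ k < n, ∀ m ∈ Γ.A S, |y k m| ≤ 2 := fun k hk m hm => by
    have h1 : |G l (s * n + k) m| ≤ ((n : ℝ) / 2) ^ l := by
      by_contra hcon
      exact hl2 ⟨s * n + k, (hidx k hk).trans hsL, m, hm, not_le.mp hcon⟩
    have e : y k m = (2 * (2 / (n : ℝ)) ^ l) * G l (s * n + k) m := by
      simp only [hy, hG, Pi.smul_apply, Finset.sum_apply, smul_eq_mul, hL]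
    rw [e, abs_mul, abs_of_nonneg (by positivity)]
    calc (2 * (2 / (n : ℝ)) ^ l) * |G l (s * n + k) m|
        ≤ (2 * (2 / (n : ℝ)) ^ l) * ((n : ℝ) / 2) ^ l := by gcongr
      _ = 2 * ((2 / (n : ℝ)) * ((n : ℝ) / 2)) ^ l := by rw [mul_pow]; ring
      _ = 2 := by rw [show (2 / (n : ℝ)) * ((n : ℝ) / 2) = 1 by field_simp]; simp
  set z : ℕ → ℕ → ℝ := fun k => Γ.rl S (Q0 k) (y k) with hz
  have hPQ : ∀ k < n, P0 k ≤ Q0 k := fun k hk => by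
    have := hidx k hk
    have := hlen k
    exact (hxa _ (by omega)).2.2.1.trans (hqm _ _ (by omega) (by omega))
  have F : Γ.Fam (Finset.range n) z P0 Q0 4 := by
    refine ⟨by norm_num, fun k hk => ?_, fun k hk k' hk' hkk => ?_, fun k hk m => ?_⟩
    · rw [Finset.mem_range] at hk
      exact rl_blk (hPQ k hk) fun m hm _ => (hyblk k hk).1 m hm
    · rw [Finset.mem_range] at hk hk'
      have h1 := hidx k' hk'
      have h2 := hlen k'
      have h3 : (s * n + k + 1) * L ≤ (s * n + k') * L := Nat.mul_le_mul_right _ (by omega)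
      have h4 := hlen k
      exact hpq _ _ (by omega) (by omega)
    · rw [Finset.mem_range] at hk
      have := rl_le (Γ := Γ) (S := S) (q := Q0 k) (x := y k) (B := 2) (by norm_num)
        (fun m _ hm => hyA k hk m hm) m
      linarith
  have hzA : ∀ k < n, ∀ m ∈ Γ.A S, z k m = y k m := fun k hk m hm => by
    simp only [hz]; rw [rl_eq hm, (hyblk k hk).2]
  set X : ℕ → ℝ := (1 / (n : ℝ)) • ∑ k ∈ Finset.range n, z k with hX
  have hXa : ∀ m, X m = (1 / (n : ℝ)) * ∑ k ∈ Finset.range n, z k m := fun m => by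
    simp [hX, Finset.sum_apply]
  have hsumle : ∀ J' ⊆ Finset.range n, ∀ m, |∑ k ∈ J', z k m| ≤ 4 * J'.card := fun J' hJ m => by
    refine (Finset.abs_sum_le_sum_abs _ _).trans ?_
    refine (Finset.sum_le_card_nsmul _ _ 4 fun k hk => F.bd k (hJ hk) m).trans ?_
    rw [nsmul_eq_mul]; linarith
  have hNP : ∀ k < n, N ≤ P0 k := fun k hk => by
    have := hidx k hk
    have := hlen k
    exact (hxa _ (by omega)).2.1
  have hQQ : ∀ k < n, Q0 k ≤ Q0 (n - 1) := fun k hk => by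
    have h1 := hidx (n - 1) (by omega)
    have h2 := hlen (n - 1)
    have h3 : (s * n + k + 1) * L ≤ (s * n + (n - 1) + 1) * L := Nat.mul_le_mul_right _ (by omega)
    exact hqm _ _ (by omega) (by omega)
  have hXblk : Γ.Blk N (Q0 (n - 1)) X := by
    refine (Blk.sum fun k hk => ?_).smul _
    have hk' := Finset.mem_range.mp hk
    exact (F.blk k hk).mono (hNP k hk') (hQQ k hk')
  have hXR : Γ.RV 5 N X := by
    constructor
    · intro m
      have := hsumle _ le_rfl m
      rw [hXa, abs_mul, abs_of_pos (by positivity), one_div, inv_mul_le_iff₀ hnR]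
      rw [Finset.card_range] at this
      linarith
    · intro m hm
      have h1 := F.step (K := 0) (E := 4) le_rfl (by norm_num) (fun J' hJ' m => by
        rw [zero_add]; exact hsumle J' hJ' m) m _ le_rfl
      rw [Finset.card_range] at h1
      have h2 : (Γ.age m : ℝ) ≤ nn (Γ.w m) := by exact_mod_cast Γ.age_le m
      have h3 : (8 : ℝ) * nn (Γ.w m) * mm (Γ.w m) ≤ n := by exact_mod_cast hnh _ hm
      have hmp := mmR_pos (Γ.w m)
      have h4 : (8 : ℝ) * nn (Γ.w m) ≤ n / mm (Γ.w m) := by rwa [le_div_iff₀ hmp]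
      rw [hXa, abs_mul, abs_of_pos (by positivity), one_div, inv_mul_le_iff₀ hnR]
      calc _ ≤ _ := h1
        _ ≤ n / mm (Γ.w m) + 4 / mm (Γ.w m) * n := by gcongr; linarith
        _ = n * (5 / mm (Γ.w m)) := by ring
  have hXA : ∀ m ∈ Γ.A S, X m = (2 / (n : ℝ)) ^ (l + 1) *
      ∑ i ∈ Finset.Ico (s * (n * L)) ((s + 1) * (n * L)), x i m := fun m hm => by
    rw [hXa, Finset.sum_congr rfl fun k hk => hzA k (Finset.mem_range.mp hk) m hm]
    simp only [hy, Pi.smul_apply, Finset.sum_apply, smul_eq_mul]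
    rw [← Finset.mul_sum, sum_blocks]
    rw [show s * n * L = s * (n * L) by ring, show (s * n + n) * L = (s + 1) * (n * L) by ring]
    rw [pow_succ]; ring
  set a' : ZZ Γ := (2 / (n : ℝ)) ^ (l + 1) •
      ∑ i ∈ Finset.Ico (s * (n * L)) ((s + 1) * (n * L)), a i with ha'
  set Y : ℕ → ℝ := (2 / (n : ℝ)) ^ (l + 1) •
      ∑ i ∈ Finset.Ico (s * (n * L)) ((s + 1) * (n * L)), x i with hY
  have hIlt : ∀ i ∈ Finset.Ico (s * (n * L)) ((s + 1) * (n * L)), i < nn j := fun i hi => by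
    have := (Finset.mem_Ico.mp hi).2; omega
  have hYblk : Γ.Blk N (q (nn j - 1)) Y := by
    refine (Blk.sum fun i hi => ?_).smul _
    have h1 := hIlt i hi
    exact (hxa i h1).2.2.2.1.mono (hxa i h1).2.1 (hqm _ _ (by omega) (by omega))
  have hYA : ∀ m, Y m = (2 / (n : ℝ)) ^ (l + 1) *
      ∑ i ∈ Finset.Ico (s * (n * L)) ((s + 1) * (n * L)), x i m := fun m => by
    simp only [hY, Pi.smul_apply, Finset.sum_apply, smul_eq_mul]
  have haY : ∀ m, |ev a' m - Y m| ≤ η := fun m => by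
    have e : ev a' m - Y m = (2 / (n : ℝ)) ^ (l + 1) *
      ∑ i ∈ Finset.Ico (s * (n * L)) ((s + 1) * (n * L)), (ev (a i) m - x i m) := by
      rw [hYA, Finset.sum_sub_distrib, mul_sub, ha', ev_smul, ev_sum, Pi.smul_apply,
        Finset.sum_apply, smul_eq_mul]
    have hcard : (Finset.Ico (s * (n * L)) ((s + 1) * (n * L))).card = n ^ (l + 1) := by
      rw [Nat.card_Ico, add_mul, one_mul, Nat.add_sub_cancel_left, hL, ← pow_succ']
    rw [e, abs_mul, abs_of_nonneg (by positivity)]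
    calc _ ≤ (2 / (n : ℝ)) ^ (l + 1) * ((n : ℝ) ^ (l + 1) * (η / 2 ^ D)) := by
          gcongr
          refine (Finset.abs_sum_le_sum_abs _ _).trans ?_
          refine (Finset.sum_le_card_nsmul _ _ (η / 2 ^ D) fun i hi =>
            (hxa i (hIlt i hi)).2.2.2.2.2 m).trans ?_
          rw [hcard, nsmul_eq_mul, Nat.cast_pow]
      _ = ((2 / (n : ℝ)) * n) ^ (l + 1) / 2 ^ D * η := by rw [mul_pow]; ring
      _ ≤ 1 * η := by
          rw [div_mul_cancel₀ _ hnR.ne']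
          gcongr
          rw [div_le_one (by positivity)]
          exact pow_le_pow_right₀ (by norm_num) hlD
      _ = η := one_mul _
  have hQa' : t.Q a' ∈ U := by
    rw [ha', map_smul, map_sum]
    exact U.smul_mem _ (U.sum_mem fun i hi => (hxa i (hIlt i hi)).1)
  set q' := max (max N (γ + 1)) (max (Q0 (n - 1)) (q (nn j - 1))) with hq'
  have hX' : Γ.Blk N q' X := hXblk.mono le_rfl (by omega)
  have hY' : Γ.Blk N q' Y := hYblk.mono le_rfl (by omega)
  refine ⟨q', X, a' + (ofE Γ q' X - ofE Γ q' Y), ?_, by omega, hX', hXR, ⟨γ, by omega, hγA, ?_⟩, ?_⟩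
  · rw [map_add, t.Q_zero (x := ofE Γ q' X - ofE Γ q' Y), add_zero]
    · exact hQa'
    · intro m hm
      rw [ev_sub, hX'.ev, hY'.ev, Pi.sub_apply, hXA m hm, hYA m, sub_self]
  · rw [hXA γ hγA, abs_mul, abs_of_nonneg (by positivity)]
    have e : G (l + 1) s γ = ∑ i ∈ Finset.Ico (s * (n * L)) ((s + 1) * (n * L)), x i γ := by
      simp only [hG, hL, pow_succ']
    rw [← e]
    calc (1 : ℝ) = ((2 / (n : ℝ)) * ((n : ℝ) / 2)) ^ (l + 1) := by
          rw [show (2 / (n : ℝ)) * ((n : ℝ) / 2) = 1 by field_simp]; simp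
      _ = (2 / (n : ℝ)) ^ (l + 1) * ((n : ℝ) / 2) ^ (l + 1) := mul_pow _ _ _
      _ < _ := by gcongr
  · intro m
    rw [ev_add, ev_sub, hX'.ev, hY'.ev, Pi.add_apply, Pi.sub_apply]
    have := haY m
    rwa [show ev a' m + (X m - Y m) - X m = ev a' m - Y m by ring]

end Sys
end AH

namespace AH
open Filter Topology
namespace Sys
variable {Γ : Sys}
variable {S : Set ℕ} {V : Type*} [NormedAddCommGroup V] [NormedSpace ℝ V]

theorem thmHI [CompleteSpace V] (t : Γ.Tgt S V) : HereditarilyIndecomposable V := by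
  intro Z U U' hZ _ hUc hU'c hU hU' hdis hsup
  have hUZ : U ≤ Z := hsup ▸ le_sup_left
  have hU'Z : U' ≤ Z := hsup ▸ le_sup_right
  have : CompleteSpace Z := hZ.completeSpace_coe
  set p : Submodule ℝ Z := U.comap Z.subtype with hp
  set p' : Submodule ℝ Z := U'.comap Z.subtype with hp'
  have hpc : IsClosed (p : Set Z) := hUc.preimage continuous_subtype_val
  have hpc' : IsClosed (p' : Set Z) := hU'c.preimage continuous_subtype_val
  have hcompl : IsCompl p p' := by
    constructor
    · rw [Submodule.disjoint_def]
      intro x h1 h2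
      have : (x : V) ∈ U ⊓ U' := ⟨h1, h2⟩
      rw [hdis, Submodule.mem_bot] at this
      exact Subtype.ext this
    · rw [codisjoint_iff, eq_top_iff]
      intro x _
      have hx : (x : V) ∈ U ⊔ U' := by rw [hsup]; exact x.2
      obtain ⟨y, hy, z, hz, e⟩ := Submodule.mem_sup.mp hx
      exact Submodule.mem_sup.mpr ⟨⟨y, hUZ hy⟩, hy, ⟨z, hU'Z hz⟩, hz, Subtype.ext e⟩
  have htc := Submodule.IsCompl.isTopCompl_of_isClosed hcompl hpc hpc'
  let W : Submodule ℝ (ZZ Γ) := Z.comap t.Q.toLinearMap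
  let i : W →ₗᵢ[ℝ] ZZ Γ := W.subtypeₗᵢ
  let T0 : W →L[ℝ] Z := (t.Q.comp W.subtypeL).codRestrict Z fun w => w.2
  let T : W →L[ℝ] V := Z.subtypeL.comp (p.subtypeL.comp ((p.projectionOntoL p' htc).comp T0))
  have hTa : ∀ w : W, t.Q w ∈ U → T w = t.Q w := fun w hw => by
    have := Submodule.projectionOntoL_apply_left htc ⟨T0 w, hw⟩
    change ((p.projectionOntoL p' htc (T0 w) : Z) : V) = _
    rw [show p.projectionOntoL p' htc (T0 w) = ⟨T0 w, hw⟩ from this]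
    rfl
  have hTb : ∀ w : W, t.Q w ∈ U' → T w = 0 := fun w hw => by
    change ((p.projectionOntoL p' htc (T0 w) : Z) : V) = _
    rw [(Submodule.projectionOntoL_apply_eq_zero_iff htc).mpr (show T0 w ∈ p' from hw)]
    rfl
  obtain ⟨N, hN⟩ := KP (i := i) t T 10 (δ := 1 / 100) (by norm_num)
  set η : ℝ := min (1 / 100) (1 / (2 * (N + 1))) with hη
  have hη0 : 0 < η := by positivity
  have hη1 : η ≤ 1 / 100 := min_le_left _ _
  have hη2 : η + η ≤ 1 / (N + 1) := by
    have : η ≤ 1 / (2 * (N + 1)) := min_le_right _ _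
    calc η + η ≤ 1 / (2 * (N + 1)) + 1 / (2 * (N + 1)) := by gcongr
      _ = 1 / ((N : ℝ) + 1) := by field_simp; norm_num
  obtain ⟨q, x, a, ha1, ha2, ha3, ha4, ⟨n, hn, hnA, hxn⟩, ha5⟩ := rvu t hU N hη0
  obtain ⟨q', x', b, hb1, hb2, hb3, hb4, ⟨n', hn', hnA', hxn'⟩, hb5⟩ := rvu t hU' q hη0
  let wa : W := ⟨a, hUZ ha1⟩
  let wb : W := ⟨b, hU'Z hb1⟩
  have hadm : Adm i 10 N q' (x + x') (wa + wb) := by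
    refine ⟨(ha3.mono le_rfl hb2).add (hb3.mono ha2 le_rfl), ⟨fun k => ?_, fun k hk => ?_⟩, fun k => ?_⟩
    · have := ha4.1 k
      have := hb4.1 k
      refine (abs_add_le _ _).trans (by linarith)
    · have h1 := ha4.2 k hk
      have h2 := hb4.2 k (by omega)
      refine (abs_add_le _ _).trans ?_
      calc _ ≤ _ := add_le_add h1 h2
        _ = _ := by ring
    · have h1 := ha5 k
      have h2 := hb5 k
      change |ev (a + b) k - (x k + x' k)| ≤ _
      rw [ev_add, Pi.add_apply, show ev a k + ev b k - (x k + x' k)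
        = (ev a k - x k) + (ev b k - x' k) by ring]
      exact (abs_add_le _ _).trans (by linarith)
  obtain ⟨c, hc⟩ := hN _ _ _ hadm
  rw [map_add, hTa wa ha1, hTb wb hb1] at hc
  have hc' : ‖t.Q ((1 - c) • a - c • b)‖ ≤ 1 / 100 := by
    have e : t.Q ((1 - c) • a - c • b) = t.Q a + 0 - c • t.Q (a + b) := by
      rw [map_sub, map_smul, map_smul, map_add]
      module
    rw [e]; exact hc
  have key : ∀ m ∈ Γ.A S, |(1 - c) * ev a m - c * ev b m| ≤ 1 / 100 := fun m hm => by
    have := (t.lower _ m hm).trans hc'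
    simpa [ev_sub, ev_smul] using this
  have hx'n : x' n = 0 := hb3.1 n hn
  have hqn' : |x n'| ≤ 5 := ha4.1 n'
  have k1 := key n hnA
  have k2 := key n' hnA'
  have a1 := ha5 n
  have b1 := hb5 n
  have a2 := ha5 n'
  have b2 := hb5 n'
  rw [hx'n, sub_zero] at b1
  have e1 : 99 / 100 ≤ |ev a n| := by
    have := abs_sub_abs_le_abs_sub (x n) (ev a n)
    rw [abs_sub_comm] at this; linarith
  have e2 : 99 / 100 ≤ |ev b n'| := by
    have := abs_sub_abs_le_abs_sub (x' n') (ev b n')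
    rw [abs_sub_comm] at this; linarith
  have e3 : |ev a n'| ≤ 6 := by
    have := abs_sub_abs_le_abs_sub (ev a n') (x n')
    linarith
  have e4 : |ev b n| ≤ 1 / 100 := by linarith
  have f1 : |1 - c| * (99 / 100) ≤ 1 / 100 + |c| * (1 / 100) := by
    have h1 := abs_sub_abs_le_abs_sub ((1 - c) * ev a n) (c * ev b n)
    rw [abs_mul, abs_mul] at h1
    have h2 := mul_le_mul_of_nonneg_left e1 (abs_nonneg (1 - c))
    have h3 := mul_le_mul_of_nonneg_left e4 (abs_nonneg c)
    linarith
  have f2 : |c| * (99 / 100) ≤ 1 / 100 + |1 - c| * 6 := by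
    have h1 := abs_sub_abs_le_abs_sub (c * ev b n') ((1 - c) * ev a n')
    rw [abs_mul, abs_mul, abs_sub_comm (c * ev b n')] at h1
    have h2 := mul_le_mul_of_nonneg_left e2 (abs_nonneg c)
    have h3 := mul_le_mul_of_nonneg_left e3 (abs_nonneg (1 - c))
    linarith
  have f3 : 1 ≤ |1 - c| + |c| := by
    have := abs_add_le (1 - c) c
    rwa [sub_add_cancel, abs_one] at this
  linarith

end Sys
end AH

namespace AH
/-- node data -/
structure Nd where
  w : ℕ
  s : ℕ
  a : ℕ
  b : ℕ
  r₁ : ℚ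
  r₂ : ℚ
  t : Finset ℕ
  age : ℕ

def dflt : Nd := ⟨0, 0, 0, 0, 0, 0, ∅, 1⟩

def Nd.tup (c : Nd) : ℕ × ℕ × ℕ × ℕ × ℚ × ℚ × Finset ℕ × ℕ :=
  (c.w, c.s, c.a, c.b, c.r₁, c.r₂, c.t, c.age)

theorem Nd.tup_inj : Function.Injective Nd.tup := by
  rintro ⟨⟩ ⟨⟩ h
  simpa [Nd.tup] using h

theorem ex_enum : ∃ f : ℕ → Nd, Function.Surjective f := by
  have : Countable Nd := Nd.tup_inj.countable
  have : Nonempty Nd := ⟨dflt⟩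
  exact exists_surjective_nat Nd

def enum (n : ℕ) : Nd := Classical.choose ex_enum (Nat.unpair n).2

theorem enum_spec (c : Nd) (N : ℕ) : ∃ n ≥ N, enum n = c := by
  obtain ⟨m, hm⟩ := Classical.choose_spec ex_enum c
  exact ⟨Nat.pair N m, Nat.left_le_pair _ _, by simp [enum, hm]⟩

def Vd (n : ℕ) (g : ℕ → Nd) (c : Nd) : Prop :=
  c.a < n ∧ c.b < n ∧ c.w ≤ n ∧ c.s ≤ n ∧ |c.r₁| + |c.r₂| ≤ 1 ∧ (g c.a).t ⊆ c.t ∧ (g c.b).t ⊆ c.t ∧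
    (Odd c.w → c.r₁ = 1 ∧ c.r₂ = 0 ∧ (g c.a).w = code c.w c.s) ∧
    (c.s = 0 ∧ c.age = 1 ∨ ∃ ξ, c.s = ξ + 1 ∧ (g ξ).t ⊆ c.t ∧ (g ξ).w = c.w ∧
      (g ξ).age < nn c.w ∧ c.age = (g ξ).age + 1)

theorem Vd.congr {n : ℕ} {g g' : ℕ → Nd} {c : Nd} (h : Vd n g c) (hg : ∀ k < n, g k = g' k) :
    Vd n g' c := by
  obtain ⟨h1, h2, h3, h4, h5, h6, h7, h8, h9⟩ := h
  refine ⟨h1, h2, h3, h4, h5, hg _ h1 ▸ h6, hg _ h2 ▸ h7, hg _ h1 ▸ h8, ?_⟩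
  rcases h9 with h | ⟨ξ, e, h⟩
  · exact Or.inl h
  · exact Or.inr ⟨ξ, e, hg ξ (by omega) ▸ h⟩

open Classical in
def Fd : ℕ → ℕ → Nd
  | 0 => fun _ => dflt
  | n + 1 => Function.update (Fd n) n (if Vd n (Fd n) (enum n) then enum n else dflt)

def nd (n : ℕ) : Nd := Fd (n + 1) n

theorem Fd_eq {n k : ℕ} (h : k < n) : Fd n k = nd k := by
  induction n with
  | zero => omega
  | succ n ih =>
    rcases Nat.lt_succ_iff_lt_or_eq.mp h with h' | h'
    · rw [Fd, Function.update_of_ne (by omega), ih h']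
    · rw [h', nd]

theorem nd_cases (n : ℕ) : nd n = dflt ∨ Vd n nd (nd n) := by
  classical
  by_cases h : Vd n (Fd n) (enum n)
  · right
    have e : nd n = enum n := by rw [nd, Fd, Function.update_self, if_pos h]
    rw [e]; exact h.congr fun k hk => Fd_eq hk
  · left
    rw [nd, Fd, Function.update_self, if_neg h]

theorem nd_hit {c : Nd} {M : ℕ} (h : ∀ n ≥ M, Vd n nd c) (N : ℕ) : ∃ n ≥ N, nd n = c := by
  classical
  obtain ⟨n, hn, e⟩ := enum_spec c (max M N)
  refine ⟨n, by omega, ?_⟩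
  rw [nd, Fd, Function.update_self, e, if_pos ((h n (by omega)).congr fun k hk => (Fd_eq hk).symm)]

theorem nd_zero : nd 0 = dflt := by
  rcases nd_cases 0 with h | h
  · exact h
  · exact absurd h.1 (by omega)

theorem ex_Sys : Nonempty Sys := by
  refine ⟨⟨fun n => (nd n).w, fun n => (nd n).s, fun n => (nd n).age, fun n => (nd n).t,
    fun n => ((nd n).r₁ : ℝ) • LinearMap.proj (nd n).a + ((nd n).r₂ : ℝ) • LinearMap.proj (nd n).b,
    fun n => ?_, fun n ξ e => ?_, fun n ξ e => ?_, fun n e => ?_, fun n => ?_, fun n ξ e => ?_,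
    fun n => ?_, fun n x B hB h => ?_, fun n ho => ?_, ?_, ?_⟩⟩
  · rcases nd_cases n with h | h
    · simp [h, dflt]
    · exact h.2.2.2.1
  · rcases nd_cases n with h | h
    · simp [h, dflt] at e
    · obtain ⟨_, _, _, _, _, _, _, _, h | ⟨ξ', e', h⟩⟩ := h
      · omega
      · obtain rfl : ξ = ξ' := by omega
        exact h.2.1
  · rcases nd_cases n with h | h
    · simp [h, dflt] at e
    · obtain ⟨_, _, _, _, _, _, _, _, h | ⟨ξ', e', h⟩⟩ := h
      · omega
      · obtain rfl : ξ = ξ' := by omega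
        exact h.2.2.2
  · rcases nd_cases n with h | h
    · simp [h, dflt]
    · obtain ⟨_, _, _, _, _, _, _, _, h | ⟨ξ', e', h⟩⟩ := h
      · exact h.2
      · omega
  · rcases nd_cases n with h | h
    · simp only [h, dflt]; exact nn_pos 0
    · obtain ⟨_, _, _, _, _, _, _, _, h | ⟨ξ', e', h⟩⟩ := h
      · simp only [h.2]; exact nn_pos _
      · have := h.2.2.2
        have := h.2.2.1
        omega
  · rcases nd_cases n with h | h
    · simp [h, dflt] at e
    · obtain ⟨_, _, _, _, _, _, _, _, h | ⟨ξ', e', h⟩⟩ := h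
      · omega
      · obtain rfl : ξ = ξ' := by omega
        exact h.1
  · rcases nd_cases n with h | h
    · simp [h, dflt]
    · exact h.2.2.1
  · rcases nd_cases n with h' | h'
    · simpa [h', dflt] using hB
    · obtain ⟨h1, h2, _, _, h5, h6, h7, _⟩ := h'
      have a1 := h _ h1 h6
      have a2 := h _ h2 h7
      have h5' : |((nd n).r₁ : ℝ)| + |((nd n).r₂ : ℝ)| ≤ 1 := by exact_mod_cast h5
      change |((nd n).r₁ : ℝ) * x (nd n).a + ((nd n).r₂ : ℝ) * x (nd n).b| ≤ B
      refine (abs_add_le _ _).trans ?_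
      rw [abs_mul, abs_mul]
      have b1 := mul_le_mul_of_nonneg_left a1 (abs_nonneg ((nd n).r₁ : ℝ))
      have b2 := mul_le_mul_of_nonneg_left a2 (abs_nonneg ((nd n).r₂ : ℝ))
      nlinarith
  · rcases nd_cases n with h | h
    · simp [h, dflt] at ho
    · obtain ⟨e1, e2, e3⟩ := h.2.2.2.2.2.2.2.1 ho
      exact ⟨(nd n).a, fun x => by simp [e1, e2], e3⟩
  · intro S j σ a b r₁ r₂ hr ha hb ho hσ N
    obtain ⟨t, age, ht, h⟩ : ∃ (t : Finset ℕ) (age : ℕ), (t : Set ℕ) ⊆ S ∧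
        ∀ n ≥ max (max (a + 1) (b + 1)) (max j σ), Vd n nd ⟨j, σ, a, b, r₁, r₂, t, age⟩ := by
      rcases hσ with hσ | ⟨ξ, e, h1, h2, h3⟩
      · refine ⟨(nd a).t ∪ (nd b).t, 1, by simp [ha, hb], fun n hn => ⟨by dsimp; omega, by dsimp; omega,
          by dsimp; omega, by dsimp; omega, hr, Finset.subset_union_left, Finset.subset_union_right,
          ho, Or.inl ⟨hσ, rfl⟩⟩⟩
      · refine ⟨(nd a).t ∪ (nd b).t ∪ (nd ξ).t, (nd ξ).age + 1, by simp [ha, hb, h1],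
          fun n hn => ⟨by dsimp; omega, by dsimp; omega,
          by dsimp; omega, by dsimp; omega, hr,
          Finset.subset_union_left.trans Finset.subset_union_left,
          Finset.subset_union_right.trans Finset.subset_union_left,
          ho, Or.inr ⟨ξ, e, Finset.subset_union_right, h2, h3, rfl⟩⟩⟩
    obtain ⟨n, hn, e⟩ := nd_hit h (max N (max (a + 1) (b + 1)))
    refine ⟨n, by omega, ?_⟩
    rw [e]
    exact ⟨ht, rfl, rfl, by omega, by omega, fun x => rfl⟩
  · intro e N
    obtain ⟨n, hn, h⟩ := nd_hit (c := ⟨2 * N, 0, 0, 0, 0, 0, {e}, 1⟩) (M := 2 * N + 1)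
      (fun n hn => ⟨by dsimp; omega, by dsimp; omega, by dsimp; omega, by dsimp; omega, by simp,
        by simp [nd_zero, dflt], by simp [nd_zero, dflt], fun h => absurd h (by simp),
        Or.inl ⟨rfl, rfl⟩⟩) N
    refine ⟨n, hn, ?_⟩
    rw [h]
    exact ⟨rfl, by dsimp; omega⟩

end AH

namespace AH
open Filter Topology
namespace Sys
variable {Γ : Sys}

theorem compact_of_comp {X Y V : Type*} [TopologicalSpace X] [TopologicalSpace Y]
    [TopologicalSpace V] [Zero X] [Zero Y] {q : X → Y} {R : Y → V} (hq : IsOpenMap q)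
    (hs : Function.Surjective q) (h0 : q 0 = 0) (h : IsCompactOperator (fun x => R (q x))) :
    IsCompactOperator R := by
  obtain ⟨K, hK, h⟩ := h
  refine ⟨K, hK, ?_⟩
  have := hq.image_mem_nhds h
  rw [h0] at this
  convert this
  exact (Set.image_preimage_eq (R ⁻¹' K) hs).symm

theorem hl_ex {S S' : Set ℕ} {e : ℕ} (h1 : e ∈ S) (h2 : e ∉ S') (N : ℕ) :
    ∃ n ≥ N, n ∈ Γ.A S ∧ n ∉ Γ.A S' ∧ N ≤ Γ.w n := by
  obtain ⟨n, hn, ht, hw⟩ := Γ.labels e N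
  exact ⟨n, hn, by simpa [A, ht] using h1, by simpa [A, ht] using h2, hw⟩

theorem hl_ex0 {S : Set ℕ} {e : ℕ} (h1 : e ∈ S) (N : ℕ) :
    ∃ n ≥ N, n ∈ Γ.A S ∧ n ∉ (∅ : Set ℕ) ∧ N ≤ Γ.w n := by
  obtain ⟨n, hn, ht, hw⟩ := Γ.labels e N
  exact ⟨n, hn, by simpa [A, ht] using h1, by simp, hw⟩

abbrev iY (Γ : Sys) (S : Set ℕ) : YY Γ (Γ.A S) →ₗᵢ[ℝ] ZZ Γ := (YY Γ (Γ.A S)).subtypeₗᵢ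

theorem iY_hr {S : Set ℕ} (z : ZZ Γ) (hz : z ∈ YY Γ (Γ.A S)) : ∃ x, iY Γ S x = z := ⟨⟨z, hz⟩, rfl⟩

theorem iY_hr' {S : Set ℕ} (x : YY Γ (Γ.A S)) : iY Γ S x ∈ YY Γ (Γ.A S) := x.2

theorem id_hr (z : ZZ Γ) (_ : z ∈ YY Γ ∅) : ∃ x, (LinearIsometry.id : ZZ Γ →ₗᵢ[ℝ] ZZ Γ) x = z :=
  ⟨z, rfl⟩

theorem id_hr' (x : ZZ Γ) : (LinearIsometry.id : ZZ Γ →ₗᵢ[ℝ] ZZ Γ) x ∈ YY Γ ∅ :=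
  fun _ h => h.elim

/-- mixed maps are never compact -/
theorem mixed {S S' : Set ℕ} {e : ℕ} (h1 : e ∈ S) (h2 : e ∉ S') {lam : ℝ}
    (h : IsCompactOperator (lam • ((mkQL S : ZZ Γ →L[ℝ] _).comp
      (iY Γ S').toContinuousLinearMap))) : lam = 0 := by
  by_contra hl
  have := YY_closed (Γ := Γ) (Γ.A S)
  refine not_compact (i := iY Γ S') (tgtQ Γ S) (inv_A S') iY_hr (hl_ex h1 h2) ?_
  have := h.smul lam⁻¹
  have e : lam⁻¹ • (lam • ((mkQL S : ZZ Γ →L[ℝ] _).comp (iY Γ S').toContinuousLinearMap)) =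
    (tgtQ Γ S).Q.comp (iY Γ S').toContinuousLinearMap := by
    rw [smul_smul, inv_mul_cancel₀ hl, one_smul]; rfl
  rw [← e]; exact this

theorem opY {S : Set ℕ} {e : ℕ} (h2 : e ∉ S) (T : YY Γ (Γ.A S) →L[ℝ] ZZ Γ) :
    ∃ lam : ℝ, IsCompactOperator (T - lam • (iY Γ S).toContinuousLinearMap) :=
  thmA (i := iY Γ S) (tgtId Γ) T (inv_A S) iY_hr iY_hr' (hl_ex (Set.mem_univ e) h2)

theorem opX {S : Set ℕ} {e : ℕ} (h1 : e ∈ S) (T : ZZ Γ →L[ℝ] (ZZ Γ ⧸ YY Γ (Γ.A S))) :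
    ∃ lam : ℝ, IsCompactOperator (fun x => T x - lam • mkQL S x) := by
  have := YY_closed (Γ := Γ) (Γ.A S)
  exact thmA (i := LinearIsometry.id) (tgtQ Γ S) T inv_empty id_hr id_hr' (hl_ex0 h1)

theorem opZ (T : ZZ Γ →L[ℝ] ZZ Γ) :
    ∃ lam : ℝ, IsCompactOperator (T - lam • ContinuousLinearMap.id ℝ (ZZ Γ)) :=
  thmA (i := LinearIsometry.id) (tgtId Γ) T inv_empty id_hr id_hr' (hl_ex0 (Set.mem_univ 0))

theorem infZ : ¬ FiniteDimensional ℝ (ZZ Γ) := fun _ => by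
  refine not_compact (i := LinearIsometry.id) (tgtId Γ) inv_empty id_hr (hl_ex0 (Set.mem_univ 0)) ?_
  have := FiniteDimensional.proper ℝ (ZZ Γ)
  exact isCompactOperator_of_locallyCompactSpace_dom _

theorem infY {S : Set ℕ} {e : ℕ} (h2 : e ∉ S) : ¬ FiniteDimensional ℝ (YY Γ (Γ.A S)) := fun _ => by
  refine not_compact (i := iY Γ S) (tgtId Γ) (inv_A S) iY_hr (hl_ex (Set.mem_univ e) h2) ?_
  have := FiniteDimensional.proper ℝ (YY Γ (Γ.A S))
  exact isCompactOperator_of_locallyCompactSpace_rng _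

theorem infX {S : Set ℕ} {e : ℕ} (h1 : e ∈ S) : ¬ FiniteDimensional ℝ (ZZ Γ ⧸ YY Γ (Γ.A S)) :=
    fun _ => by
  have := YY_closed (Γ := Γ) (Γ.A S)
  refine not_compact (i := LinearIsometry.id) (tgtQ Γ S) inv_empty id_hr (hl_ex0 h1) ?_
  have := FiniteDimensional.proper ℝ (ZZ Γ ⧸ YY Γ (Γ.A S))
  exact isCompactOperator_of_locallyCompactSpace_dom _

theorem spcZ : ScalarPlusCompact (ZZ Γ) := fun T => by
  obtain ⟨lam, h⟩ := opZ T
  exact ⟨lam, _, h, by abel⟩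

theorem spcY {S : Set ℕ} {e : ℕ} (h2 : e ∉ S) : ScalarPlusCompact (YY Γ (Γ.A S)) := fun T => by
  obtain ⟨lam, h⟩ := opY h2 ((YY Γ (Γ.A S)).subtypeL.comp T)
  refine ⟨lam, T - lam • ContinuousLinearMap.id ℝ _, ?_, by abel⟩
  exact h.codRestrict (V := YY Γ (Γ.A S))
    (fun x => ((T - lam • ContinuousLinearMap.id ℝ (YY Γ (Γ.A S))) x).2) (YY_closed _)

theorem mixY {S S' : Set ℕ} {e : ℕ} (h1 : e ∈ S') (h2 : e ∉ S)
    (T : YY Γ (Γ.A S) →L[ℝ] YY Γ (Γ.A S')) : IsCompactOperator T := by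
  obtain ⟨lam, h⟩ := opY h2 ((YY Γ (Γ.A S')).subtypeL.comp T)
  have h0 : -lam = 0 := mixed (Γ := Γ) h1 h2 (by
    have h3 := h.clm_comp (mkQL S' : ZZ Γ →L[ℝ] _)
    refine cast (congrArg IsCompactOperator (funext fun x => ?_)) h3
    symm
    have : (mkQL S' : ZZ Γ →L[ℝ] _) (T x : ZZ Γ) = 0 :=
      (Submodule.Quotient.mk_eq_zero _).mpr (T x).2
    change (-lam) • mkQL S' (x : ZZ Γ) = mkQL S' ((T x : ZZ Γ) - lam • (x : ZZ Γ))
    rw [map_sub, this, map_smul]; module)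
  obtain rfl : lam = 0 := by linarith
  rw [zero_smul, sub_zero] at h
  exact h.codRestrict (V := YY Γ (Γ.A S')) (fun x => (T x).2) (YY_closed _)

theorem desc {S : Set ℕ} {V : Type*} [SeminormedAddCommGroup V] [NormedSpace ℝ V]
    {R : (ZZ Γ ⧸ YY Γ (Γ.A S)) →L[ℝ] V} (h : IsCompactOperator (fun x : ZZ Γ => R (mkQL S x))) :
    IsCompactOperator R :=
  compact_of_comp (q := (mkQL S : ZZ Γ →L[ℝ] _)) (Submodule.isOpenMap_mkQ _)
    (Submodule.mkQ_surjective _) (map_zero _) h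

theorem spcX {S : Set ℕ} {e : ℕ} (h1 : e ∈ S) : ScalarPlusCompact (ZZ Γ ⧸ YY Γ (Γ.A S)) := fun T => by
  obtain ⟨lam, h⟩ := opX h1 (T.comp (mkQL S))
  exact ⟨lam, T - lam • ContinuousLinearMap.id ℝ _, desc h, by abel⟩

theorem mixX {S S' : Set ℕ} {e : ℕ} (h1 : e ∈ S') (h2 : e ∉ S)
    (T : (ZZ Γ ⧸ YY Γ (Γ.A S)) →L[ℝ] (ZZ Γ ⧸ YY Γ (Γ.A S'))) : IsCompactOperator T := by
  obtain ⟨lam, h⟩ := opX h1 (T.comp (mkQL S))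
  have h0 : -lam = 0 := mixed (Γ := Γ) h1 h2 (by
    have h3 := h.comp_clm (iY Γ S).toContinuousLinearMap
    refine cast (congrArg IsCompactOperator (funext fun x => ?_)) h3
    symm
    have : (mkQL S : ZZ Γ →L[ℝ] _) (x : ZZ Γ) = 0 :=
      (Submodule.Quotient.mk_eq_zero _).mpr x.2
    change (-lam) • mkQL S' (x : ZZ Γ) = T (mkQL S (x : ZZ Γ)) - lam • mkQL S' (x : ZZ Γ)
    rw [this, map_zero]; module)
  obtain rfl : lam = 0 := by linarith
  simp only [zero_smul, sub_zero] at h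
  exact desc h

theorem hiX (S : Set ℕ) : HereditarilyIndecomposable (ZZ Γ ⧸ YY Γ (Γ.A S)) := by
  have := YY_closed (Γ := Γ) (Γ.A S)
  exact thmHI (tgtQ Γ S)

/-- an antichain of size continuum -/
def SS (α : Set ℕ) : Set ℕ := {n | (n / 2 ∈ α ↔ n % 2 = 0)}

theorem SS_sep {α β : Set ℕ} (h : α ≠ β) : ∃ e, e ∈ SS β ∧ e ∉ SS α := by
  have : ∃ n, ¬ (n ∈ α ↔ n ∈ β) := by
    by_contra! hc; exact h (Set.ext hc)
  obtain ⟨n, hn⟩ := this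
  by_cases hb : n ∈ β
  · have ha : n ∉ α := by tauto
    exact ⟨2 * n, by simp [SS, hb], by simp [SS, ha]⟩
  · have ha : n ∈ α := by tauto
    have e1 : (2 * n + 1) / 2 = n := by omega
    have e2 : (2 * n + 1) % 2 = 1 := by omega
    exact ⟨2 * n + 1, by simp [SS, hb, e1, e2], by simp [SS, ha, e1, e2]⟩

theorem SS_mem (α : Set ℕ) : (∃ e, e ∈ SS α) ∧ ∃ e, e ∉ SS α := by
  have hne : α ≠ αᶜ := fun h => by
    have : 0 ∈ α ↔ 0 ∈ αᶜ := by rw [← h]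
    simp at this
  obtain ⟨e, -, he⟩ := SS_sep hne
  obtain ⟨f, hf, -⟩ := SS_sep hne.symm
  exact ⟨⟨f, hf⟩, ⟨e, he⟩⟩

theorem main_aux :
    ∃ (Z : Type) (_ : NormedAddCommGroup Z) (_ : NormedSpace ℝ Z) (_ : CompleteSpace Z)
      (I : Type) (Y : I → Submodule ℝ Z),
      Cardinal.mk I = Cardinal.continuum ∧
      (¬FiniteDimensional ℝ Z ∧ TopologicalSpace.SeparableSpace Z ∧
        IsLinftySpace Z ∧ HereditarilyIndecomposable Z ∧ ScalarPlusCompact Z) ∧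
      (∀ α : I, IsClosed (Y α : Set Z) ∧ ¬FiniteDimensional ℝ ↥(Y α) ∧
        IsLinftySpace ↥(Y α) ∧ ScalarPlusCompact ↥(Y α)) ∧
      (∀ α β : I, α ≠ β → ∀ T : ↥(Y α) →L[ℝ] ↥(Y β), IsCompactOperator T) ∧
      (∀ α : I, ¬FiniteDimensional ℝ (Z ⧸ Y α) ∧
        HereditarilyIndecomposable (Z ⧸ Y α) ∧ ScalarPlusCompact (Z ⧸ Y α)) ∧
      (∀ α β : I, α ≠ β → ∀ T : (Z ⧸ Y α) →L[ℝ] (Z ⧸ Y β), IsCompactOperator T) := by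
  obtain ⟨Γ⟩ := ex_Sys
  have hZ := linfty_emb (Γ := Γ) (LinearIsometry.id) inv_empty id_hr id_hr'
  refine ⟨ZZ Γ, inferInstance, inferInstance, inferInstance, Set ℕ,
    fun α => YY Γ (Γ.A (SS α)), by simp, ⟨infZ, hZ.2, hZ.1, thmHI (tgtId Γ), spcZ⟩,
    fun α => ?_, fun α β h T => ?_, fun α => ?_, fun α β h T => ?_⟩
  · obtain ⟨-, e, he⟩ := SS_mem α
    exact ⟨YY_closed _, infY he, (linfty_emb (iY Γ (SS α)) (inv_A _) iY_hr iY_hr').1, spcY he⟩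
  · obtain ⟨e, h1, h2⟩ := SS_sep h
    exact mixY h1 h2 T
  · obtain ⟨⟨e, he⟩, -⟩ := SS_mem α
    exact ⟨infX he, hiX _, spcX he⟩
  · obtain ⟨e, h1, h2⟩ := SS_sep h
    exact mixX h1 h2 T

end Sys
end AH

/-- **Statement 14.** There exist a separable infinite-dimensional hereditarily
indecomposable `L∞`-space `Z` with the scalar-plus-compact property and a continuum-sized
family `(Y_α)` of infinite-dimensional closed subspaces of `Z` such that each `Y_α` is an
`L∞`-space with the scalar-plus-compact property, operators between distinct `Y_α`'s are
compact, each quotient `Z/Y_α` is an infinite-dimensional hereditarily indecomposable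
space with the scalar-plus-compact property, and operators between distinct quotients are
compact. -/
theorem exists_continuum_subspaces_and_quotients :
    ∃ (Z : Type) (_ : NormedAddCommGroup Z) (_ : NormedSpace ℝ Z) (_ : CompleteSpace Z)
      (I : Type) (Y : I → Submodule ℝ Z),
      Cardinal.mk I = Cardinal.continuum ∧
      (¬FiniteDimensional ℝ Z ∧ TopologicalSpace.SeparableSpace Z ∧
        IsLinftySpace Z ∧ HereditarilyIndecomposable Z ∧ ScalarPlusCompact Z) ∧
      (∀ α : I, IsClosed (Y α : Set Z) ∧ ¬FiniteDimensional ℝ ↥(Y α) ∧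
        IsLinftySpace ↥(Y α) ∧ ScalarPlusCompact ↥(Y α)) ∧
      (∀ α β : I, α ≠ β → ∀ T : ↥(Y α) →L[ℝ] ↥(Y β), IsCompactOperator T) ∧
      (∀ α : I, ¬FiniteDimensional ℝ (Z ⧸ Y α) ∧
        HereditarilyIndecomposable (Z ⧸ Y α) ∧ ScalarPlusCompact (Z ⧸ Y α)) ∧
      (∀ α β : I, α ≠ β → ∀ T : (Z ⧸ Y α) →L[ℝ] (Z ⧸ Y β), IsCompactOperator T) := by
  exact AH.Sys.main_aux
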